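/- arXiv:2505.07092 — 3 statements merged into one kernel-verified Lean document; each statement's English description precedes it below -/
import Mathlib

section
/- Let p, q, s be distinct primes with p ≡ 5 (mod 8), s ≡ 3 (mod 8), q ≡ 7 (mod 8), and Legendre symbols (p/q) = (p/s) = (s/q) = 1, and let L = ℚ(√2, √(pq), √(ps), i). Then every unit of the ring of integers of L is of the form ζ₈ᵏ·u where ζ₈ is a primitive 8-th root of unity in L, k is an integer, and u is a unit of the ring of integers of L⁺; i.e., E_L = ⟨ζ₈⟩·E_{L⁺}. -/
open Real NumberField IntermediateField

noncomputable section

/-- The totally real multiquadratic field `L⁺ = ℚ(√2, √(pq), √(ps))`, realized as a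
subfield of `ℂ`. -/
def LplusC (p q s : ℕ) : IntermediateField ℚ ℂ :=
  adjoin ℚ {((Real.sqrt 2 : ℝ) : ℂ), ((Real.sqrt (p * q) : ℝ) : ℂ),
    ((Real.sqrt (p * s) : ℝ) : ℂ)}

/-- The primitive 8-th root of unity `ζ₈ = (√2 + i√2)/2` in `ℂ`. -/
def zeta8 : ℂ := ((Real.sqrt 2 : ℝ) + Complex.I * (Real.sqrt 2 : ℝ)) / 2

/-- The imaginary multiquadratic field `L = ℚ(√2, √(pq), √(ps), i)`, realized as a
subfield of `ℂ`. -/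
def Lfield (p q s : ℕ) : IntermediateField ℚ ℂ :=
  adjoin ℚ {((Real.sqrt 2 : ℝ) : ℂ), ((Real.sqrt (p * q) : ℝ) : ℂ),
    ((Real.sqrt (p * s) : ℝ) : ℂ), Complex.I}

lemma exists_add_mul_of_mem_adjoin_insert {F E : Type*} [Field F] [Field E] [Algebra F E]
    {S : Set E} {x y : E} (hy : y ^ 2 ∈ adjoin F S) (hx : x ∈ adjoin F (insert y S)) :
    ∃ u ∈ adjoin F S, ∃ v ∈ adjoin F S, x = u + v * y := by
  induction hx using adjoin_induction with
  | mem x hx =>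
    rcases hx with rfl | hx
    · exact ⟨0, zero_mem _, 1, one_mem _, by simp⟩
    · exact ⟨x, subset_adjoin F S hx, 0, zero_mem _, by simp⟩
  | algebraMap t => exact ⟨_, (adjoin F S).algebraMap_mem t, 0, zero_mem _, by simp⟩
  | add x z _ _ hx hz =>
    obtain ⟨u, hu, v, hv, rfl⟩ := hx
    obtain ⟨u', hu', v', hv', rfl⟩ := hz
    exact ⟨_, add_mem hu hu', _, add_mem hv hv', by ring⟩
  | mul x z _ _ hx hz =>
    obtain ⟨u, hu, v, hv, rfl⟩ := hx
    obtain ⟨u', hu', v', hv', rfl⟩ := hz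
    exact ⟨_, add_mem (mul_mem hu hu') (mul_mem (mul_mem hv hv') hy), _,
      add_mem (mul_mem hu hv') (mul_mem hv hu'), by ring⟩
  | inv x _ hx =>
    obtain ⟨u, hu, v, hv, rfl⟩ := hx
    by_cases h0 : u + v * y = 0
    · exact ⟨0, zero_mem _, 0, zero_mem _, by simp [h0]⟩
    by_cases hv0 : v = 0
    · exact ⟨u⁻¹, inv_mem hu, 0, zero_mem _, by simp [hv0]⟩
    by_cases h1 : u - v * y = 0
    · have hyS : y ∈ adjoin F S := by
        have : y = u / v := by field_simp; linear_combination -h1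
        exact this ▸ div_mem hu hv
      exact ⟨_, inv_mem (add_mem hu (mul_mem hv hyS)), 0, zero_mem _, by simp⟩
    · have hd : u ^ 2 - v ^ 2 * y ^ 2 ∈ adjoin F S :=
        sub_mem (pow_mem hu 2) (mul_mem (pow_mem hv 2) hy)
      have hd0 : u ^ 2 - v ^ 2 * y ^ 2 ≠ 0 := by
        rw [show u ^ 2 - v ^ 2 * y ^ 2 = (u - v * y) * (u + v * y) by ring]
        exact mul_ne_zero h1 h0
      refine ⟨_, div_mem hu hd, _, div_mem (neg_mem hv) hd, ?_⟩
      field_simp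
      ring

/-- A quadratic element of a quadratic extension comes, up to the generator, from the base. -/
lemma mem_or_mul_mem_adjoin_of_mem_adjoin_insert {E : Type*} [Field E] [Algebra ℚ E]
    {S : Set E} {x y : E} (hx2 : x ^ 2 ∈ adjoin ℚ S) (hy : y ^ 2 ∈ adjoin ℚ S)
    (hx : x ∈ adjoin ℚ (insert y S)) : x ∈ adjoin ℚ S ∨ x * y ∈ adjoin ℚ S := by
  have : CharZero E := algebraRat.charZero E
  obtain ⟨u, hu, v, hv, rfl⟩ := exists_add_mul_of_mem_adjoin_insert hy hx
  by_cases hu0 : u = 0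
  · right
    rw [hu0, show (0 + v * y) * y = v * y ^ 2 by ring]
    exact mul_mem hv hy
  by_cases hv0 : v = 0
  · left; simpa [hv0] using hu
  left
  have hyS : y ∈ adjoin ℚ S := by
    have : y = ((u + v * y) ^ 2 - u ^ 2 - v ^ 2 * y ^ 2) / (2 * u * v) := by
      field_simp; ring
    rw [this]
    exact div_mem (sub_mem (sub_mem hx2 (pow_mem hu 2)) (mul_mem (pow_mem hv 2) hy))
      (mul_mem (mul_mem (ofNat_mem _ 2) hu) hv)
  exact add_mem hu (mul_mem hv hyS)

/-- In a Galois extension, a square root outside of `K` is negated by some automorphism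
over `K`. -/
lemma exists_algEquiv_map_eq_neg {E : Type*} [Field E] [Algebra ℚ E] [IsGalois ℚ E]
    [FiniteDimensional ℚ E]
    {K : IntermediateField ℚ E} {x : E} (hx2 : x ^ 2 ∈ K) (hx : x ∉ K) :
    ∃ σ : E ≃ₐ[ℚ] E, (∀ u ∈ K, σ u = u) ∧ σ x = -x := by
  rw [← IsGalois.fixedField_fixingSubgroup K, mem_fixedField_iff] at hx
  push Not at hx
  obtain ⟨σ, hσ, hne⟩ := hx
  rw [IntermediateField.mem_fixingSubgroup_iff] at hσ
  refine ⟨σ, hσ, ?_⟩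
  have h := hσ _ hx2
  rw [map_pow] at h
  exact (sq_eq_sq_iff_eq_or_eq_neg.mp h).resolve_left hne

lemma not_mem_bot_of_sq_eq {E : Type*} [Field E] [Algebra ℚ E] {x : E} {l m : ℕ}
    (hl : l.Prime) (hm : ¬ l ∣ m) (hx : x ^ 2 = ((l * m : ℕ) : E)) :
    x ∉ adjoin ℚ (∅ : Set E) := by
  have : CharZero E := algebraRat.charZero E
  rw [adjoin_empty, mem_bot]
  rintro ⟨t, rfl⟩
  have h : t ^ 2 = ((l * m : ℕ) : ℚ) := by
    apply (algebraMap ℚ E).injective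
    rw [map_pow, hx, map_natCast]
  obtain ⟨k, hk⟩ := Rat.isSquare_natCast_iff.mp ⟨t, by rw [← h, sq]⟩
  have hlk : l ∣ k := by
    have : l ∣ k * k := hk ▸ dvd_mul_right l m
    exact (hl.dvd_mul.mp this).elim id id
  obtain ⟨j, rfl⟩ := hlk
  apply hm
  have : m = l * (j * j) := Nat.eq_of_mul_eq_mul_left hl.pos (by rw [hk]; ring)
  exact this ▸ dvd_mul_right _ _

lemma not_mem_bot_of_sq_eq_neg {E : Type*} [Field E] [Algebra ℚ E] {x : E} {m : ℕ}
    (hm : 0 < m) (hx : x ^ 2 = -(m : E)) : x ∉ adjoin ℚ (∅ : Set E) := by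
  have : CharZero E := algebraRat.charZero E
  rw [adjoin_empty, mem_bot]
  rintro ⟨t, rfl⟩
  have h : t ^ 2 = -(m : ℚ) := by
    apply (algebraMap ℚ E).injective
    rw [map_pow, hx, map_neg, map_natCast]
  have : (0 : ℚ) < m := by exact_mod_cast hm
  nlinarith [sq_nonneg t]

lemma Rat.exists_eq_intCast_of_squarefree_mul_sq {m : ℕ} (hm : Squarefree m) {t : ℚ} {N : ℤ}
    (h : (m : ℚ) * t ^ 2 = N) : ∃ z : ℤ, t = z := by
  have hm0 : (m : ℚ) ≠ 0 := by exact_mod_cast hm.ne_zero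
  have htint : IsIntegral ℤ ((m : ℚ) * t) := by
    refine IsIntegral.of_pow (n := 2) two_pos ?_
    rw [show ((m : ℚ) * t) ^ 2 = ((m * N : ℤ) : ℚ) by push_cast; rw [← h]; ring]
    exact isIntegral_algebraMap
  obtain ⟨k, hk⟩ := IsIntegrallyClosed.isIntegral_iff.mp htint
  have hk' : (k : ℚ) = m * t := by simpa using hk
  have hk2 : k ^ 2 = m * N := by
    have : (k : ℚ) ^ 2 = m * N := by rw [hk', ← h]; ring
    exact_mod_cast this
  have hdvd : (m : ℤ) ∣ k := by
    have hsq : Squarefree (m : ℤ) := Int.squarefree_natCast.mpr hm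
    exact (hsq.dvd_pow_iff_dvd two_ne_zero).mp (Dvd.intro _ hk2.symm)
  obtain ⟨z, rfl⟩ := hdvd
  refine ⟨z, ?_⟩
  push_cast at hk'
  exact (mul_left_cancel₀ hm0 hk').symm

/-- Integers of a quadratic field have half-integral coordinates. -/
lemma exists_two_mul_eq_of_isIntegral {E : Type*} [Field E] [Algebra ℚ E] [IsGalois ℚ E]
    [FiniteDimensional ℚ E] {m : ℕ} (hm : Squarefree m) {c g : E} (hc : c ^ 2 = m)
    (hcQ : c ∉ adjoin ℚ (∅ : Set E)) (hg : g ∈ adjoin ℚ {c}) (hgi : IsIntegral ℤ g) :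
    ∃ a b N : ℤ, 2 * g = a + b * c ∧ a ^ 2 - m * b ^ 2 = 4 * N := by
  have : CharZero E := algebraRat.charZero E
  have hc2 : c ^ 2 ∈ adjoin ℚ (∅ : Set E) := hc ▸ (adjoin ℚ (∅ : Set E)).natCast_mem m
  obtain ⟨ρ, -, hρ⟩ := exists_algEquiv_map_eq_neg hc2 hcQ
  rw [← insert_empty_eq] at hg
  obtain ⟨u, hu, v, hv, rfl⟩ := exists_add_mul_of_mem_adjoin_insert hc2 hg
  rw [adjoin_empty, mem_bot] at hu hv
  obtain ⟨u, rfl⟩ := hu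
  obtain ⟨v, rfl⟩ := hv
  have hconj : IsIntegral ℤ (ρ (algebraMap ℚ E u + algebraMap ℚ E v * c)) :=
    hgi.map (ρ.toAlgHom.restrictScalars ℤ)
  rw [map_add, map_mul, AlgEquiv.commutes, AlgEquiv.commutes, hρ] at hconj
  have rational : ∀ t : ℚ, IsIntegral ℤ (algebraMap ℚ E t) → ∃ z : ℤ, t = z := by
    intro t ht
    rw [isIntegral_algebraMap_iff (algebraMap ℚ E).injective] at ht
    obtain ⟨z, hz⟩ := IsIntegrallyClosed.isIntegral_iff.mp ht
    exact ⟨z, by simpa using hz.symm⟩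
  obtain ⟨a, ha⟩ := rational (2 * u) (by
    rw [show algebraMap ℚ E (2 * u) = (algebraMap ℚ E u + algebraMap ℚ E v * c) +
      (algebraMap ℚ E u + algebraMap ℚ E v * -c) by rw [map_mul, map_ofNat]; ring]
    exact hgi.add hconj)
  obtain ⟨N, hN⟩ := rational (u ^ 2 - m * v ^ 2) (by
    rw [show algebraMap ℚ E (u ^ 2 - m * v ^ 2) = (algebraMap ℚ E u + algebraMap ℚ E v * c) *
      (algebraMap ℚ E u + algebraMap ℚ E v * -c) by
        rw [map_sub, map_mul, map_pow, map_pow, map_natCast, ← hc]; ring]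
    exact hgi.mul hconj)
  obtain ⟨b, hb⟩ := Rat.exists_eq_intCast_of_squarefree_mul_sq hm (t := 2 * v)
    (N := a ^ 2 - 4 * N) (by push_cast; rw [← ha, ← hN]; ring)
  refine ⟨a, b, N, ?_, ?_⟩
  · have ha' := congrArg (algebraMap ℚ E) ha
    have hb' := congrArg (algebraMap ℚ E) hb
    rw [map_mul, map_ofNat, map_intCast] at ha' hb'
    rw [← ha', ← hb']
    ring
  · have : (a : ℚ) ^ 2 - m * b ^ 2 = 4 * N := by rw [← ha, ← hb, ← hN]; ring
    exact_mod_cast this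

lemma intCast_add_mul_injective {E : Type*} [Field E] [Algebra ℚ E] {c : E}
    (hcQ : c ∉ adjoin ℚ (∅ : Set E)) {a b a' b' : ℤ} (h : (a : E) + b * c = a' + b' * c) :
    a = a' ∧ b = b' := by
  have : CharZero E := algebraRat.charZero E
  by_cases hb : b = b'
  · subst hb
    exact ⟨by exact_mod_cast add_right_cancel h, rfl⟩
  · exfalso
    have hb' : (b : E) - b' ≠ 0 := sub_ne_zero.mpr (by exact_mod_cast hb)
    apply hcQ
    rw [show c = (a' - a) / (b - b') by field_simp; linear_combination h]
    exact div_mem (sub_mem (intCast_mem _ _) (intCast_mem _ _))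
      (sub_mem (intCast_mem _ _) (intCast_mem _ _))

lemma exists_two_mul_eq_of_isIntegral_inv {E : Type*} [Field E] [Algebra ℚ E] [IsGalois ℚ E]
    [FiniteDimensional ℚ E] {m : ℕ} (hm : Squarefree m) {c w : E} (hc : c ^ 2 = m)
    (hcQ : c ∉ adjoin ℚ (∅ : Set E)) (hw : w ∈ adjoin ℚ {c}) (hw0 : w ≠ 0)
    (hwi : IsIntegral ℤ w) (hwi' : IsIntegral ℤ w⁻¹) :
    ∃ a b : ℤ, 2 * w = a + b * c ∧ (a ^ 2 - m * b ^ 2 = 4 ∨ a ^ 2 - m * b ^ 2 = -4) := by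
  obtain ⟨a, b, N, hab, hN⟩ := exists_two_mul_eq_of_isIntegral hm hc hcQ hw hwi
  obtain ⟨a', b', N', hab', hN'⟩ := exists_two_mul_eq_of_isIntegral hm hc hcQ (inv_mem hw) hwi'
  refine ⟨a, b, hab, ?_⟩
  have hprod : (2 * w) * (2 * w⁻¹) = 4 := by field_simp; norm_num
  rw [hab, hab'] at hprod
  obtain ⟨h₁, h₂⟩ := intCast_add_mul_injective hcQ (a := a * a' + m * b * b')
    (b := a * b' + a' * b) (a' := 4) (b' := 0) (by
      push_cast; rw [← hc]; linear_combination hprod)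
  have hNN : N * N' = 1 := by
    have : 16 * (N * N') = 16 := by
      calc 16 * (N * N') = (4 * N) * (4 * N') := by ring
        _ = (a * a' + m * b * b') ^ 2 - m * (a * b' + a' * b) ^ 2 := by
          rw [← hN, ← hN']; ring
        _ = 16 := by rw [h₁, h₂]; norm_num
    omega
  rcases Int.eq_one_or_neg_one_of_mul_eq_one hNN with rfl | rfl
  · left; simpa using hN
  · right; simpa using hN

lemma isSquare_zmod_of_isCoprime_of_mul_eq {p q s : ℕ} (hq : q.Prime) (hs : s.Prime)
    (hn : IsSquare (-1 : ZMod p)) (hqp : IsSquare (q : ZMod p)) (hsp : IsSquare (s : ZMod p))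
    {x y c : ℤ} (hxy : IsCoprime x y) (h : x * y = q * s * c ^ 2) :
    IsSquare (x : ZMod p) := by
  have key : ∀ x' y' : ℤ, IsCoprime x' y' → x' * y' = c ^ 2 → IsSquare (x' : ZMod p) := by
    intro x' y' hco h'
    obtain ⟨z, hz | hz⟩ := Int.sq_of_isCoprime hco h'
    · rw [hz]; push_cast; exact IsSquare.sq _
    · rw [hz]; push_cast; rw [neg_eq_neg_one_mul]; exact hn.mul (IsSquare.sq _)
  have hq' : Prime (q : ℤ) := Nat.prime_iff_prime_int.mp hq
  have hs' : Prime (s : ℤ) := Nat.prime_iff_prime_int.mp hs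
  have hsplit : ∀ {r : ℤ} {x y d : ℤ}, Prime r → x * y = r * d →
      (∃ x', x = r * x' ∧ x' * y = d) ∨ (∃ y', y = r * y' ∧ x * y' = d) := by
    intro r x y d hr h
    rcases hr.dvd_or_dvd (h ▸ dvd_mul_right r d) with ⟨x', rfl⟩ | ⟨y', rfl⟩
    · exact .inl ⟨x', rfl, mul_left_cancel₀ hr.ne_zero (by rw [← h]; ring)⟩
    · exact .inr ⟨y', rfl, mul_left_cancel₀ hr.ne_zero (by rw [← h]; ring)⟩
  rw [mul_assoc] at h
  rcases hsplit hq' h with ⟨x, rfl, hx⟩ | ⟨y, rfl, hx⟩ <;>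
    rcases hsplit hs' hx with ⟨x, rfl, hy⟩ | ⟨y, rfl, hy⟩
  · push_cast
    exact hqp.mul (hsp.mul (key _ _ hxy.of_mul_left_right.of_mul_left_right hy))
  · push_cast
    exact hqp.mul (key _ _ hxy.of_mul_left_right.of_mul_right_right hy)
  · push_cast
    exact hsp.mul (key _ _ hxy.of_mul_left_right.of_mul_right_right hy)
  · exact key _ _ hxy.of_mul_right_right.of_mul_right_right hy

lemma isSquare_zmod_add_two_of_sq_sub_mul_sq_eq_four {p q s : ℕ} (hq : q.Prime) (hs : s.Prime)
    (hqs : q * s % 8 = 5)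
    (hn : IsSquare (-1 : ZMod p)) (hqp : IsSquare (q : ZMod p)) (hsp : IsSquare (s : ZMod p))
    {a b : ℤ} (h : a ^ 2 - q * s * b ^ 2 = 4) :
    IsSquare ((a : ZMod p) + 2) := by
  obtain ⟨m, hm⟩ : ∃ m : ℤ, (q * s : ℤ) = 8 * m + 5 :=
    ⟨(q * s : ℤ) / 8, by have : (q * s : ℤ) % 8 = 5 := by exact_mod_cast hqs
                         omega⟩
  rcases Int.even_or_odd' a with ⟨a, rfl | rfl⟩
  · rcases Int.even_or_odd' b with ⟨b, rfl | rfl⟩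
    · rcases Int.even_or_odd' b with ⟨b, rfl | rfl⟩
      · rcases Int.even_or_odd' a with ⟨a, rfl | rfl⟩
        · exfalso
          have : 4 * (a ^ 2 - q * s * b ^ 2) = 1 := by linarith
          omega
        · have hsq : IsSquare (((a + 1 : ℤ)) : ZMod p) := by
            refine isSquare_zmod_of_isCoprime_of_mul_eq hq hs hn hqp hsp (y := a) (c := b)
              ⟨1, -1, by ring⟩ (by linarith)
          have h4 : IsSquare (4 : ZMod p) := ⟨2, by norm_num⟩
          have := h4.mul hsq
          push_cast at this ⊢
          rwa [show (2 * (2 * a + 1) + 2 : ZMod p) = 4 * (a + 1) by ring]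
      · exfalso
        rw [hm] at h
        rcases Int.even_or_odd' a with ⟨a, rfl | rfl⟩
        · have : 4 * (a ^ 2 - (8 * m + 5) * (b ^ 2 + b) - 2 * m) = 6 := by linarith
          omega
        · have : 4 * (a ^ 2 + a - (8 * m + 5) * (b ^ 2 + b) - 2 * m) = 5 := by linarith
          omega
    · exfalso
      rw [hm] at h
      have : 4 * (a ^ 2 - (8 * m + 5) * (b ^ 2 + b) - 2 * m) = 9 := by linarith
      omega
  · have := isSquare_zmod_of_isCoprime_of_mul_eq hq hs hn hqp hsp (x := 2 * a + 1 + 2)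
      (y := 2 * a + 1 - 2) (c := b) ?_ (by linarith)
    · exact_mod_cast this
    · have hco : IsCoprime (2 * a + 1 - 2) ((2 : ℤ) ^ 2) := IsCoprime.pow_right ⟨1, 1 - a, by ring⟩
      have h4 : 2 * a + 1 + 2 = 2 ^ 2 + (2 * a + 1 - 2) * 1 := by ring
      rw [h4]
      exact (hco.add_mul_left_right 1).symm

lemma two_mul_unit_ne_norm {p q s : ℕ} (hp : p.Prime) (hq : q.Prime) (hs : s.Prime)
    (hpq : p ≠ q) (hps : p ≠ s) (hp8 : p % 8 = 5) (hqs : q * s % 8 = 5)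
    (hqp : IsSquare (q : ZMod p)) (hsp : IsSquare (s : ZMod p))
    {a b e f g h : ℤ} (hab : a ^ 2 - q * s * b ^ 2 = 4)
    (h₁ : 16 * q * a = q * (e ^ 2 + q * s * f ^ 2) - p * (g ^ 2 + q * s * h ^ 2))
    (h₂ : 16 * q * b = 2 * q * e * f - 2 * p * g * h) : False := by
  have : Fact p.Prime := ⟨hp⟩
  have hp2 : p ≠ 2 := by rintro rfl; omega
  have hn : IsSquare (-1 : ZMod p) := ZMod.exists_sq_eq_neg_one_iff.mpr (by omega)
  have h2 : ¬ IsSquare (2 : ZMod p) := by rw [ZMod.exists_sq_eq_two_iff hp2]; omega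
  have ha2 := isSquare_zmod_add_two_of_sq_sub_mul_sq_eq_four hq hs hqs hn hqp hsp hab
  have hq0 : (q : ZMod p) ≠ 0 := by
    rw [Ne, ZMod.natCast_eq_zero_iff, Nat.prime_dvd_prime_iff_eq hp hq]; exact hpq
  have hs0 : (s : ZMod p) ≠ 0 := by
    rw [Ne, ZMod.natCast_eq_zero_iff, Nat.prime_dvd_prime_iff_eq hp hs]; exact hps
  obtain ⟨r, hr⟩ := hqp.mul hsp
  have hr0 : r ≠ 0 := by rintro rfl; exact mul_ne_zero hq0 hs0 (by simpa using hr)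
  have hab' := congrArg (Int.cast : ℤ → ZMod p) hab
  have h₁' := congrArg (Int.cast : ℤ → ZMod p) h₁
  have h₂' := congrArg (Int.cast : ℤ → ZMod p) h₂
  push_cast at hab' h₁' h₂'
  rw [ZMod.natCast_self p] at h₁' h₂'
  generalize (a : ZMod p) = a at *
  generalize (b : ZMod p) = b at *
  generalize (e : ZMod p) = e at *
  generalize (f : ZMod p) = f at *
  have hsq : 16 * (a + b * r) = (e + f * r) ^ 2 := by
    refine mul_left_cancel₀ hq0 ?_
    linear_combination h₁' + r * h₂' + q * f ^ 2 * hr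
  have h4 : (4 : ZMod p) ≠ 0 := by
    intro h
    have : (2 : ZMod p) = 0 := by
      have : (2 : ZMod p) * 2 = 0 := by rw [← h]; norm_num
      simpa using this
    exact h2 ⟨0, by rw [this]; simp⟩
  have hone : (a + b * r) * (a - b * r) = 4 := by
    linear_combination hab' + b ^ 2 * hr
  have hunit : a + b * r ≠ 0 := by
    intro h; rw [h, zero_mul] at hone; exact h4 hone.symm
  have hsq' : IsSquare (a + b * r) := by
    refine ⟨(e + f * r) / 4, ?_⟩
    field_simp
    linear_combination hsq
  have hmul : 2 * (a + 2) * (a + b * r) = (a + 2 + b * r) ^ 2 := by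
    linear_combination hab' + b ^ 2 * hr
  by_cases h0 : a + 2 = 0
  · have hb : b = 0 := by
      have : (b * r) ^ 2 = 0 := by
        linear_combination -hmul + (2 * (a + b * r) - (a + 2) - 2 * b * r) * h0
      simpa [hr0] using this
    apply h2
    have : (2 : ZMod p) = -1 * (a + b * r) := by rw [hb]; linear_combination h0
    rw [this]
    exact hn.mul hsq'
  · apply h2
    have : (2 : ZMod p) = (a + 2 + b * r) ^ 2 / ((a + 2) * (a + b * r)) := by
      rw [← hmul]; field_simp
    rw [this]
    exact (IsSquare.sq _).div (ha2.mul hsq')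

lemma sq_sub_mul_sq_ne_neg_four {q s : ℕ} (hq : q.Prime) (hq4 : q % 4 = 3) (a b : ℤ) :
    a ^ 2 - q * s * b ^ 2 ≠ -4 := by
  intro h
  have : Fact q.Prime := ⟨hq⟩
  have h' := congrArg (Int.cast : ℤ → ZMod q) h
  push_cast at h'
  rw [ZMod.natCast_self, zero_mul, zero_mul, sub_zero] at h'
  have h2 : (2 : ZMod q) ≠ 0 := by
    intro h2
    have := (ZMod.natCast_eq_zero_iff 2 q).mp (by exact_mod_cast h2)
    rw [Nat.prime_dvd_prime_iff_eq hq Nat.prime_two] at this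
    omega
  refine ZMod.mod_four_ne_three_of_sq_eq_neg_one (p := q) (y := a / 2) ?_ hq4
  field_simp
  rw [h']; norm_num

section Multiquadratic

variable {E : Type*} [Field E] [Algebra ℚ E] {p q s : ℕ} {r a c i : E}

lemma not_mem_bot_of_sq_eq_mul (hq : q.Prime) (hs : s.Prime) (hqs : q ≠ s)
    (hc : c ^ 2 = (q * s : ℕ)) : c ∉ adjoin ℚ (∅ : Set E) :=
  not_mem_bot_of_sq_eq hq (by rwa [Nat.prime_dvd_prime_iff_eq hq hs]) hc

lemma sqrt_two_mul_not_mem_adjoin {n : ℕ} (hn2 : ¬ 2 ∣ n) (hp2 : ¬ 2 ∣ p) (hq2 : ¬ 2 ∣ q) (hs2 : ¬ 2 ∣ s)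
    (hr : r ^ 2 = (2 * n : ℕ)) (ha : a ^ 2 = (p * q : ℕ)) (hc : c ^ 2 = (q * s : ℕ)) :
    r ∉ adjoin ℚ {a, c} := by
  intro h
  have hnat : ∀ (S : Set E) (n : ℕ), (n : E) ∈ adjoin ℚ S := fun S n ↦
    (adjoin ℚ S).natCast_mem n
  have hr' : ∀ S : Set E, r ^ 2 ∈ adjoin ℚ S := fun S ↦ hr ▸ hnat S _
  have ha' : ∀ S : Set E, a ^ 2 ∈ adjoin ℚ S := fun S ↦ ha ▸ hnat S _
  have hc' : ∀ S : Set E, c ^ 2 ∈ adjoin ℚ S := fun S ↦ hc ▸ hnat S _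
  have hra' : ∀ S : Set E, (r * a) ^ 2 ∈ adjoin ℚ S := fun S ↦
    mul_pow r a 2 ▸ mul_mem (hr' S) (ha' S)
  have hodd : ∀ m n : ℕ, ¬ 2 ∣ m → ¬ 2 ∣ n → ¬ 2 ∣ m * n := fun m n hm hn ↦
    Nat.Prime.not_dvd_mul Nat.prime_two hm hn
  rcases mem_or_mul_mem_adjoin_of_mem_adjoin_insert (hr' _) (ha' _) h with h | h <;>
    rw [← insert_empty_eq] at h
  · rcases mem_or_mul_mem_adjoin_of_mem_adjoin_insert (hr' _) (hc' _) h with h | h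
    · exact not_mem_bot_of_sq_eq Nat.prime_two hn2 hr h
    · exact not_mem_bot_of_sq_eq Nat.prime_two (hodd _ _ hn2 (hodd _ _ hq2 hs2))
        (by rw [mul_pow, hr, hc]; push_cast; ring) h
  · rcases mem_or_mul_mem_adjoin_of_mem_adjoin_insert (hra' _) (hc' _) h with h | h
    · exact not_mem_bot_of_sq_eq Nat.prime_two (hodd _ _ hn2 (hodd _ _ hp2 hq2))
        (by rw [mul_pow, hr, ha]; push_cast; ring) h
    · exact not_mem_bot_of_sq_eq Nat.prime_two
        (hodd _ _ hn2 (hodd _ _ (hodd _ _ hp2 hq2) (hodd _ _ hq2 hs2)))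
        (by rw [mul_pow, mul_pow, hr, hc, ha]; push_cast; ring) h

lemma sqrt_mul_not_mem_adjoin (hp : p.Prime) (hp2 : ¬ p ∣ 2) (hpq : ¬ p ∣ q) (hps : ¬ p ∣ s)
    (hr : r ^ 2 = 2) (ha : a ^ 2 = (p * q : ℕ)) (hc : c ^ 2 = (q * s : ℕ)) :
    a ∉ adjoin ℚ {r, c} := by
  intro h
  have hnat : ∀ (S : Set E) (n : ℕ), (n : E) ∈ adjoin ℚ S := fun S n ↦
    (adjoin ℚ S).natCast_mem n
  have hr' : ∀ S : Set E, r ^ 2 ∈ adjoin ℚ S := fun S ↦ by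
    rw [hr]; exact_mod_cast hnat S 2
  have ha' : ∀ S : Set E, a ^ 2 ∈ adjoin ℚ S := fun S ↦ ha ▸ hnat S _
  have hc' : ∀ S : Set E, c ^ 2 ∈ adjoin ℚ S := fun S ↦ hc ▸ hnat S _
  have har' : ∀ S : Set E, (a * r) ^ 2 ∈ adjoin ℚ S := fun S ↦
    mul_pow a r 2 ▸ mul_mem (ha' S) (hr' S)
  rcases mem_or_mul_mem_adjoin_of_mem_adjoin_insert (ha' _) (hr' _) h with h | h <;>
    rw [← insert_empty_eq] at h
  · rcases mem_or_mul_mem_adjoin_of_mem_adjoin_insert (ha' _) (hc' _) h with h | h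
    · exact not_mem_bot_of_sq_eq hp hpq ha h
    · exact not_mem_bot_of_sq_eq hp (m := q * (q * s))
        (hp.not_dvd_mul hpq (hp.not_dvd_mul hpq hps))
        (by rw [mul_pow, ha, hc]; push_cast; ring) h
  · rcases mem_or_mul_mem_adjoin_of_mem_adjoin_insert (har' _) (hc' _) h with h | h
    · exact not_mem_bot_of_sq_eq hp (hp.not_dvd_mul hp2 hpq)
        (by rw [mul_pow, hr, ha]; push_cast; ring) h
    · exact not_mem_bot_of_sq_eq hp (m := 2 * q * (q * s))
        (hp.not_dvd_mul (hp.not_dvd_mul hp2 hpq) (hp.not_dvd_mul hpq hps))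
        (by rw [mul_pow, mul_pow, hr, hc, ha]; push_cast; ring) h

/-- A unit multiple of `2 + √2` is not a square in `ℚ(√2, √(pq), √(qs))`. -/
lemma sq_ne_two_add_sqrt_two_mul_unit [IsGalois ℚ E] [FiniteDimensional ℚ E]
    (hp : p.Prime) (hq : q.Prime) (hs : s.Prime) (hpq : p ≠ q) (hps : p ≠ s) (hqs : q ≠ s)
    (hp8 : p % 8 = 5) (hs8 : s % 8 = 3) (hq8 : q % 8 = 7)
    (hqp : IsSquare (q : ZMod p)) (hsp : IsSquare (s : ZMod p))
    (hr : r ^ 2 = 2) (ha : a ^ 2 = (p * q : ℕ)) (hc : c ^ 2 = (q * s : ℕ))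
    {x η : E} (hx : x ∈ adjoin ℚ {r, a, c}) (hη0 : η ≠ 0) (hη : IsIntegral ℤ η)
    (hη' : IsIntegral ℤ η⁻¹) : x ^ 2 ≠ (2 + r) * η := by
  intro hxη
  have : CharZero E := algebraRat.charZero E
  have hqs8 : q * s % 8 = 5 := by rw [Nat.mul_mod, hq8, hs8]
  have hpq' : ¬ p ∣ q := by rwa [Nat.prime_dvd_prime_iff_eq hp hq]
  have hps' : ¬ p ∣ s := by rwa [Nat.prime_dvd_prime_iff_eq hp hs]
  have hp2' : ¬ p ∣ 2 := by rw [Nat.prime_dvd_prime_iff_eq hp Nat.prime_two]; omega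
  have hcQ := not_mem_bot_of_sq_eq_mul hq hs hqs hc
  have hsf : Squarefree (q * s) :=
    (Nat.squarefree_mul ((Nat.coprime_primes hq hs).mpr hqs)).mpr ⟨hq.squarefree, hs.squarefree⟩
  have hp0 : (p : E) ≠ 0 := by exact_mod_cast hp.ne_zero
  have hnat : ∀ (S : Set E) (n : ℕ), (n : E) ∈ adjoin ℚ S := fun S n ↦
    (adjoin ℚ S).natCast_mem n
  have hr' : ∀ S : Set E, r ^ 2 ∈ adjoin ℚ S := fun S ↦ by
    rw [hr]; exact_mod_cast hnat S 2
  have ha' : ∀ S : Set E, a ^ 2 ∈ adjoin ℚ S := fun S ↦ ha ▸ hnat S _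
  obtain ⟨τ, hτ, hτr⟩ := exists_algEquiv_map_eq_neg (hr' _)
    (sqrt_two_mul_not_mem_adjoin (n := 1) (by omega) (by omega) (by omega) (by omega)
      (by rw [hr]; norm_num) ha hc)
  obtain ⟨σ, hσ, hσa⟩ := exists_algEquiv_map_eq_neg (ha' _)
    (sqrt_mul_not_mem_adjoin hp hp2' hpq' hps' hr ha hc)
  have map_int (ρ : E ≃ₐ[ℚ] E) {g : E} (hg : IsIntegral ℤ g) : IsIntegral ℤ (ρ g) :=
    hg.map (ρ.toAlgHom.restrictScalars ℤ)
  have natCast_int (n : ℕ) : IsIntegral ℤ (n : E) := by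
    exact_mod_cast isIntegral_algebraMap (R := ℤ) (A := E) (x := (n : ℤ))
  have two_int : IsIntegral ℤ (2 : E) := by exact_mod_cast natCast_int 2
  -- The relative norm `y` of `x` to `ℚ(√(pq), √(qs))`.
  obtain ⟨A, hA, B, hB, hxAB⟩ := exists_add_mul_of_mem_adjoin_insert (hr' _) hx
  have hτx : τ x = A - B * r := by
    rw [hxAB, map_add, map_mul, hτ A hA, hτ B hB, hτr]; ring
  obtain ⟨y, hy⟩ : ∃ y, y = x * τ x := ⟨_, rfl⟩
  have hymem : y ∈ adjoin ℚ {a, c} := by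
    rw [hy, hτx, hxAB, show (A + B * r) * (A - B * r) = A ^ 2 - B ^ 2 * r ^ 2 by ring]
    exact sub_mem (pow_mem hA 2) (mul_mem (pow_mem hB 2) (hr' _))
  have hy2 : y ^ 2 = 2 * (η * τ η) := by
    have h2 : τ x ^ 2 = (2 - r) * τ η := by
      rw [← map_pow, hxη, map_mul, map_add, hτr, map_ofNat]; ring
    rw [hy, mul_pow, hxη, h2]
    linear_combination -(η * τ η) * hr
  have hxi : IsIntegral ℤ x := by
    have hri : IsIntegral ℤ r := .of_pow two_pos (hr ▸ two_int)
    exact .of_pow two_pos (hxη ▸ (two_int.add hri).mul hη)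
  have hyi : IsIntegral ℤ y := hy ▸ hxi.mul (map_int τ hxi)
  -- The relative norm `2 * w` of `y` to `ℚ(√(qs))`.
  obtain ⟨α, hα, β, hβ, hyαβ⟩ := exists_add_mul_of_mem_adjoin_insert (ha' _) hymem
  have hle : adjoin ℚ {c} ≤ adjoin ℚ {r, c} := adjoin.mono _ _ _ (by simp)
  have hσy : σ y = α - β * a := by
    rw [hyαβ, map_add, map_mul, hσ α (hle hα), hσ β (hle hβ), hσa]; ring
  have hσyi := map_int σ hyi
  obtain ⟨w, hw⟩ : ∃ w, w = y * σ y / 2 := ⟨_, rfl⟩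
  have hwmem : w ∈ adjoin ℚ {c} := by
    rw [hw, hσy, hyαβ, show (α + β * a) * (α - β * a) = α ^ 2 - β ^ 2 * a ^ 2 by ring]
    exact div_mem (sub_mem (pow_mem hα 2) (mul_mem (pow_mem hβ 2) (ha' _))) (ofNat_mem _ 2)
  have hw2 : w ^ 2 = (η * τ η) * σ (η * τ η) := by
    have h2 : σ y ^ 2 = 2 * σ (η * τ η) := by
      rw [← map_pow, hy2, map_mul, map_ofNat]
    rw [hw, div_pow, mul_pow, hy2, h2]; ring
  have hw0 : w ≠ 0 := by
    intro h
    rw [h, zero_pow two_ne_zero] at hw2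
    simp [hη0] at hw2
  have hwi : IsIntegral ℤ w := by
    have h1 := hη.mul (map_int τ hη)
    exact .of_pow two_pos (hw2 ▸ h1.mul (map_int σ h1))
  have hwi' : IsIntegral ℤ w⁻¹ := by
    have h1 := hη'.mul (map_int τ hη')
    refine .of_pow two_pos (n := 2) ?_
    rw [inv_pow, hw2]
    simpa [mul_comm, mul_left_comm, mul_assoc] using h1.mul (map_int σ h1)
  obtain ⟨a₀, b₀, hab, hN⟩ := exists_two_mul_eq_of_isIntegral_inv hsf hc hcQ hwmem hw0 hwi hwi'
  push_cast at hN
  replace hN := hN.resolve_right (sq_sub_mul_sq_ne_neg_four hq (by omega) _ _)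
  -- The trace and the different part of `y` over `ℚ(√(qs))`.
  obtain ⟨e, f, -, hef, -⟩ := exists_two_mul_eq_of_isIntegral hsf hc hcQ (g := y + σ y)
    (by
      rw [hσy, hyαβ, show α + β * a + (α - β * a) = 2 * α by ring]
      exact mul_mem (ofNat_mem _ 2) hα)
    (hyi.add hσyi)
  have hai : IsIntegral ℤ a := .of_pow two_pos (ha ▸ natCast_int _)
  obtain ⟨g, h, -, hgh, -⟩ := exists_two_mul_eq_of_isIntegral hsf hc hcQ (g := (y - σ y) * a)
    (by
      rw [hσy, hyαβ, show (α + β * a - (α - β * a)) * a = 2 * β * a ^ 2 by ring]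
      exact mul_mem (mul_mem (ofNat_mem _ 2) hβ) (ha' _))
    ((hyi.sub hσyi).mul hai)
  obtain ⟨k, l, -, hkl, -⟩ := exists_two_mul_eq_of_isIntegral hsf hc hcQ (g := (y - σ y) ^ 2)
    (by
      rw [hσy, hyαβ, show (α + β * a - (α - β * a)) ^ 2 = (2 * β) ^ 2 * a ^ 2 by ring]
      exact mul_mem (pow_mem (mul_mem (ofNat_mem _ 2) hβ) 2) (ha' _))
    ((hyi.sub hσyi).pow 2)
  push_cast at ha hc
  have hdiff : ((g : E) + h * c) ^ 2 = 2 * p * q * (k + l * c) := by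
    rw [← hgh, ← hkl]; linear_combination 4 * (y - σ y) ^ 2 * ha
  obtain ⟨h₁, h₂⟩ := intCast_add_mul_injective hcQ (a := g ^ 2 + q * s * h ^ 2)
    (b := 2 * g * h) (a' := 2 * p * q * k) (b' := 2 * p * q * l) (by
      push_cast; linear_combination hdiff - h ^ 2 * hc)
  have hpZ : Prime (p : ℤ) := Nat.prime_iff_prime_int.mp hp
  have hpqs : ¬ (p : ℤ) ∣ q * s := by exact_mod_cast hp.not_dvd_mul hpq' hps'
  have hdvd : (p : ℤ) ∣ g ∧ (p : ℤ) ∣ h := by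
    have hgh' : (p : ℤ) ∣ g * h := ⟨q * l, by linarith⟩
    have hsum : (p : ℤ) ∣ g ^ 2 + q * s * h ^ 2 := ⟨2 * q * k, by linarith⟩
    rcases hpZ.dvd_or_dvd hgh' with hd | hd
    · refine ⟨hd, ?_⟩
      rw [dvd_add_right (dvd_pow hd two_ne_zero)] at hsum
      exact hpZ.dvd_of_dvd_pow ((hpZ.dvd_or_dvd hsum).resolve_left hpqs)
    · refine ⟨?_, hd⟩
      rw [dvd_add_left (Dvd.dvd.mul_left (dvd_pow hd two_ne_zero) _)] at hsum
      exact hpZ.dvd_of_dvd_pow hsum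
  obtain ⟨⟨g, rfl⟩, ⟨h, rfl⟩⟩ := hdvd
  push_cast at hdiff
  have hdiff' : (p : E) * (g + h * c) ^ 2 = 4 * q * (y - σ y) ^ 2 := by
    refine mul_left_cancel₀ hp0 ?_
    linear_combination hdiff - 2 * p * q * hkl
  have hfinal : 16 * (q : E) * (a₀ + b₀ * c) = q * (e + f * c) ^ 2 - p * (g + h * c) ^ 2 := by
    rw [hdiff', ← hab, ← hef, hw]; ring
  obtain ⟨h₃, h₄⟩ := intCast_add_mul_injective hcQ (a := 16 * q * a₀) (b := 16 * q * b₀)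
    (a' := q * (e ^ 2 + q * s * f ^ 2) - p * (g ^ 2 + q * s * h ^ 2))
    (b' := 2 * q * e * f - 2 * p * g * h) (by
      push_cast; linear_combination hfinal + (q * f ^ 2 - p * h ^ 2) * hc)
  exact two_mul_unit_ne_norm hp hq hs hpq hps hp8 hqs8 hqp hsp hN h₃ h₄

lemma exists_sq_eq_neg_of_mem_adjoin_insert {S : Set E} {x y : E} {m n : ℕ} (hm : 0 < m)
    (hn : 0 < n) (hx : x ^ 2 = -(n : E)) (hy : y ^ 2 = (m : E)) (h : x ∈ adjoin ℚ (insert y S)) :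
    ∃ z ∈ adjoin ℚ S, ∃ k : ℕ, 0 < k ∧ z ^ 2 = -(k : E) := by
  rcases mem_or_mul_mem_adjoin_of_mem_adjoin_insert
    (hx ▸ neg_mem ((adjoin ℚ S).natCast_mem n)) (hy ▸ (adjoin ℚ S).natCast_mem m) h with h | h
  · exact ⟨x, h, n, hn, hx⟩
  · exact ⟨x * y, h, n * m, Nat.mul_pos hn hm, by rw [mul_pow, hx, hy]; push_cast; ring⟩

lemma sqrt_neg_not_mem_adjoin (hp : 0 < p) (hq : 0 < q) (hs : 0 < s) {x : E} {n : ℕ} (hn : 0 < n)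
    (hx : x ^ 2 = -(n : E)) (hr : r ^ 2 = 2) (ha : a ^ 2 = (p * q : ℕ))
    (hc : c ^ 2 = (q * s : ℕ)) : x ∉ adjoin ℚ {r, a, c} := by
  intro h
  obtain ⟨x, h, n, hn, hx⟩ := exists_sq_eq_neg_of_mem_adjoin_insert two_pos hn hx
    (by exact_mod_cast hr) h
  obtain ⟨x, h, n, hn, hx⟩ := exists_sq_eq_neg_of_mem_adjoin_insert (Nat.mul_pos hp hq) hn hx ha h
  rw [← insert_empty_eq] at h
  obtain ⟨x, h, n, hn, hx⟩ := exists_sq_eq_neg_of_mem_adjoin_insert (Nat.mul_pos hq hs) hn hx hc h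
  exact not_mem_bot_of_sq_eq_neg hn hx h

lemma sqrt_three_not_mem_adjoin (hp : p.Prime) (hq : q.Prime) (hp2 : ¬ 2 ∣ p) (hq2 : ¬ 2 ∣ q)
    (hs2 : ¬ 2 ∣ s) (hp3 : ¬ p ∣ 3) (hq3 : ¬ q ∣ 3) (hpq : ¬ p ∣ q) (hps : ¬ p ∣ s) (hqs : ¬ q ∣ s)
    (hr : r ^ 2 = 2) (ha : a ^ 2 = (p * q : ℕ)) (hc : c ^ 2 = (q * s : ℕ))
    {x : E} (hx : x ^ 2 = 3) : x ∉ adjoin ℚ {r, a, c} := by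
  intro h
  have hnat : ∀ (S : Set E) (n : ℕ), (n : E) ∈ adjoin ℚ S := fun S n ↦
    (adjoin ℚ S).natCast_mem n
  have hr' : ∀ S : Set E, r ^ 2 ∈ adjoin ℚ S := fun S ↦ by
    rw [hr]; exact_mod_cast hnat S 2
  have hx' : ∀ S : Set E, x ^ 2 ∈ adjoin ℚ S := fun S ↦ by
    rw [hx]; exact_mod_cast hnat S 3
  have ha' : ∀ S : Set E, a ^ 2 ∈ adjoin ℚ S := fun S ↦ ha ▸ hnat S _
  have hc' : ∀ S : Set E, c ^ 2 ∈ adjoin ℚ S := fun S ↦ hc ▸ hnat S _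
  have hxa' : ∀ S : Set E, (x * a) ^ 2 ∈ adjoin ℚ S := fun S ↦
    mul_pow x a 2 ▸ mul_mem (hx' S) (ha' S)
  rcases mem_or_mul_mem_adjoin_of_mem_adjoin_insert (hx' _) (hr' _) h with h | h
  · rcases mem_or_mul_mem_adjoin_of_mem_adjoin_insert (hx' _) (ha' _) h with h | h <;>
      rw [← insert_empty_eq] at h
    · rcases mem_or_mul_mem_adjoin_of_mem_adjoin_insert (hx' _) (hc' _) h with h | h
      · exact not_mem_bot_of_sq_eq Nat.prime_three (m := 1) (by norm_num)
          (by rw [hx]; norm_num) h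
      · exact not_mem_bot_of_sq_eq hq (hq.not_dvd_mul hq3 hqs)
          (by rw [mul_pow, hx, hc]; push_cast; ring) h
    · rcases mem_or_mul_mem_adjoin_of_mem_adjoin_insert (hxa' _) (hc' _) h with h | h
      · exact not_mem_bot_of_sq_eq hp (hp.not_dvd_mul hp3 hpq)
          (by rw [mul_pow, hx, ha]; push_cast; ring) h
      · exact not_mem_bot_of_sq_eq hp (m := 3 * q * (q * s))
          (hp.not_dvd_mul (hp.not_dvd_mul hp3 hpq) (hp.not_dvd_mul hpq hps))
          (by rw [mul_pow, mul_pow, hx, hc, ha]; push_cast; ring) h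
  · exact sqrt_two_mul_not_mem_adjoin (n := 3) (by norm_num) hp2 hq2 hs2
      (by rw [mul_pow, hx, hr]; norm_num) ha hc h

lemma exists_algEquiv_eq_pow_of_coprime [IsGalois ℚ E] {v : E} {n m : ℕ} (hn : 0 < n)
    (hv : v ^ n = 1) (hm : m.Coprime n) : ∃ σ : E ≃ₐ[ℚ] E, σ v = v ^ m := by
  have : CharZero E := algebraRat.charZero E
  have hfin : IsOfFinOrder v := isOfFinOrder_iff_pow_eq_one.mpr ⟨n, hn, hv⟩
  have hprim := IsPrimitiveRoot.orderOf v
  have hm' : m.Coprime (orderOf v) := hm.coprime_dvd_right (orderOf_dvd_of_pow_eq_one hv)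
  have hv_int : IsIntegral ℚ v := (hprim.isIntegral hfin.orderOf_pos).tower_top
  refine minpoly.exists_algEquiv_of_root' hv_int.isAlgebraic ?_
  have hroot {z : E} (hz : IsPrimitiveRoot z (orderOf v)) :
      Polynomial.aeval z (Polynomial.cyclotomic (orderOf v) ℚ) = 0 := by
    rw [Polynomial.aeval_def, ← Polynomial.eval_map, Polynomial.map_cyclotomic]
    exact hz.isRoot_cyclotomic hfin.orderOf_pos
  rw [← minpoly.eq_of_irreducible_of_monic (Polynomial.cyclotomic.irreducible_rat hfin.orderOf_pos)
    (hroot hprim) (Polynomial.cyclotomic.monic _ ℚ)]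
  exact hroot (hprim.pow_of_coprime m hm')

/-- Roots of unity in a field with Galois group of exponent `2` that does not contain `√-3`. -/
lemma pow_eight_eq_one_of_involutive [IsGalois ℚ E]
    (hσ : ∀ (σ : E ≃ₐ[ℚ] E) (x : E), σ (σ x) = x) (h3 : ∀ x : E, x ^ 2 ≠ -3)
    {u : E} {n : ℕ} (hn : 0 < n) (hu : u ^ n = 1) : u ^ 8 = 1 := by
  have hu0 : u ≠ 0 := by rintro rfl; simp [hn.ne'] at hu
  have sq_fixed {v : E} {n m : ℕ} (hn : 0 < n) (hv : v ^ n = 1) (hm : m.Coprime n) :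
      v ^ (m * m) = v := by
    obtain ⟨σ, h⟩ := exists_algEquiv_eq_pow_of_coprime hn hv hm
    have := hσ σ v
    rwa [h, map_pow, h, ← pow_mul] at this
  obtain ⟨k, t, ht, rfl⟩ := Nat.exists_eq_two_pow_mul_odd hn.ne'
  have h4 : (u ^ 2 ^ k) ^ 3 = 1 := by
    have := sq_fixed (v := u ^ 2 ^ k) ht.pos (by rw [← pow_mul, hu])
      (Nat.coprime_two_left.mpr ht)
    refine mul_left_cancel₀ (pow_ne_zero (2 ^ k) hu0) ?_
    rw [mul_one, ← pow_succ']
    exact this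
  have h9 : (u ^ 3) ^ 8 = 1 := by
    have := sq_fixed (v := u ^ 3) (n := 2 ^ k) (m := 3) (by positivity)
      (by rw [← pow_mul, mul_comm, pow_mul, h4]) (Nat.Coprime.pow_right k (by norm_num))
    refine mul_left_cancel₀ (pow_ne_zero 3 hu0) ?_
    rw [mul_one, ← pow_succ']
    exact this
  by_contra hne
  have hfac : (u ^ 8 - 1) * ((u ^ 8) ^ 2 + u ^ 8 + 1) = 0 := by linear_combination h9
  have hz := (mul_eq_zero.mp hfac).resolve_left (sub_ne_zero.mpr hne)
  exact h3 (2 * u ^ 8 + 1) (by linear_combination 4 * hz)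

lemma star_eq_self_of_sq_eq_natCast {z : ℂ} {n : ℕ} (hz : z ^ 2 = n) :
    starRingEnd ℂ z = z := by
  have h : starRingEnd ℂ z ^ 2 = z ^ 2 := by rw [← map_pow, hz, map_natCast]
  rcases sq_eq_sq_iff_eq_or_eq_neg.mp h with h | h
  · exact h
  · have hre : z.re = 0 := by
      have := congrArg Complex.re h
      simp at this
      linarith
    have him := congrArg Complex.re hz
    simp [sq, hre] at him
    have hn : (0 : ℝ) ≤ n := n.cast_nonneg
    have him0 : z.im = 0 := by nlinarith [mul_self_nonneg z.im]
    rw [show z = 0 from Complex.ext hre him0, map_zero]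

lemma star_eq_neg_of_sq_eq_neg_one {z : ℂ} (hz : z ^ 2 = -1) : starRingEnd ℂ z = -z := by
  have : z ^ 2 = Complex.I ^ 2 := by rw [hz, Complex.I_sq]
  rcases sq_eq_sq_iff_eq_or_eq_neg.mp this with rfl | rfl <;> simp

/-- A unit is a power of `ζ₈` times a real unit. -/
lemma exists_eq_zeta_zpow_mul [IsGalois ℚ E] [FiniteDimensional ℚ E]
    (hp : p.Prime) (hq : q.Prime) (hs : s.Prime) (hpq : p ≠ q) (hps : p ≠ s) (hqs : q ≠ s)
    (hp8 : p % 8 = 5) (hs8 : s % 8 = 3) (hq8 : q % 8 = 7)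
    (hqp : IsSquare (q : ZMod p)) (hsp : IsSquare (s : ZMod p))
    (hr : r ^ 2 = 2) (ha : a ^ 2 = (p * q : ℕ)) (hc : c ^ 2 = (q * s : ℕ)) (hi : i ^ 2 = -1)
    (htop : adjoin ℚ {i, r, a, c} = ⊤) {ε : E} (hε0 : ε ≠ 0) (hε : IsIntegral ℤ ε)
    (hε' : IsIntegral ℤ ε⁻¹) :
    ∃ k : ℤ, ∃ v ∈ adjoin ℚ {r, a, c}, ε = ((r + i * r) / 2) ^ k * v := by
  have : CharZero E := algebraRat.charZero E
  have hfin : @FiniteDimensional ℚ E _ _ DivisionRing.toRatAlgebra.toModule := by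
    convert ‹FiniteDimensional ℚ E›
    exact Subsingleton.elim _ _
  have : NumberField E := @NumberField.mk E _ _ hfin
  have hpq' : ¬ p ∣ q := by rwa [Nat.prime_dvd_prime_iff_eq hp hq]
  have hps' : ¬ p ∣ s := by rwa [Nat.prime_dvd_prime_iff_eq hp hs]
  have hqs' : ¬ q ∣ s := by rwa [Nat.prime_dvd_prime_iff_eq hq hs]
  have hp3 : ¬ p ∣ 3 := by rw [Nat.prime_dvd_prime_iff_eq hp Nat.prime_three]; omega
  have hq3 : ¬ q ∣ 3 := by rw [Nat.prime_dvd_prime_iff_eq hq Nat.prime_three]; omega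
  have hmem (x : E) : x ∈ adjoin ℚ {i, r, a, c} := htop ▸ mem_top
  have hi' : i ^ 2 ∈ adjoin ℚ {r, a, c} := hi ▸ neg_mem (one_mem _)
  -- Complex conjugation.
  obtain ⟨κ, hκ, hκi⟩ := exists_algEquiv_map_eq_neg hi'
    (sqrt_neg_not_mem_adjoin hp.pos hq.pos hs.pos one_pos (by rw [hi]; norm_num) hr ha hc)
  have hκr : κ r = r := hκ r (subset_adjoin _ _ (by simp))
  have hκa : κ a = a := hκ a (subset_adjoin _ _ (by simp))
  have hκc : κ c = c := hκ c (subset_adjoin _ _ (by simp))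
  have mem_of_fixed (x : E) (hx : κ x = x) : x ∈ adjoin ℚ {r, a, c} := by
    obtain ⟨A, hA, B, hB, rfl⟩ := exists_add_mul_of_mem_adjoin_insert hi' (hmem x)
    rw [map_add, map_mul, hκ A hA, hκ B hB, hκi] at hx
    have : B * i = 0 := by linear_combination -hx / 2
    rw [this, add_zero]
    exact hA
  have hconj (φ : E →+* ℂ) (x : E) : φ (κ x) = starRingEnd ℂ (φ x) := by
    induction hmem x using adjoin_induction with
    | mem x hx =>
      rcases hx with rfl | rfl | rfl | rfl
      · rw [hκi, map_neg, star_eq_neg_of_sq_eq_neg_one]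
        rw [← map_pow, hi, map_neg, map_one]
      · rw [hκr, star_eq_self_of_sq_eq_natCast (n := 2)]
        rw [← map_pow, hr, map_ofNat]; norm_num
      · rw [hκa, star_eq_self_of_sq_eq_natCast (n := p * q)]
        rw [← map_pow, ha, map_natCast]
      · rw [hκc, star_eq_self_of_sq_eq_natCast (n := q * s)]
        rw [← map_pow, hc, map_natCast]
    | algebraMap t => rw [AlgEquiv.commutes, eq_ratCast, map_ratCast, map_ratCast]
    | add x y _ _ hx hy => simp only [map_add, hx, hy]
    | mul x y _ _ hx hy => simp only [map_mul, hx, hy]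
    | inv x _ hx => simp only [map_inv₀, hx]
  have hinv (σ : E ≃ₐ[ℚ] E) (x : E) : σ (σ x) = x := by
    have hsq {y : E} (hy : σ (y ^ 2) = y ^ 2) : σ (σ y) = y := by
      rw [map_pow] at hy
      rcases sq_eq_sq_iff_eq_or_eq_neg.mp hy with h | h
      · rw [h, h]
      · rw [h, map_neg, h, neg_neg]
    induction hmem x using adjoin_induction with
    | mem x hx =>
      rcases hx with rfl | rfl | rfl | rfl
      · exact hsq (by rw [hi, map_neg, map_one])
      · exact hsq (by rw [hr, map_ofNat])
      · exact hsq (by rw [ha, map_natCast])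
      · exact hsq (by rw [hc, map_natCast])
    | algebraMap t => rw [AlgEquiv.commutes, AlgEquiv.commutes]
    | add x y _ _ hx hy => simp only [map_add, hx, hy]
    | mul x y _ _ hx hy => simp only [map_mul, hx, hy]
    | inv x _ hx => simp only [map_inv₀, hx]
  have h3 (x : E) : x ^ 2 ≠ -3 := by
    intro hx
    have hx' : x ^ 2 ∈ adjoin ℚ {r, a, c} := hx ▸ neg_mem (ofNat_mem _ 3)
    rcases mem_or_mul_mem_adjoin_of_mem_adjoin_insert hx' hi' (hmem x) with h | h
    · exact sqrt_neg_not_mem_adjoin hp.pos hq.pos hs.pos (n := 3) (by norm_num)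
        (by rw [hx]; norm_num) hr ha hc h
    · exact sqrt_three_not_mem_adjoin hp hq (by omega) (by omega) (by omega) hp3 hq3 hpq' hps'
        hqs' hr ha hc (by rw [mul_pow, hx, hi]; norm_num) h
  have map_int {g : E} (hg : IsIntegral ℤ g) : IsIntegral ℤ (κ g) :=
    hg.map (κ.toAlgHom.restrictScalars ℤ)
  have hκε0 : κ ε ≠ 0 := by simpa using hε0
  have hκε' : IsIntegral ℤ (κ ε)⁻¹ := by simpa using map_int hε'
  obtain ⟨n, hn, hu⟩ := NumberField.Embeddings.pow_eq_one_of_norm_eq_one E ℂ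
    (x := ε * (κ ε)⁻¹) (hε.mul hκε') fun φ ↦ by
      rw [map_mul, map_inv₀, hconj, norm_mul, norm_inv, RCLike.norm_conj]
      exact mul_inv_cancel₀ (norm_ne_zero_iff.mpr (by simpa using hε0))
  have hu8 := pow_eight_eq_one_of_involutive hinv h3 hn hu
  obtain ⟨ζ, hζ⟩ : ∃ ζ, ζ = (r + i * r) / 2 := ⟨_, rfl⟩
  rw [← hζ]
  have hζ2 : ζ ^ 2 = i := by
    rw [hζ]; linear_combination (1 + 2 * i + i ^ 2) / 4 * hr + hi / 2
  have hζκ : ζ * κ ζ = 1 := by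
    rw [hζ, map_div₀, map_add, map_mul, hκr, hκi, map_ofNat]
    linear_combination (1 - i ^ 2) / 4 * hr - hi / 2
  have hζ0 : ζ ≠ 0 := left_ne_zero_of_mul_eq_one hζκ
  have hκζ : κ ζ = ζ⁻¹ := eq_inv_of_mul_eq_one_right hζκ
  have hζr : ζ + ζ⁻¹ = r := by
    rw [← hκζ, hζ, map_div₀, map_add, map_mul, hκr, hκi, map_ofNat]; ring
  have hprim : IsPrimitiveRoot ζ 8 := by
    have hζ4 : ζ ^ 4 = -1 := by rw [show ζ ^ 4 = (ζ ^ 2) ^ 2 by ring, hζ2, hi]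
    rw [IsPrimitiveRoot.iff_orderOf]
    refine orderOf_eq_prime_pow (p := 2) (n := 2) ?_ ?_
    · norm_num [hζ4]
    · rw [show ζ ^ 2 ^ (2 + 1) = (ζ ^ 4) ^ 2 by ring, hζ4]; norm_num
  obtain ⟨j, -, hj⟩ := hprim.eq_pow_of_pow_eq_one hu8
  have hεκ : ε = ζ ^ j * κ ε := by rw [hj]; field_simp
  rcases Nat.even_or_odd' j with ⟨l, rfl | rfl⟩
  · refine ⟨l, ε * (ζ ^ l)⁻¹, mem_of_fixed _ ?_, ?_⟩
    · rw [map_mul, map_inv₀, map_pow, hκζ, inv_pow, inv_inv]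
      conv_rhs => rw [hεκ]
      field_simp
      ring
    · rw [zpow_natCast]; field_simp
  · exfalso
    have hx : κ ((1 + ζ⁻¹) * (ε * (ζ ^ l)⁻¹)) = (1 + ζ⁻¹) * (ε * (ζ ^ l)⁻¹) := by
      simp only [map_mul, map_add, map_one, map_inv₀, map_pow, hκζ, inv_pow, inv_inv]
      conv_rhs => rw [hεκ]
      field_simp
      ring
    refine sq_ne_two_add_sqrt_two_mul_unit hp hq hs hpq hps hqs hp8 hs8 hq8 hqp hsp hr ha hc
      (mem_of_fixed _ hx) (mul_ne_zero hε0 hκε0) (hε.mul (map_int hε))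
      (by rw [mul_inv]; exact hε'.mul hκε') ?_
    calc ((1 + ζ⁻¹) * (ε * (ζ ^ l)⁻¹)) ^ 2
        = ((1 + ζ⁻¹) * (ε * (ζ ^ l)⁻¹)) * κ ((1 + ζ⁻¹) * (ε * (ζ ^ l)⁻¹)) := by rw [hx, sq]
      _ = (2 + (ζ + ζ⁻¹)) * (ε * κ ε) := by
        simp only [map_mul, map_add, map_one, map_inv₀, map_pow, hκζ, inv_pow, inv_inv]
        field_simp
        ring
      _ = (2 + r) * (ε * κ ε) := by rw [hζr]

end Multiquadratic

lemma isIntegral_and_splits_minpoly_of_sq_eq {K : IntermediateField ℚ ℂ} {x : ℂ} (hx : x ∈ K)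
    {t : ℚ} (ht : x ^ 2 = t) :
    IsIntegral ℚ x ∧ ((minpoly ℚ x).map (algebraMap ℚ K)).Splits := by
  have hroot : Polynomial.aeval x (Polynomial.X ^ 2 - Polynomial.C t) = 0 := by simp [ht]
  have hmonic : (Polynomial.X ^ 2 - Polynomial.C t).Monic :=
    Polynomial.monic_X_pow_sub_C t two_ne_zero
  refine ⟨⟨_, hmonic, hroot⟩, ?_⟩
  have hdvd := Polynomial.map_dvd (algebraMap ℚ K) (minpoly.dvd ℚ x hroot)
  refine Polynomial.Splits.of_dvd ?_ (hmonic.map _).ne_zero hdvd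
  have hfac : (Polynomial.X ^ 2 - Polynomial.C t).map (algebraMap ℚ K) =
      (Polynomial.X - Polynomial.C ⟨x, hx⟩) * (Polynomial.X - Polynomial.C (-⟨x, hx⟩)) := by
    have : algebraMap ℚ K t = (⟨x, hx⟩ : K) ^ 2 := Subtype.ext (by simp [ht])
    rw [Polynomial.map_sub, Polynomial.map_pow, Polynomial.map_X, Polynomial.map_C, this]
    simp only [map_pow, map_neg]
    ring
  rw [hfac]
  exact (Polynomial.Splits.X_sub_C _).mul (Polynomial.Splits.X_sub_C _)

lemma isGalois_adjoin_of_sq_mem {S : Set ℂ} (hS : S.Finite) (h : ∀ x ∈ S, ∃ t : ℚ, x ^ 2 = t) :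
    FiniteDimensional ℚ (adjoin ℚ S) ∧ IsGalois ℚ (adjoin ℚ S) := by
  have hsplit : ∀ x ∈ S, IsIntegral ℚ x ∧
      ((minpoly ℚ x).map (algebraMap ℚ (adjoin ℚ S))).Splits := fun x hx ↦ by
    obtain ⟨t, ht⟩ := h x hx
    exact isIntegral_and_splits_minpoly_of_sq_eq (subset_adjoin ℚ S hx) ht
  have : Finite S := hS
  have hfin : FiniteDimensional ℚ (adjoin ℚ S) :=
    finiteDimensional_adjoin fun x hx ↦ (hsplit x hx).1
  refine ⟨hfin, ?_⟩
  have : Normal ℚ (adjoin ℚ S) := normal_iff.mpr fun x ↦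
    ⟨Algebra.IsIntegral.isIntegral x, by
      rw [← minpoly.algebraMap_eq (algebraMap (adjoin ℚ S) ℂ).injective x]
      exact splits_of_mem_adjoin ℚ ℂ hsplit x.2⟩
  exact ⟨⟩

lemma isSquare_natCast_zmod_of_legendreSym_eq_one {p q : ℕ} (hp : p.Prime) (hq : q.Prime)
    (hpq : p ≠ q) (hp4 : p % 4 = 1) (hq2 : q ≠ 2)
    (h : @legendreSym q ⟨hq⟩ (p : ℤ) = 1) : IsSquare (q : ZMod p) := by
  have : Fact p.Prime := ⟨hp⟩
  have : Fact q.Prime := ⟨hq⟩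
  have hpq0 : ((p : ℤ) : ZMod q) ≠ 0 := by
    rw [Int.cast_natCast, Ne, ZMod.natCast_eq_zero_iff, Nat.prime_dvd_prime_iff_eq hq hp]
    exact hpq.symm
  rw [ZMod.exists_sq_eq_prime_iff_of_mod_four_eq_one hp4 hq2]
  simpa using (legendreSym.eq_one_iff q hpq0).mp h

/-- Let `p, q, s` be distinct primes with `p ≡ 5 (mod 8)`, `s ≡ 3 (mod 8)`,
`q ≡ 7 (mod 8)` and `(p/q) = (p/s) = (s/q) = 1`, and `L = ℚ(√2, √(pq), √(ps), i)`.
Then every unit of the ring of integers of `L` is of the form `ζ₈ᵏ·u` with `u` a unit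
of the ring of integers of `L⁺`; i.e. `E_L = ⟨ζ₈⟩·E_{L⁺}`. -/
theorem statement_11 (p q s : ℕ) (hp : p.Prime) (hq : q.Prime) (hs : s.Prime)
    (hpq : p ≠ q) (hps : p ≠ s) (hqs : q ≠ s)
    (hp8 : p % 8 = 5) (hs8 : s % 8 = 3) (hq8 : q % 8 = 7)
    (hleg1 : @legendreSym q ⟨hq⟩ (p : ℤ) = 1)
    (hleg2 : @legendreSym s ⟨hs⟩ (p : ℤ) = 1)
    (hleg3 : @legendreSym q ⟨hq⟩ (s : ℤ) = 1) :
    ∀ ε : (𝓞 ↥(Lfield p q s))ˣ, ∃ (k : ℤ) (u : (𝓞 ↥(LplusC p q s))ˣ),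
      (((ε : 𝓞 ↥(Lfield p q s)) : ↥(Lfield p q s)) : ℂ) =
        zeta8 ^ k * (((u : 𝓞 ↥(LplusC p q s)) : ↥(LplusC p q s)) : ℂ) := by
  intro ε
  have hqp := isSquare_natCast_zmod_of_legendreSym_eq_one hp hq hpq (by omega) (by omega) hleg1
  have hsp := isSquare_natCast_zmod_of_legendreSym_eq_one hp hs hps (by omega) (by omega) hleg2
  have sqrt_sq (n : ℕ) : ((√(n : ℝ) : ℝ) : ℂ) ^ 2 = n := by
    rw [← Complex.ofReal_pow, Real.sq_sqrt n.cast_nonneg, Complex.ofReal_natCast]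
  have hr : ((√2 : ℝ) : ℂ) ^ 2 = 2 := by simpa using sqrt_sq 2
  have ha : ((√(p * q) : ℝ) : ℂ) ^ 2 = (p * q : ℕ) := by simpa using sqrt_sq (p * q)
  have hb : ((√(p * s) : ℝ) : ℂ) ^ 2 = (p * s : ℕ) := by simpa using sqrt_sq (p * s)
  obtain ⟨hfin, hgal⟩ : FiniteDimensional ℚ (Lfield p q s) ∧ IsGalois ℚ (Lfield p q s) := by
    refine isGalois_adjoin_of_sq_mem (Set.toFinite _) ?_
    rintro x (rfl | rfl | rfl | rfl)
    · exact ⟨2, by rw [hr]; norm_num⟩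
    · exact ⟨(p * q : ℕ), by rw [ha]; norm_num⟩
    · exact ⟨(p * s : ℕ), by rw [hb]; norm_num⟩
    · exact ⟨-1, by rw [Complex.I_sq]; norm_num⟩
  have hrL : ((√2 : ℝ) : ℂ) ∈ Lfield p q s := subset_adjoin _ _ (by simp)
  have haL : ((√(p * q) : ℝ) : ℂ) ∈ Lfield p q s := subset_adjoin _ _ (by simp)
  have hbL : ((√(p * s) : ℝ) : ℂ) ∈ Lfield p q s := subset_adjoin _ _ (by simp)
  have hiL : Complex.I ∈ Lfield p q s := subset_adjoin _ _ (by simp)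
  let r : Lfield p q s := ⟨_, hrL⟩
  let a : Lfield p q s := ⟨_, haL⟩
  let b : Lfield p q s := ⟨_, hbL⟩
  let i : Lfield p q s := ⟨_, hiL⟩
  let c : Lfield p q s := a * b / p
  have hr' : r ^ 2 = 2 := Subtype.ext hr
  have ha' : a ^ 2 = (p * q : ℕ) := Subtype.ext ha
  have hb' : b ^ 2 = (p * s : ℕ) := Subtype.ext hb
  have hi' : i ^ 2 = -1 := Subtype.ext Complex.I_sq
  have hp0' : (p : Lfield p q s) ≠ 0 := by exact_mod_cast hp.ne_zero
  have hq0' : (q : Lfield p q s) ≠ 0 := by exact_mod_cast hq.ne_zero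
  have hc' : c ^ 2 = (q * s : ℕ) := by
    simp only [c]
    rw [div_pow, mul_pow, ha', hb']
    push_cast
    field_simp
  have hbc : b = c * a / q := by
    have : a * a = p * q := by rw [← sq, ha']; push_cast; rfl
    simp only [c]
    field_simp
    linear_combination -b * this
  have htop : adjoin ℚ {i, r, a, c} = ⊤ := by
    have hsub {x : Lfield p q s} (hx : x ∈ ({i, r, a, c} : Set (Lfield p q s))) :
        x ∈ adjoin ℚ {i, r, a, c} := subset_adjoin _ _ hx
    have hbmem : b ∈ adjoin ℚ {i, r, a, c} := by
      rw [hbc]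
      exact div_mem (mul_mem (hsub (by simp)) (hsub (by simp)))
        ((adjoin ℚ {i, r, a, c}).natCast_mem q)
    have hle : Lfield p q s ≤ (adjoin ℚ {i, r, a, c}).map (Lfield p q s).val := by
      conv_lhs => rw [Lfield]
      rw [adjoin_le_iff]
      rintro x (rfl | rfl | rfl | rfl)
      · exact ⟨r, hsub (by simp), rfl⟩
      · exact ⟨a, hsub (by simp), rfl⟩
      · exact ⟨b, hbmem, rfl⟩
      · exact ⟨i, hsub (by simp), rfl⟩
    rw [eq_top_iff]
    intro x _
    obtain ⟨y, hy, hyx⟩ := hle x.2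
    rwa [← Subtype.ext hyx]
  have hε0 : ((ε : 𝓞 (Lfield p q s)) : Lfield p q s) ≠ 0 := by simp
  have hε : IsIntegral ℤ ((ε : 𝓞 (Lfield p q s)) : Lfield p q s) := RingOfIntegers.isIntegral_coe _
  have hε' : IsIntegral ℤ ((ε : 𝓞 (Lfield p q s)) : Lfield p q s)⁻¹ := by
    have := RingOfIntegers.isIntegral_coe ((ε⁻¹ : (𝓞 (Lfield p q s))ˣ) : 𝓞 (Lfield p q s))
    simpa using this
  obtain ⟨k, v, hv, hεv⟩ := exists_eq_zeta_zpow_mul hp hq hs hpq hps hqs hp8 hs8 hq8 hqp hsp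
    hr' ha' hc' hi' htop hε0 hε hε'
  have hεC : (((ε : 𝓞 (Lfield p q s)) : Lfield p q s) : ℂ) = zeta8 ^ k * (v : ℂ) := by
    rw [hεv]; rfl
  have hvmem : (v : ℂ) ∈ LplusC p q s := by
    have hle : adjoin ℚ {r, a, c} ≤ (LplusC p q s).comap (Lfield p q s).val := by
      have hrP : (r : ℂ) ∈ LplusC p q s := subset_adjoin _ _ (by simp [r])
      have haP : (a : ℂ) ∈ LplusC p q s := subset_adjoin _ _ (by simp [a])
      have hbP : (b : ℂ) ∈ LplusC p q s := subset_adjoin _ _ (by simp [b])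
      refine adjoin_le_iff.mpr ?_
      rintro x (rfl | rfl | rfl)
      · exact hrP
      · exact haP
      · exact div_mem (mul_mem haP hbP) ((LplusC p q s).natCast_mem p)
    exact hle hv
  have hζ8 : zeta8 ^ 8 = 1 := by
    have : zeta8 ^ 2 = Complex.I := by
      rw [zeta8]
      linear_combination (1 + 2 * Complex.I + Complex.I ^ 2) / 4 * hr + Complex.I_sq / 2
    rw [show zeta8 ^ 8 = ((zeta8 ^ 2) ^ 2) ^ 2 by ring, this, Complex.I_sq]; norm_num
  have hζ0 : zeta8 ≠ 0 := by
    intro h; rw [h] at hζ8; norm_num at hζ8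
  have hζint (j : ℤ) : IsIntegral ℤ (zeta8 ^ j) := by
    refine .of_pow (n := 8) (by norm_num) ?_
    rw [← zpow_natCast, ← zpow_mul, mul_comm, zpow_mul, zpow_natCast, hζ8, one_zpow]
    exact isIntegral_one
  have hvC : (v : ℂ) = zeta8 ^ (-k) * (((ε : 𝓞 (Lfield p q s)) : Lfield p q s) : ℂ) := by
    rw [hεC, ← mul_assoc, ← zpow_add₀ hζ0, neg_add_cancel, zpow_zero, one_mul]
  have to_complex {K : IntermediateField ℚ ℂ} (x : K) : IsIntegral ℤ (x : ℂ) ↔ IsIntegral ℤ x :=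
    isIntegral_algHom_iff (K.val.restrictScalars ℤ) Subtype.val_injective
  have hvi : IsIntegral ℤ (v : ℂ) := hvC ▸ (hζint _).mul ((to_complex _).mpr hε)
  have hvi' : IsIntegral ℤ (v : ℂ)⁻¹ := by
    rw [hvC, mul_inv, ← zpow_neg]
    exact (hζint _).mul ((to_complex (_⁻¹)).mpr hε')
  have hv0 : (v : ℂ) ≠ 0 := by
    intro h
    rw [h, mul_zero] at hεC
    exact hε0 (Subtype.ext hεC)
  let u : 𝓞 (LplusC p q s) := ⟨⟨v, hvmem⟩, (to_complex _).mp hvi⟩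
  let u' : 𝓞 (LplusC p q s) := ⟨⟨(v : ℂ)⁻¹, inv_mem hvmem⟩, (to_complex _).mp hvi'⟩
  have huu' : u * u' = 1 := RingOfIntegers.ext (Subtype.ext (mul_inv_cancel₀ hv0))
  exact ⟨k, ⟨u, u', huu', by rw [mul_comm, huu']⟩, hεC⟩
end
end

section
/- Let p, q, s be distinct primes with p ≡ 5 (mod 8), s ≡ 3 (mod 8), q ≡ 7 (mod 8), and Legendre symbols (p/q) = (p/s) = (s/q) = 1, and let ℓ > 1 be an odd squarefree integer coprime to p, q, s. Then there is no unit ε of the ring of integers of L⁺ such that ℓ·ε is a square in L⁺. -/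
open Real NumberField IntermediateField

noncomputable section

/-- The totally real multiquadratic field `L⁺ = ℚ(√2, √(pq), √(ps))`, realized as a
subfield of `ℝ`. -/
def Lplus (p q s : ℕ) : IntermediateField ℚ ℝ :=
  adjoin ℚ {Real.sqrt 2, Real.sqrt (p * q), Real.sqrt (p * s)}

/-- If `t ^ 2 ∈ K`, then `{a + b * t | a, b ∈ K}` is closed under inversion. -/
theorem exists_inv_eq_add_mul {E : Type*} [Field E] [Algebra ℚ E] (K : IntermediateField ℚ E)
    {t a b : E} (ht : t ^ 2 ∈ K) (ha : a ∈ K) (hb : b ∈ K) :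
    ∃ c ∈ K, ∃ e ∈ K, (a + b * t)⁻¹ = c + e * t := by
  by_cases htK : t ∈ K
  · exact ⟨_, K.inv_mem (K.add_mem ha (K.mul_mem hb htK)), 0, K.zero_mem, by ring⟩
  by_cases hb0 : b = 0
  · exact ⟨a⁻¹, K.inv_mem ha, 0, K.zero_mem, by simp [hb0]⟩
  have h₁ : a + b * t ≠ 0 := fun h ↦ htK <| by
    have : t = -a / b := by rw [eq_div_iff hb0]; linear_combination h
    exact this ▸ K.div_mem (K.neg_mem ha) hb
  have h₂ : a - b * t ≠ 0 := fun h ↦ htK <| by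
    have : t = a / b := by rw [eq_div_iff hb0]; linear_combination -h
    exact this ▸ K.div_mem ha hb
  have hN : a ^ 2 - b ^ 2 * t ^ 2 ∈ K :=
    K.sub_mem (pow_mem ha 2) (K.mul_mem (pow_mem hb 2) ht)
  have hN0 : a ^ 2 - b ^ 2 * t ^ 2 ≠ 0 := by
    have : a ^ 2 - b ^ 2 * t ^ 2 = (a + b * t) * (a - b * t) := by ring
    exact this ▸ mul_ne_zero h₁ h₂
  refine ⟨a / (a ^ 2 - b ^ 2 * t ^ 2), K.div_mem ha hN,
    -b / (a ^ 2 - b ^ 2 * t ^ 2), K.div_mem (K.neg_mem hb) hN, ?_⟩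
  symm
  refine eq_inv_of_mul_eq_one_left ?_
  rw [div_mul_eq_mul_div, ← add_div, div_mul_eq_mul_div, div_eq_one_iff_eq hN0]
  ring

/-- Elements of `ℚ(S, t)` have the form `a + b * t` with `a, b ∈ ℚ(S)` when `t ^ 2 ∈ ℚ(S)`. -/
theorem exists_eq_add_mul_of_mem_adjoin_insert {E : Type*} [Field E] [Algebra ℚ E] {S : Set E}
    {t x : E} (ht : t ^ 2 ∈ adjoin ℚ S) (hx : x ∈ adjoin ℚ (insert t S)) :
    ∃ a ∈ adjoin ℚ S, ∃ b ∈ adjoin ℚ S, x = a + b * t := by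
  set K := adjoin ℚ S
  induction hx using adjoin_induction with
  | mem x hx =>
    rcases hx with rfl | hx
    · exact ⟨0, K.zero_mem, 1, K.one_mem, by ring⟩
    · exact ⟨x, subset_adjoin ℚ S hx, 0, K.zero_mem, by ring⟩
  | algebraMap x => exact ⟨_, K.algebraMap_mem x, 0, K.zero_mem, by ring⟩
  | add x y _ _ hx hy =>
    obtain ⟨a, ha, b, hb, rfl⟩ := hx
    obtain ⟨c, hc, e, he, rfl⟩ := hy
    exact ⟨_, K.add_mem ha hc, _, K.add_mem hb he, by ring⟩
  | inv x _ hx =>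
    obtain ⟨a, ha, b, hb, rfl⟩ := hx
    exact exists_inv_eq_add_mul K ht ha hb
  | mul x y _ _ hx hy =>
    obtain ⟨a, ha, b, hb, rfl⟩ := hx
    obtain ⟨c, hc, e, he, rfl⟩ := hy
    exact ⟨_, K.add_mem (K.mul_mem ha hc) (K.mul_mem (K.mul_mem hb he) ht),
      _, K.add_mem (K.mul_mem ha he) (K.mul_mem hb hc), by ring⟩

/-- Conjugation of a quadratic extension `K(t) / K` with `t ^ 2 ∈ K` preserves integrality. -/
theorem isIntegral_conj {E : Type*} [Field E] [Algebra ℚ E] (K : IntermediateField ℚ E)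
    {t a b : E} (ht : t ^ 2 ∈ K) (htK : t ∉ K) (ha : a ∈ K) (hb : b ∈ K)
    (h : IsIntegral ℤ (a + b * t)) : IsIntegral ℤ (a - b * t) := by
  obtain ⟨f, hf, hf0⟩ := h
  refine ⟨f, hf, ?_⟩
  have hirr : Irreducible (Polynomial.X ^ 2 - Polynomial.C (⟨t ^ 2, ht⟩ : K)) := by
    refine X_pow_sub_C_irreducible_of_prime Nat.prime_two fun c hc ↦ ?_
    have hc' : t ^ 2 = (c : E) ^ 2 := (congrArg Subtype.val hc).symm
    rcases sq_eq_sq_iff_eq_or_eq_neg.mp hc' with h | h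
    · exact htK (h ▸ c.2)
    · exact htK (h ▸ K.neg_mem c.2)
  have hmin : minpoly K t = Polynomial.X ^ 2 - Polynomial.C (⟨t ^ 2, ht⟩ : K) := by
    refine (minpoly.eq_of_irreducible_of_monic hirr ?_
      (Polynomial.monic_X_pow_sub_C _ two_ne_zero)).symm
    simp [IntermediateField.algebraMap_apply]
  let g : Polynomial K := (f.map (algebraMap ℤ K)).comp
    (Polynomial.C ⟨a, ha⟩ + Polynomial.C ⟨b, hb⟩ * Polynomial.X)
  have hg (u : E) : Polynomial.aeval u g = Polynomial.eval₂ (algebraMap ℤ E) (a + b * u) f := by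
    simp only [g, Polynomial.aeval_comp, Polynomial.aeval_map_algebraMap]
    simp [Polynomial.aeval_def, IntermediateField.algebraMap_apply]
  obtain ⟨k, hk⟩ := minpoly.dvd K t ((hg t).trans hf0)
  have hneg := hg (-t)
  rw [hk, hmin] at hneg
  rw [show a - b * t = a + b * -t by ring, ← hneg]
  simp [IntermediateField.algebraMap_apply]

theorem isIntegral_of_coprime_mul {E : Type*} [CommRing E] {m n : ℤ} {x : E}
    (hmn : IsCoprime m n) (hm : IsIntegral ℤ (m * x)) (hn : IsIntegral ℤ (n * x)) :
    IsIntegral ℤ x := by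
  obtain ⟨u, v, huv⟩ := hmn
  have huv' : (u : E) * m + v * n = 1 := by
    simpa using congrArg (Int.cast : ℤ → E) huv
  have hu : IsIntegral ℤ (u : E) := isIntegral_algebraMap (R := ℤ) (x := u)
  have hv : IsIntegral ℤ (v : E) := isIntegral_algebraMap (R := ℤ) (x := v)
  have : x = u * (m * x) + v * (n * x) := by linear_combination -x * huv'
  rw [this]
  exact (hu.mul hm).add (hv.mul hn)

/-- `r` stays squarefree in the ring of integers of `K`:
for `x ∈ K`, if `r * x ^ 2` is integral then so is `x`. -/
def SquarefreeIn {E : Type*} [Field E] [Algebra ℚ E] (r : ℤ) (K : IntermediateField ℚ E) : Prop :=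
  ∀ x ∈ K, IsIntegral ℤ (r * x ^ 2) → IsIntegral ℤ x

theorem squarefreeIn_adjoin_empty {E : Type*} [Field E] [Algebra ℚ E] {r : ℤ} (hr : Prime r) :
    SquarefreeIn r (adjoin ℚ (∅ : Set E)) := by
  intro x hx h
  rw [adjoin_empty, mem_bot] at hx
  obtain ⟨y, rfl⟩ := hx
  have h' : IsIntegral ℤ ((r : ℚ) * y ^ 2) := by
    rw [← isIntegral_algebraMap_iff (algebraMap ℚ E).injective]
    rwa [map_mul, map_intCast, map_pow]
  have hint : IsIntegral ℤ ((r : ℚ) * y) := by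
    refine IsIntegral.of_pow two_pos ?_
    rw [show ((r : ℚ) * y) ^ 2 = r * (r * y ^ 2) by ring]
    exact (isIntegral_algebraMap (R := ℤ) (x := r)).mul h'
  obtain ⟨m, hm⟩ := IsIntegrallyClosed.isIntegral_iff.mp hint
  obtain ⟨n, hn⟩ := IsIntegrallyClosed.isIntegral_iff.mp h'
  simp only [eq_intCast] at hm hn
  have hmn : m ^ 2 = r * n := by
    have : (m : ℚ) ^ 2 = r * n := by rw [hm, hn]; ring
    exact_mod_cast this
  obtain ⟨k, rfl⟩ := hr.dvd_of_dvd_pow (Dvd.intro n hmn.symm)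
  have hr0 : (r : ℚ) ≠ 0 := by exact_mod_cast hr.ne_zero
  have hy : y = k := by
    push_cast at hm
    exact (mul_left_cancel₀ hr0 hm).symm
  rw [hy]
  simpa using (isIntegral_algebraMap (R := ℤ) (A := E) (x := k))

theorem SquarefreeIn.adjoin_insert {E : Type*} [Field E] [Algebra ℚ E] {r d : ℤ} {S : Set E}
    {t : E} (hS : SquarefreeIn r (adjoin ℚ S)) (ht : t ^ 2 = d) (hrd : IsCoprime r (2 * d)) :
    SquarefreeIn r (adjoin ℚ (insert t S)) := by
  intro x hx h
  set K := adjoin ℚ S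
  have hint (n : ℤ) : IsIntegral ℤ (n : E) := isIntegral_algebraMap (R := ℤ) (x := n)
  have hintK (n : ℤ) : (n : E) ∈ K := intCast_mem K n
  have htK2 : t ^ 2 ∈ K := ht ▸ hintK d
  obtain ⟨a, ha, b, hb, rfl⟩ := exists_eq_add_mul_of_mem_adjoin_insert htK2 hx
  by_cases htK : t ∈ K
  · exact hS _ (K.add_mem ha (K.mul_mem hb htK)) h
  have hconj : IsIntegral ℤ (r * (a - b * t) ^ 2) := by
    have key := isIntegral_conj K (a := r * (a ^ 2 + b ^ 2 * t ^ 2)) (b := r * (2 * a * b))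
      htK2 htK
      (K.mul_mem (hintK r) (K.add_mem (pow_mem ha 2) (K.mul_mem (pow_mem hb 2) htK2)))
      (K.mul_mem (hintK r) (K.mul_mem (K.mul_mem (ofNat_mem K 2) ha) hb))
      (Eq.subst (motive := IsIntegral ℤ) (by ring) h)
    exact Eq.subst (motive := IsIntegral ℤ) (by ring) key
  have hnorm : IsIntegral ℤ (r * ((a + b * t) * (a - b * t))) := by
    refine IsIntegral.of_pow two_pos ?_
    refine Eq.subst (motive := IsIntegral ℤ) ?_ (h.mul hconj)
    ring
  have h2 : IsIntegral ℤ (2 : E) := by simpa using hint 2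
  have hsum : IsIntegral ℤ (2 * a) := by
    refine hS _ (K.mul_mem (ofNat_mem K 2) ha) ?_
    refine Eq.subst (motive := IsIntegral ℤ) ?_ ((h.add hconj).add (h2.mul hnorm))
    ring
  have hdiff : IsIntegral ℤ (2 * b * d) := by
    refine hS _ (K.mul_mem (K.mul_mem (ofNat_mem K 2) hb) (hintK d)) ?_
    refine Eq.subst (motive := IsIntegral ℤ) ?_ ((hint d).mul ((h.add hconj).sub (h2.mul hnorm)))
    linear_combination 4 * r * b ^ 2 * d * ht
  have htint : IsIntegral ℤ t := IsIntegral.of_pow two_pos (ht ▸ hint d)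
  refine isIntegral_of_coprime_mul hrd ?_ ?_
  · refine IsIntegral.of_pow two_pos ?_
    refine Eq.subst (motive := IsIntegral ℤ) ?_ ((hint r).mul h)
    ring
  · refine Eq.subst (motive := IsIntegral ℤ) ?_ (((hint d).mul hsum).add (hdiff.mul htint))
    push_cast
    ring

/-- Let `p, q, s` be distinct primes with `p ≡ 5 (mod 8)`, `s ≡ 3 (mod 8)`,
`q ≡ 7 (mod 8)` and `(p/q) = (p/s) = (s/q) = 1`, and let `ℓ > 1` be an odd squarefree
integer coprime to `p, q, s`.  Then there is no unit `ε` of the ring of integers of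
`L⁺ = ℚ(√2, √(pq), √(ps))` such that `ℓ·ε` is a square in `L⁺`. -/
theorem statement_13 (p q s : ℕ) (hp : p.Prime) (hq : q.Prime) (hs : s.Prime)
    (hpq : p ≠ q) (hps : p ≠ s) (hqs : q ≠ s)
    (hp8 : p % 8 = 5) (hs8 : s % 8 = 3) (hq8 : q % 8 = 7)
    (hleg1 : @legendreSym q ⟨hq⟩ (p : ℤ) = 1)
    (hleg2 : @legendreSym s ⟨hs⟩ (p : ℤ) = 1)
    (hleg3 : @legendreSym q ⟨hq⟩ (s : ℤ) = 1)
    (ℓ : ℕ) (hℓ1 : 1 < ℓ) (hℓodd : Odd ℓ) (hℓsf : Squarefree ℓ)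
    (hℓp : Nat.Coprime ℓ p) (hℓq : Nat.Coprime ℓ q) (hℓs : Nat.Coprime ℓ s) :
    ¬ ∃ (ε : (𝓞 ↥(Lplus p q s))ˣ) (ξ : ↥(Lplus p q s)),
        ((ξ : ℝ)) ^ 2 =
          (ℓ : ℝ) * (((ε : 𝓞 ↥(Lplus p q s)) : ↥(Lplus p q s)) : ℝ) := by
  rintro ⟨ε, ξ, h⟩
  obtain ⟨r, hr, m, rfl⟩ := Nat.exists_prime_and_dvd hℓ1.ne'
  have hrZ : Prime (r : ℤ) := Nat.prime_iff_prime_int.mp hr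
  have hr0 : (r : ℝ) ≠ 0 := by exact_mod_cast hr.ne_zero
  have hcop2 : Nat.Coprime r 2 := (Nat.coprime_two_right.mpr hℓodd).coprime_mul_right
  have hcopp : Nat.Coprime r p := hℓp.coprime_mul_right
  have hcopq : Nat.Coprime r q := hℓq.coprime_mul_right
  have hcops : Nat.Coprime r s := hℓs.coprime_mul_right
  have hL : SquarefreeIn (r : ℤ) (Lplus p q s) := by
    have h₀ := squarefreeIn_adjoin_empty (E := ℝ) hrZ
    have h₁ := h₀.adjoin_insert (t := √(p * s)) (d := (p * s : ℕ))
      (by rw [Real.sq_sqrt (by positivity)]; push_cast; ring)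
      (by exact_mod_cast (hcop2.mul_right (hcopp.mul_right hcops)).isCoprime)
    have h₂ := h₁.adjoin_insert (t := √(p * q)) (d := (p * q : ℕ))
      (by rw [Real.sq_sqrt (by positivity)]; push_cast; ring)
      (by exact_mod_cast (hcop2.mul_right (hcopp.mul_right hcopq)).isCoprime)
    have h₃ := h₂.adjoin_insert (t := √2) (d := 2)
      (by rw [Real.sq_sqrt (by positivity)]; norm_num)
      (by exact_mod_cast (hcop2.mul_right hcop2).isCoprime)
    simpa [Lplus] using h₃
  have hint (y : 𝓞 (Lplus p q s)) : IsIntegral ℤ ((y : Lplus p q s) : ℝ) :=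
    y.isIntegral_coe.map ((Lplus p q s).val.restrictScalars ℤ)
  have hm : IsIntegral ℤ (m : ℝ) := by
    simpa using isIntegral_algebraMap (R := ℤ) (A := ℝ) (x := m)
  push_cast at h
  have hx : IsIntegral ℤ ((ξ : ℝ) / r) := by
    refine hL _ ((Lplus p q s).div_mem ξ.2 ((Lplus p q s).natCast_mem r)) ?_
    refine Eq.subst (motive := IsIntegral ℤ) ?_ (hm.mul (hint ε))
    rw [div_pow, h]
    push_cast
    field_simp
  have hεinv : (((ε : 𝓞 (Lplus p q s)) : Lplus p q s) : ℝ) *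
      ((((ε⁻¹ : (𝓞 (Lplus p q s))ˣ) : 𝓞 (Lplus p q s)) : Lplus p q s) : ℝ) = 1 := by
    exact_mod_cast congrArg (fun y : 𝓞 (Lplus p q s) ↦ ((y : Lplus p q s) : ℝ)) ε.mul_inv
  have hmr : IsIntegral ℤ ((m / r : ℚ) : ℝ) := by
    refine Eq.subst (motive := IsIntegral ℤ) ?_ ((hx.pow 2).mul (hint (ε⁻¹ : (𝓞 (Lplus p q s))ˣ)))
    rw [div_pow, h]
    push_cast
    field_simp
    linear_combination (m : ℝ) * hεinv
  have hmr' : IsIntegral ℤ (m / r : ℚ) :=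
    (isIntegral_algebraMap_iff (algebraMap ℚ ℝ).injective).mp hmr
  obtain ⟨n, hn⟩ := IsIntegrallyClosed.isIntegral_iff.mp hmr'
  have hrm : (r : ℤ) ∣ m := by
    refine ⟨n, ?_⟩
    have hr0' : (r : ℚ) ≠ 0 := by exact_mod_cast hr.ne_zero
    rw [eq_intCast, eq_div_iff hr0'] at hn
    have : (m : ℚ) = r * n := by rw [← hn, mul_comm]
    exact_mod_cast this
  exact hr.not_isUnit (hℓsf r (mul_dvd_mul_left r (Int.natCast_dvd_natCast.mp hrm)))
end
end

section
/- Let p, q, s be distinct primes with p ≡ 5 (mod 8), s ≡ 3 (mod 8), q ≡ 7 (mod 8), and Legendre symbols (p/q) = (p/s) = (s/q) = −1. Then there exist units ξ₁, ξ₂, ξ₃, ξ₄, ξ₅ of the ring of integers of L⁺ with ξ₁² = ε_{pq}·ε_{2pq}, ξ₂² = ε_{ps}·ε_{2ps}, ξ₃² = ε_{qs}·ε_{2qs}, ξ₄² = ε_{pq}·ε_{ps}, ξ₅² = ε_{pq}·ε_{qs} (as real numbers), such that the unit group of the ring of integers of L⁺ is generated by −1, ε₂, ε_{pq}, ξ₁,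 ξ₂, ξ₃, ξ₄, ξ₅. -/
open Real NumberField IntermediateField

noncomputable section

/-- `e : ℝ` is a unit greater than `1` of the ring of integers of the real quadratic
field `ℚ(√d)`: it can be written as `(x + y√d)/2` with `x, y ≥ 1` integers satisfying
`x² - d·y² = ±4`. -/
def IsQuadUnit (d : ℕ) (e : ℝ) : Prop :=
  ∃ x y : ℤ, 1 ≤ x ∧ 1 ≤ y ∧
    (x ^ 2 - (d : ℤ) * y ^ 2 = 4 ∨ x ^ 2 - (d : ℤ) * y ^ 2 = -4) ∧
    2 * e = (x : ℝ) + (y : ℝ) * Real.sqrt d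

/-- `e` is the fundamental unit of the real quadratic field `ℚ(√d)` (for `d > 1`
squarefree), i.e. the smallest unit `> 1` of its ring of integers. -/
def IsFundamentalUnit (d : ℕ) (e : ℝ) : Prop :=
  IsQuadUnit d e ∧ ∀ e' : ℝ, IsQuadUnit d e' → e ≤ e'


/-- The image in `ℝ` of a unit of the ring of integers of a subfield of `ℝ`. -/
def unitVal {K : IntermediateField ℚ ℝ} (u : (𝓞 ↥K)ˣ) : ℝ :=
  ((u : 𝓞 ↥K) : ↥K)

/-- `e` is a unit of the ring of integers of `ℚ(√d)`, written as `(x + y√d)/2`. -/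
def IsSignedQuadUnit (d : ℕ) (e : ℝ) : Prop :=
  ∃ x y : ℤ, (x ^ 2 - (d : ℤ) * y ^ 2 = 4 ∨ x ^ 2 - (d : ℤ) * y ^ 2 = -4) ∧
    2 * e = (x : ℝ) + (y : ℝ) * Real.sqrt d

lemma IsQuadUnit.isSignedQuadUnit {d : ℕ} {e : ℝ} (h : IsQuadUnit d e) :
    IsSignedQuadUnit d e := by
  obtain ⟨x, y, -, -, h, he⟩ := h
  exact ⟨x, y, h, he⟩

lemma IsQuadUnit.one_lt {d : ℕ} {e : ℝ} (hd : 2 ≤ d) (h : IsQuadUnit d e) : 1 < e := by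
  obtain ⟨x, y, hx, hy, -, he⟩ := h
  have hx' : (1 : ℝ) ≤ x := by exact_mod_cast hx
  have hy' : (1 : ℝ) ≤ y := by exact_mod_cast hy
  have h1 : (1 : ℝ) < √(d : ℝ) := by
    rw [Real.lt_sqrt (by norm_num)]
    have : (2 : ℝ) ≤ d := by exact_mod_cast hd
    linarith
  nlinarith

lemma IsSignedQuadUnit.neg {d : ℕ} {e : ℝ} (h : IsSignedQuadUnit d e) :
    IsSignedQuadUnit d (-e) := by
  obtain ⟨x, y, h, he⟩ := h
  refine ⟨-x, -y, by simpa using h, ?_⟩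
  push_cast
  linear_combination -he

lemma IsSignedQuadUnit.ne_zero {d : ℕ} {e : ℝ} (h : IsSignedQuadUnit d e) : e ≠ 0 := by
  obtain ⟨x, y, h, he⟩ := h
  rintro rfl
  have hd : √(d : ℝ) ^ 2 = d := Real.sq_sqrt (by positivity)
  have h0 : (x : ℝ) ^ 2 - d * y ^ 2 = 0 := by
    rw [← hd]
    linear_combination -(x - y * √(d : ℝ)) * he
  have h0' : x ^ 2 - (d : ℤ) * y ^ 2 = 0 := by exact_mod_cast h0
  omega

lemma IsSignedQuadUnit.inv {d : ℕ} {e : ℝ} (h : IsSignedQuadUnit d e) :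
    IsSignedQuadUnit d e⁻¹ := by
  have h0 := h.ne_zero
  obtain ⟨x, y, h, he⟩ := h
  have hd : √(d : ℝ) ^ 2 = d := Real.sq_sqrt (by positivity)
  rcases h with h | h
  · refine ⟨x, -y, Or.inl (by simpa using h), ?_⟩
    have hr : (x : ℝ) ^ 2 - d * y ^ 2 = 4 := by exact_mod_cast h
    rw [← hd] at hr
    field_simp
    push_cast
    linear_combination -(1 / 2 : ℝ) * hr - (1 / 2 : ℝ) * (x - y * √(d : ℝ)) * he
  · refine ⟨-x, y, Or.inr (by simpa using h), ?_⟩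
    have hr : (x : ℝ) ^ 2 - d * y ^ 2 = -4 := by exact_mod_cast h
    rw [← hd] at hr
    field_simp
    push_cast
    linear_combination (1 / 2 : ℝ) * hr + (1 / 2 : ℝ) * (x - y * √(d : ℝ)) * he

lemma even_sub_mul_of_sq_sub {d x y : ℤ} (h : x ^ 2 - d * y ^ 2 = 4 ∨ x ^ 2 - d * y ^ 2 = -4) :
    Even (x - d * y) := by
  have : Even (x ^ 2 - d * y ^ 2) := by
    rcases h with h | h <;> rw [h] <;> decide
  simpa [Int.even_sub, Int.even_mul, Int.even_pow] using this

lemma IsSignedQuadUnit.mul {d : ℕ} {e f : ℝ} (he : IsSignedQuadUnit d e)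
    (hf : IsSignedQuadUnit d f) : IsSignedQuadUnit d (e * f) := by
  obtain ⟨x, y, h, he⟩ := he
  obtain ⟨z, w, h', hf⟩ := hf
  have hd : √(d : ℝ) ^ 2 = d := Real.sq_sqrt (by positivity)
  obtain ⟨k, hk⟩ := even_sub_mul_of_sq_sub h
  obtain ⟨l, hl⟩ := even_sub_mul_of_sq_sub h'
  have h2 : Even ((d : ℤ) * (d + 1)) := Int.even_mul_succ_self _
  obtain ⟨j, hj⟩ := h2
  obtain ⟨a, ha⟩ : ∃ a, x * z + d * y * w = 2 * a :=
    ⟨2 * k * l + k * d * w + l * d * y + j * y * w, by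
      linear_combination z * hk + d * y * hl + 2 * k * hl + y * w * hj⟩
  obtain ⟨b, hb⟩ : ∃ b, x * w + z * y = 2 * b :=
    ⟨k * w + l * y + d * y * w, by linear_combination w * hk + y * hl⟩
  have key : 4 * (a ^ 2 - (d : ℤ) * b ^ 2) =
      (x ^ 2 - d * y ^ 2) * (z ^ 2 - d * w ^ 2) := by
    linear_combination -(x * z + d * y * w + 2 * a) * ha + d * (x * w + z * y + 2 * b) * hb
  refine ⟨a, b, ?_, ?_⟩
  · rcases h with h | h <;> rcases h' with h' | h' <;> rw [h, h'] at key <;> omega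
  · have ha' : (x : ℝ) * z + d * y * w = 2 * a := by exact_mod_cast ha
    have hb' : (x : ℝ) * w + z * y = 2 * b := by exact_mod_cast hb
    linear_combination (1 / 2 : ℝ) * ha' + (1 / 2 : ℝ) * √(d : ℝ) * hb' + f * he
      + (1 / 2 : ℝ) * (x + y * √(d : ℝ)) * hf + (1 / 2 : ℝ) * y * w * hd

lemma isSignedQuadUnit_one (d : ℕ) : IsSignedQuadUnit d 1 :=
  ⟨2, 0, by norm_num, by norm_num⟩

lemma IsSignedQuadUnit.pow {d : ℕ} {e : ℝ} (h : IsSignedQuadUnit d e) (n : ℕ) :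
    IsSignedQuadUnit d (e ^ n) := by
  induction n with
  | zero => simpa using isSignedQuadUnit_one d
  | succ n ih => rw [pow_succ]; exact ih.mul h

lemma IsSignedQuadUnit.zpow {d : ℕ} {e : ℝ} (h : IsSignedQuadUnit d e) (n : ℤ) :
    IsSignedQuadUnit d (e ^ n) := by
  cases n with
  | ofNat n => simpa using h.pow n
  | negSucc n => rw [zpow_negSucc]; exact (h.pow _).inv

lemma IsSignedQuadUnit.isQuadUnit {d : ℕ} {e : ℝ} (h : IsSignedQuadUnit d e)
    (he1 : 1 < e) : IsQuadUnit d e := by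
  obtain ⟨x, y, h, he⟩ := h
  have hd : √(d : ℝ) ^ 2 = d := Real.sq_sqrt (by positivity)
  have hs0 : 0 ≤ √(d : ℝ) := Real.sqrt_nonneg _
  set f : ℝ := (x - y * √(d : ℝ)) / 2 with hf
  have hef : e * f = 1 ∨ e * f = -1 := by
    have h4 : 4 * (e * f) = x ^ 2 - d * y ^ 2 := by
      rw [hf]
      linear_combination (x - y * √(d : ℝ)) * he - y ^ 2 * hd
    rcases h with h | h
    · left
      have hr : (x : ℝ) ^ 2 - d * y ^ 2 = 4 := by exact_mod_cast h
      linarith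
    · right
      have hr : (x : ℝ) ^ 2 - d * y ^ 2 = -4 := by exact_mod_cast h
      linarith
  have hf1 : |f| < 1 := by
    have : |e| * |f| = 1 := by
      rw [← abs_mul]
      rcases hef with h | h <;> rw [h] <;> simp
    rw [abs_of_pos (by linarith)] at this
    by_contra hcon
    push Not at hcon
    nlinarith
  rw [abs_lt] at hf1
  have hx : (0 : ℝ) < x := by linarith
  have hy : (0 : ℝ) < y := by
    have : 0 < y * √(d : ℝ) := by linarith
    exact pos_of_mul_pos_left this hs0
  exact ⟨x, y, by exact_mod_cast hx, by exact_mod_cast hy, h, he⟩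

/-- Every unit of a real quadratic field is, up to sign, a power of the fundamental unit. -/
lemma IsFundamentalUnit.exists_zpow {d : ℕ} (hd : 2 ≤ d) {ε e : ℝ} (hε : IsFundamentalUnit d ε)
    (he : IsSignedQuadUnit d e) : ∃ a : ℤ, e = ε ^ a ∨ e = -ε ^ a := by
  have key : ∀ f : ℝ, 0 < f → IsSignedQuadUnit d f → ∃ a : ℤ, f = ε ^ a := by
    intro f hf0 hf
    have h1 := hε.1.one_lt hd
    have hε0 : 0 < ε := by linarith
    obtain ⟨n, hn1, hn2⟩ := exists_mem_Ico_zpow hf0 h1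
    refine ⟨n, ?_⟩
    have hg : IsSignedQuadUnit d (f * (ε ^ n)⁻¹) :=
      hf.mul (hε.1.isSignedQuadUnit.zpow n).inv
    have hpos : 0 < ε ^ n := zpow_pos hε0 n
    rcases eq_or_lt_of_le hn1 with h | h
    · exact h.symm
    · exfalso
      have h2 : 1 < f * (ε ^ n)⁻¹ := by
        rw [← div_eq_mul_inv, one_lt_div hpos]; exact h
      have h3 := hε.2 _ (hg.isQuadUnit h2)
      rw [← div_eq_mul_inv, le_div_iff₀ hpos] at h3
      rw [zpow_add_one₀ hε0.ne'] at hn2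
      linarith [mul_comm ε (ε ^ n)]
  rcases lt_or_gt_of_ne he.ne_zero with h | h
  · obtain ⟨a, ha⟩ := key (-e) (by linarith) he.neg
    exact ⟨a, Or.inr (by linarith)⟩
  · obtain ⟨a, ha⟩ := key e h he
    exact ⟨a, Or.inl ha⟩

lemma Squarefree.eq_of_mul_sq_eq {a b r t : ℕ} (ha : Squarefree a) (hb : Squarefree b)
    (hr : r ≠ 0) (ht : t ≠ 0) (h : a * r ^ 2 = b * t ^ 2) : a = b := by
  refine Nat.eq_of_factorization_eq ha.ne_zero hb.ne_zero fun ℓ => ?_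
  have h1 := congrArg (fun n => n.factorization ℓ) h
  have h2 := ha.natFactorization_le_one ℓ
  have h3 := hb.natFactorization_le_one ℓ
  simp only [Nat.factorization_mul ha.ne_zero (pow_ne_zero 2 hr),
    Nat.factorization_mul hb.ne_zero (pow_ne_zero 2 ht), Nat.factorization_pow,
    Finsupp.add_apply, Finsupp.smul_apply, smul_eq_mul] at h1
  omega

/-- The factorization of `(x + 2)(x - 2) = d y²` for squarefree `d`. -/
lemma exists_factor_of_sq_eq_four_add {d x y : ℕ} (hd : Squarefree d) (hx : 2 < x)
    (h : x ^ 2 = 4 + d * y ^ 2) :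
    ∃ g k c n m : ℕ, d = g * k ∧ (c = 1 ∨ c = 2 ∧ Odd d) ∧ x + 2 = c * g * n ^ 2 ∧
      x = c * k * m ^ 2 + 2 := by
  obtain ⟨t, n, htn, ht⟩ := Nat.sq_mul_squarefree (x + 2)
  obtain ⟨t', m, htm, ht'⟩ := Nat.sq_mul_squarefree (x - 2)
  have hn : n ≠ 0 := by rintro rfl; simp at htn
  have hm : m ≠ 0 := by
    rintro rfl
    simp at htm
    omega
  have hc0 : 0 < Nat.gcd t t' := Nat.gcd_pos_of_pos_left _ ht.ne_zero.bot_lt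
  obtain ⟨g, k, hgk, hg, hk⟩ := Nat.exists_coprime t t'
  set c := Nat.gcd t t' with hc
  have hgt : g ∣ t := ⟨c, hg⟩
  have hkt : k ∣ t' := ⟨c, hk⟩
  have hgk_sf : Squarefree (g * k) :=
    (Nat.squarefree_mul hgk).2 ⟨ht.squarefree_of_dvd hgt, ht'.squarefree_of_dvd hkt⟩
  have hc4 : c ∣ 4 := by
    have h1 : c ∣ x + 2 := htn ▸ (Nat.gcd_dvd_left t t').mul_left _
    have h2 : c ∣ x - 2 := htm ▸ (Nat.gcd_dvd_right t t').mul_left _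
    have := Nat.dvd_sub h1 h2
    rwa [show x + 2 - (x - 2) = 4 by omega] at this
  have hc_sf : Squarefree c := ht.squarefree_of_dvd (Nat.gcd_dvd_left t t')
  have hc12 : c = 1 ∨ c = 2 := by
    have : c ≤ 4 := Nat.le_of_dvd (by norm_num) hc4
    interval_cases c
    · simp
    · simp
    · omega
    · exfalso
      exact absurd (hc_sf 2 (by norm_num)) (by decide)
  have hy : y ≠ 0 := by
    rintro rfl
    nlinarith
  have hprod : (g * k) * (c * n * m) ^ 2 = d * y ^ 2 := by
    have h1 : (x + 2) * (x - 2) = d * y ^ 2 := by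
      obtain ⟨z, rfl⟩ : ∃ z, x = z + 2 := ⟨x - 2, by omega⟩
      simp only [Nat.add_sub_cancel]
      nlinarith
    rw [← h1, ← htn, ← htm]
    calc (g * k) * (c * n * m) ^ 2 = (n ^ 2 * (g * c)) * (m ^ 2 * (k * c)) := by ring
      _ = _ := by rw [← hg, ← hk]
  have hdgk : d = g * k := (hgk_sf.eq_of_mul_sq_eq hd (by positivity) hy hprod).symm
  refine ⟨g, k, c, n, m, hdgk, ?_, ?_, ?_⟩
  · refine hc12.imp_right fun h2 => ⟨h2, ?_⟩
    rw [hg, h2, Nat.squarefree_mul_iff] at ht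
    rw [hk, h2, Nat.squarefree_mul_iff] at ht'
    rw [hdgk]
    exact (Nat.coprime_two_right.1 ht.1).mul (Nat.coprime_two_right.1 ht'.1)
  · rw [← htn, hg]; ring
  · have : c * k * m ^ 2 = x - 2 := by
      rw [← htm, show m ^ 2 * t' = m ^ 2 * (k * c) by rw [← hk]]
      ring
    omega

/-- `e` lies in the square class of the rational number `t` in `ℚ(√d)`. -/
def HasSquareClass (d : ℕ) (e : ℝ) (t : ℕ) : Prop :=
  ∃ A B : ℚ, e = t * ((A : ℝ) + B * √(d : ℝ)) ^ 2

lemma not_sq_eq_neg_four_zmod {ℓ : ℕ} (hℓ : ℓ.Prime) (h4 : ℓ % 4 = 3) (z : ZMod ℓ) :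
    z ^ 2 ≠ -4 := by
  intro h
  have := Fact.mk hℓ
  have h2 : (2 : ZMod ℓ) ≠ 0 := by
    intro h2
    have : ℓ ∣ 2 := (ZMod.natCast_eq_zero_iff 2 ℓ).1 (by exact_mod_cast h2)
    have := Nat.le_of_dvd (by norm_num) this
    interval_cases ℓ <;> omega
  exact ZMod.mod_four_ne_three_of_sq_eq_neg_sq' h2 (by rw [h]; norm_num) h4

lemma IsFundamentalUnit.exists_squareClass {d : ℕ} {e : ℝ} (hd : Squarefree d)
    (he : IsFundamentalUnit d e) {ℓ : ℕ} (hℓ : ℓ.Prime) (hℓd : ℓ ∣ d) (hℓ4 : ℓ % 4 = 3) :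
    ∃ g k c n m : ℕ, d = g * k ∧ (c = 1 ∨ c = 2 ∧ Odd d) ∧ c * g * n ^ 2 = c * k * m ^ 2 + 4 ∧
      ¬ (g = 1 ∧ c = 1) ∧ ¬ (k = 1 ∧ c = 1) ∧
      HasSquareClass d e (c * g) ∧ HasSquareClass d e (c * k) := by
  obtain ⟨⟨x, y, hx, hy, h, hxy⟩, hmin⟩ := he
  have hd2 : 2 ≤ d := hℓ.two_le.trans (Nat.le_of_dvd hd.ne_zero.bot_lt hℓd)
  have hd0 : ((d : ℕ) : ZMod ℓ) = 0 := (ZMod.natCast_eq_zero_iff d ℓ).2 hℓd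
  lift x to ℕ using by omega
  lift y to ℕ using by omega
  have hnorm : x ^ 2 = 4 + d * y ^ 2 := by
    rcases h with h | h
    · zify; linarith
    · exfalso
      have := congrArg (Int.cast : ℤ → ZMod ℓ) h
      push_cast at this
      rw [hd0] at this
      exact not_sq_eq_neg_four_zmod hℓ hℓ4 (x : ZMod ℓ) (by linear_combination this)
  have hx2 : 2 < x := by
    have : 1 ≤ y := by exact_mod_cast hy
    by_contra hcon
    have : x ^ 2 ≤ 4 := by nlinarith
    have : 0 < d * y ^ 2 := by positivity
    omega
  obtain ⟨g, k, c, n, m, hgk, hc, hn, hm⟩ := exists_factor_of_sq_eq_four_add hd hx2 hnorm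
  have hsd : √(d : ℝ) ^ 2 = d := Real.sq_sqrt (by positivity)
  have hnr : (x : ℝ) ^ 2 = 4 + d * y ^ 2 := by exact_mod_cast hnorm
  have hxy' : 2 * e = x + y * √(d : ℝ) := by simpa using hxy
  have hn' : (x : ℝ) + 2 = c * g * n ^ 2 := by exact_mod_cast hn
  have hm' : (x : ℝ) = c * k * m ^ 2 + 2 := by exact_mod_cast hm
  have hcg : c * g ≠ 0 := by rintro h; rw [h] at hn; omega
  have hn0 : n ≠ 0 := by rintro rfl; simp at hn
  have hck : c * k ≠ 0 := by rintro h; rw [h] at hm; omega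
  have hm0 : m ≠ 0 := by rintro rfl; simp at hm; omega
  have key : ∀ t n : ℕ, t ≠ 0 → n ≠ 0 → ∀ δ : ℤ, δ ^ 2 = 4 → (x : ℝ) + δ = t * n ^ 2 →
      HasSquareClass d e t := by
    intro t n ht hn δ hδ h
    refine ⟨(x + δ) / (2 * t * n), y / (2 * t * n), ?_⟩
    have ht' : (t : ℝ) ≠ 0 := by exact_mod_cast ht
    have hn' : (n : ℝ) ≠ 0 := by exact_mod_cast hn
    have hδ' : (δ : ℝ) ^ 2 = 4 := by exact_mod_cast hδ
    push_cast
    field_simp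
    linear_combination (2 * t * n ^ 2 : ℝ) * hxy' - (2 * x + 2 * y * √(d : ℝ)) * h
      - (y : ℝ) ^ 2 * hsd + hnr - hδ'
  refine ⟨g, k, c, n, m, hgk, hc, by omega, ?_, ?_, ?_, ?_⟩
  · rintro ⟨rfl, rfl⟩
    simp only [one_mul] at hgk hn hm hn' hm'
    subst hgk
    set f : ℝ := (n + m * √(d : ℝ)) / 2 with hf
    have hfu : IsQuadUnit d f := by
      refine ⟨n, m, by omega, by omega, Or.inl ?_, by rw [hf]; push_cast; ring⟩
      have : n ^ 2 = d * m ^ 2 + 4 := by omega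
      zify at this
      linarith
    have hy' : n * m = y := by
      have : d * (n * m) ^ 2 = d * y ^ 2 := by
        zify at hn hm hnorm ⊢
        linear_combination hnorm + (x - 2 : ℤ) * (-hn) + n ^ 2 * (-hm)
      have := Nat.eq_of_mul_eq_mul_left hd.ne_zero.bot_lt this
      exact Nat.pow_left_injective (by norm_num) this
    have hy'' : (n : ℝ) * m = y := by exact_mod_cast hy'
    have hfe : f ^ 2 = e := by
      rw [hf]
      linear_combination (1 / 4 : ℝ) * m ^ 2 * hsd + (1 / 2 : ℝ) * √(d : ℝ) * hy''
        - (1 / 2 : ℝ) * hxy' - (1 / 4 : ℝ) * hn' - (1 / 4 : ℝ) * hm'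
    have h1 := hfu.one_lt hd2
    have h2 := hmin f hfu
    nlinarith
  · rintro ⟨rfl, rfl⟩
    have := congrArg (Nat.cast : ℕ → ZMod ℓ) (show g * n ^ 2 = m ^ 2 + 4 by
      simp only [one_mul, mul_one] at hn hm; omega)
    simp only [mul_one] at hgk
    rw [← hgk] at this
    push_cast at this
    rw [hd0] at this
    exact not_sq_eq_neg_four_zmod hℓ hℓ4 (m : ZMod ℓ) (by linear_combination -this)
  · exact key _ n hcg hn0 2 (by norm_num) (by push_cast; linarith)
  · exact key _ m hck hm0 (-2) (by norm_num) (by push_cast; linarith)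

lemma Nat.Prime.mul_eq_mul_cases {r N g k : ℕ} (hr : r.Prime) (h : r * N = g * k) :
    (∃ g', g = r * g' ∧ N = g' * k) ∨ ∃ k', k = r * k' ∧ N = g * k' := by
  rcases (hr.dvd_mul).1 (Dvd.intro _ h) with ⟨g', rfl⟩ | ⟨k', rfl⟩
  · exact Or.inl ⟨g', rfl, Nat.eq_of_mul_eq_mul_left hr.pos (by rw [h]; ring)⟩
  · exact Or.inr ⟨k', rfl, Nat.eq_of_mul_eq_mul_left hr.pos (by rw [h]; ring)⟩

lemma legendreSym_ne_neg_one_of_dvd_right {g k c n m ℓ : ℕ} [Fact ℓ.Prime] (h2 : ℓ ≠ 2)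
    (h : c * g * n ^ 2 = c * k * m ^ 2 + 4) (hk : ℓ ∣ k) :
    legendreSym ℓ ((c : ℤ) * g) ≠ -1 := by
  rw [Ne, legendreSym.eq_neg_one_iff, not_not]
  have h' := congrArg (Nat.cast : ℕ → ZMod ℓ) h
  have hk0 : ((k : ℕ) : ZMod ℓ) = 0 := (ZMod.natCast_eq_zero_iff k ℓ).2 hk
  push_cast at h' ⊢
  rw [hk0] at h'
  have h20 : (2 : ZMod ℓ) ≠ 0 := by
    have : ((2 : ℕ) : ZMod ℓ) ≠ 0 := by
      rw [Ne, ZMod.natCast_eq_zero_iff, Nat.prime_dvd_prime_iff_eq Fact.out Nat.prime_two]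
      exact h2
    exact_mod_cast this
  have hn0 : (n : ZMod ℓ) ≠ 0 := by
    intro hn0
    rw [hn0] at h'
    have h4 : (2 : ZMod ℓ) ^ 2 = 0 := by linear_combination -h'
    exact h20 (pow_eq_zero_iff (two_ne_zero) |>.1 h4)
  refine ⟨2 / n, ?_⟩
  field_simp
  linear_combination h'

lemma legendreSym_ne_neg_one_of_dvd_left {g k c n m ℓ : ℕ} [Fact ℓ.Prime] (h2 : ℓ ≠ 2)
    (h : c * g * n ^ 2 = c * k * m ^ 2 + 4) (hg : ℓ ∣ g) :
    legendreSym ℓ (-1) * legendreSym ℓ ((c : ℤ) * k) ≠ -1 := by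
  rw [← legendreSym.mul, Ne, legendreSym.eq_neg_one_iff, not_not]
  have h' := congrArg (Nat.cast : ℕ → ZMod ℓ) h
  have hk0 : ((g : ℕ) : ZMod ℓ) = 0 := (ZMod.natCast_eq_zero_iff g ℓ).2 hg
  push_cast at h' ⊢
  rw [hk0] at h'
  have h20 : (2 : ZMod ℓ) ≠ 0 := by
    have : ((2 : ℕ) : ZMod ℓ) ≠ 0 := by
      rw [Ne, ZMod.natCast_eq_zero_iff, Nat.prime_dvd_prime_iff_eq Fact.out Nat.prime_two]
      exact h2
    exact_mod_cast this
  have hm0 : (m : ZMod ℓ) ≠ 0 := by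
    intro hm0
    rw [hm0] at h'
    have h4 : (2 : ZMod ℓ) ^ 2 = 0 := by linear_combination -h'
    exact h20 (pow_eq_zero_iff (two_ne_zero) |>.1 h4)
  refine ⟨2 / m, ?_⟩
  field_simp
  linear_combination h'

lemma HasSquareClass.congr {d t t' : ℕ} {e : ℝ} (h : HasSquareClass d e t) (ht : t = t') :
    HasSquareClass d e t' := ht ▸ h

lemma Nat.Prime.squarefree_mul_of_ne {p q : ℕ} (hp : p.Prime) (hq : q.Prime) (h : p ≠ q) :
    Squarefree (p * q) :=
  (Nat.squarefree_mul ((Nat.coprime_primes hp hq).2 h)).2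
    ⟨hp.prime.squarefree, hq.prime.squarefree⟩

lemma Nat.Prime.squarefree_two_mul_mul {p q : ℕ} (hp : p.Prime) (hq : q.Prime) (h : p ≠ q)
    (hp2 : p ≠ 2) (hq2 : q ≠ 2) : Squarefree (2 * p * q) := by
  rw [mul_assoc]
  refine (Nat.squarefree_mul ?_).2 ⟨Nat.prime_two.prime.squarefree, hp.squarefree_mul_of_ne hq h⟩
  exact Nat.Coprime.mul_right ((Nat.coprime_primes Nat.prime_two hp).2 hp2.symm)
    ((Nat.coprime_primes Nat.prime_two hq).2 hq2.symm)

section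

variable {p r : ℕ} [Fact p.Prime] [Fact r.Prime] {e : ℝ}

lemma IsFundamentalUnit.hasSquareClass_two_mul (hpr : p ≠ r) (hp2 : p ≠ 2)
    (hr4 : r % 4 = 3) (hpn : legendreSym p (-1) = 1) (hpt : legendreSym p 2 = -1)
    (hprl : legendreSym p r = -1)
    (he : IsFundamentalUnit (p * r) e) : HasSquareClass (p * r) e (2 * p) := by
  have hp : p.Prime := Fact.out
  have hr : r.Prime := Fact.out
  obtain ⟨g, k, c, n, m, hgk, hc, h, h1, h2, h3, h4⟩ :=
    he.exists_squareClass (hp.squarefree_mul_of_ne hr hpr) hr (Dvd.intro_left _ rfl) hr4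
  have Lp := legendreSym_ne_neg_one_of_dvd_right (ℓ := p) hp2 h
  have Lp' := legendreSym_ne_neg_one_of_dvd_left (ℓ := p) hp2 h
  rcases hp.mul_eq_mul_cases hgk with ⟨g, rfl, h5⟩ | ⟨k, rfl, h5⟩ <;>
  rcases hr.mul_eq_mul_cases (N := 1) ((mul_one r).trans h5) with
    ⟨g, rfl, h6⟩ | ⟨k, rfl, h6⟩ <;>
  obtain ⟨rfl, rfl⟩ := mul_eq_one.1 h6.symm <;>
  rcases hc with rfl | ⟨rfl, -⟩ <;>
  first
  | exact h3.congr (by ring1)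
  | exact h4.congr (by ring1)
  | exact absurd ⟨rfl, rfl⟩ h1
  | exact absurd ⟨rfl, rfl⟩ h2
  | (simp [legendreSym.mul, hpt, hprl] at Lp; done)
  | simp [hpn, hpt, hprl] at Lp'

lemma IsFundamentalUnit.hasSquareClass_of_two_mul (hpr : p ≠ r) (hp2 : p ≠ 2)
    (hr4 : r % 4 = 3) (hpn : legendreSym p (-1) = 1) (hpt : legendreSym p 2 = -1)
    (hprl : legendreSym p r = -1) (he : IsFundamentalUnit (2 * p * r) e) :
    HasSquareClass (2 * p * r) e p := by
  have hp : p.Prime := Fact.out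
  have hr : r.Prime := Fact.out
  have hr2 : r ≠ 2 := by omega
  have hd := hp.squarefree_two_mul_mul hr hpr hp2 hr2
  obtain ⟨g, k, c, n, m, hgk, hc, h, h1, h2, h3, h4⟩ :=
    he.exists_squareClass hd hr (Dvd.intro_left _ rfl) hr4
  have Lp := legendreSym_ne_neg_one_of_dvd_right (ℓ := p) hp2 h
  have Lp' := legendreSym_ne_neg_one_of_dvd_left (ℓ := p) hp2 h
  obtain rfl : c = 1 := by
    rcases hc with rfl | ⟨-, hodd⟩
    · rfl
    · exact absurd hodd (Nat.not_odd_iff_even.2 ((even_two_mul p).mul_right r))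
  rw [mul_assoc] at hgk
  rcases Nat.prime_two.mul_eq_mul_cases hgk with ⟨g, rfl, h7⟩ | ⟨k, rfl, h7⟩ <;>
  rcases hp.mul_eq_mul_cases h7 with ⟨g, rfl, h5⟩ | ⟨k, rfl, h5⟩ <;>
  rcases hr.mul_eq_mul_cases (N := 1) ((mul_one r).trans h5) with
    ⟨g, rfl, h6⟩ | ⟨k, rfl, h6⟩ <;>
  obtain ⟨rfl, rfl⟩ := mul_eq_one.1 h6.symm <;>
  first
  | exact h3.congr (by ring1)
  | exact h4.congr (by ring1)
  | exact absurd ⟨rfl, rfl⟩ h1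
  | exact absurd ⟨rfl, rfl⟩ h2
  | (simp [legendreSym.mul, hpt, hprl] at Lp; done)
  | simp [hpn, hpt, hprl] at Lp'

lemma IsFundamentalUnit.hasSquareClass_left (hpr : p ≠ r) (hp4 : p % 4 = 3) (hr4 : r % 4 = 3)
    (hpn : legendreSym p (-1) = -1) (hpt : legendreSym p 2 = 1) (hprl : legendreSym p r = -1)
    (hrt : legendreSym r 2 = -1) (hrpl : legendreSym r p = 1)
    (he : IsFundamentalUnit (p * r) e) : HasSquareClass (p * r) e p := by
  have hp : p.Prime := Fact.out
  have hr : r.Prime := Fact.out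
  have hp2 : p ≠ 2 := by omega
  have hr2 : r ≠ 2 := by omega
  obtain ⟨g, k, c, n, m, hgk, hc, h, h1, h2, h3, h4⟩ :=
    he.exists_squareClass (hp.squarefree_mul_of_ne hr hpr) hr (Dvd.intro_left _ rfl) hr4
  have Lp := legendreSym_ne_neg_one_of_dvd_right (ℓ := p) hp2 h
  have Lp' := legendreSym_ne_neg_one_of_dvd_left (ℓ := p) hp2 h
  have Lr := legendreSym_ne_neg_one_of_dvd_right (ℓ := r) hr2 h
  rcases hp.mul_eq_mul_cases hgk with ⟨g, rfl, h5⟩ | ⟨k, rfl, h5⟩ <;>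
  rcases hr.mul_eq_mul_cases (N := 1) ((mul_one r).trans h5) with
    ⟨g, rfl, h6⟩ | ⟨k, rfl, h6⟩ <;>
  obtain ⟨rfl, rfl⟩ := mul_eq_one.1 h6.symm <;>
  rcases hc with rfl | ⟨rfl, -⟩ <;>
  first
  | exact h3.congr (by ring1)
  | exact h4.congr (by ring1)
  | exact absurd ⟨rfl, rfl⟩ h1
  | exact absurd ⟨rfl, rfl⟩ h2
  | (simp [legendreSym.mul, hpt, hprl] at Lp; done)
  | (simp [legendreSym.mul, hpn, hpt, hprl] at Lp'; done)
  | simp [legendreSym.mul, hrt, hrpl] at Lr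

lemma IsFundamentalUnit.hasSquareClass_left_of_two_mul (hpr : p ≠ r) (hp4 : p % 4 = 3)
    (hr4 : r % 4 = 3) (hpn : legendreSym p (-1) = -1) (hpt : legendreSym p 2 = 1)
    (hprl : legendreSym p r = -1) (hrt : legendreSym r 2 = -1) (hrpl : legendreSym r p = 1)
    (he : IsFundamentalUnit (2 * p * r) e) : HasSquareClass (2 * p * r) e p := by
  have hp : p.Prime := Fact.out
  have hr : r.Prime := Fact.out
  have hp2 : p ≠ 2 := by omega
  have hr2 : r ≠ 2 := by omega
  have hd := hp.squarefree_two_mul_mul hr hpr hp2 hr2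
  obtain ⟨g, k, c, n, m, hgk, hc, h, h1, h2, h3, h4⟩ :=
    he.exists_squareClass hd hr (Dvd.intro_left _ rfl) hr4
  have Lp := legendreSym_ne_neg_one_of_dvd_right (ℓ := p) hp2 h
  have Lp' := legendreSym_ne_neg_one_of_dvd_left (ℓ := p) hp2 h
  have Lr := legendreSym_ne_neg_one_of_dvd_right (ℓ := r) hr2 h
  obtain rfl : c = 1 := by
    rcases hc with rfl | ⟨-, hodd⟩
    · rfl
    · exact absurd hodd (Nat.not_odd_iff_even.2 ((even_two_mul p).mul_right r))
  rw [mul_assoc] at hgk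
  rcases Nat.prime_two.mul_eq_mul_cases hgk with ⟨g, rfl, h7⟩ | ⟨k, rfl, h7⟩ <;>
  rcases hp.mul_eq_mul_cases h7 with ⟨g, rfl, h5⟩ | ⟨k, rfl, h5⟩ <;>
  rcases hr.mul_eq_mul_cases (N := 1) ((mul_one r).trans h5) with
    ⟨g, rfl, h6⟩ | ⟨k, rfl, h6⟩ <;>
  obtain ⟨rfl, rfl⟩ := mul_eq_one.1 h6.symm <;>
  first
  | exact h3.congr (by ring1)
  | exact h4.congr (by ring1)
  | exact absurd ⟨rfl, rfl⟩ h1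
  | exact absurd ⟨rfl, rfl⟩ h2
  | (simp [legendreSym.mul, hpt, hprl] at Lp; done)
  | (simp [legendreSym.mul, hpn, hpt, hprl] at Lp'; done)
  | simp [legendreSym.mul, hrt, hrpl] at Lr

end

/-- Three commuting involutions of `K` whose common fixed field is `ℚ`. -/
structure IsFrame {K : Type*} [Field K] [Algebra ℚ K] (τ₁ τ₂ τ₃ : K ≃ₐ[ℚ] K) : Prop where
  invol₁ : τ₁ * τ₁ = 1
  invol₂ : τ₂ * τ₂ = 1
  invol₃ : τ₃ * τ₃ = 1
  comm₁₂ : τ₁ * τ₂ = τ₂ * τ₁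
  comm₁₃ : τ₁ * τ₃ = τ₃ * τ₁
  comm₂₃ : τ₂ * τ₃ = τ₃ * τ₂
  fixed : ∀ z : K, τ₁ z = z → τ₂ z = z → τ₃ z = z → ∃ r : ℚ, algebraMap ℚ K r = z

section MultiquadraticField

open Polynomial in
lemma splits_minpoly_of_sq_eq {K : Type*} [Field K] [Algebra ℚ K] {x : ℝ} {y : K} {r : ℚ}
    (hx : x ^ 2 = r) (hy : y ^ 2 = algebraMap ℚ K r) :
    ((minpoly ℚ x).map (algebraMap ℚ K)).Splits := by
  have hsplit : ((X ^ 2 - C r : ℚ[X]).map (algebraMap ℚ K)).Splits := by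
    have : (X ^ 2 - C r : ℚ[X]).map (algebraMap ℚ K) = (X - C y) * (X - C (-y)) := by
      simp only [Polynomial.map_sub, Polynomial.map_pow, map_X, map_C, ← hy, C_pow, C_neg]
      ring
    rw [this]
    exact (Splits.X_sub_C _).mul (Splits.X_sub_C _)
  have hdvd : minpoly ℚ x ∣ X ^ 2 - C r := minpoly.dvd ℚ x (by simp [hx])
  have hne : (X ^ 2 - C r : ℚ[X]).map (algebraMap ℚ K) ≠ 0 :=
    ((monic_X_pow_sub_C r two_ne_zero).map _).ne_zero
  exact hsplit.of_dvd hne (Polynomial.map_dvd _ hdvd)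

lemma isIntegral_of_sq_eq {x : ℝ} {r : ℚ} (hx : x ^ 2 = r) : IsIntegral ℚ x :=
  IsIntegral.of_pow two_pos (by rw [hx]; exact isIntegral_algebraMap (R := ℚ) (x := r))

lemma isGalois_of_eq_adjoin_of_sq_mem {K : IntermediateField ℚ ℝ} {S : Set ℝ}
    (hK : K = adjoin ℚ S) (hS : ∀ x ∈ S, ∃ r : ℚ, x ^ 2 = r) : IsGalois ℚ K := by
  have hint : ∀ x ∈ S, IsIntegral ℚ x := by
    intro x hx
    obtain ⟨r, hr⟩ := hS x hx
    exact isIntegral_of_sq_eq hr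
  have halg : Algebra.IsAlgebraic ℚ K := by
    rw [hK]
    exact isAlgebraic_adjoin hint
  have hsplit : ∀ x ∈ S, IsIntegral ℚ x ∧ ((minpoly ℚ x).map (algebraMap ℚ K)).Splits := by
    intro x hx
    obtain ⟨r, hr⟩ := hS x hx
    have hxK : x ∈ K := hK ▸ subset_adjoin _ _ hx
    exact ⟨hint x hx, splits_minpoly_of_sq_eq (y := (⟨x, hxK⟩ : K)) hr
      (Subtype.ext (by simpa using hr))⟩
  have hnormal : Normal ℚ K := by
    refine normal_iff.2 fun z => ⟨(Algebra.IsAlgebraic.isAlgebraic z).isIntegral, ?_⟩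
    have hz : minpoly ℚ z = minpoly ℚ (z : ℝ) := IntermediateField.minpoly_eq z
    rw [hz]
    exact splits_of_mem_adjoin ℚ ℝ hsplit (hK ▸ z.2)
  exact { }

/-- The quadratic character cut out by an element that every automorphism maps to itself or
to its negative. -/
def quadraticSignHom {K : Type*} [Field K] [Algebra ℚ K] (x : K) (hx : x ≠ 0)
    (h : ∀ g : K ≃ₐ[ℚ] K, g x = x ∨ g x = -x) : (K ≃ₐ[ℚ] K) →* ℤˣ := by
  classical
  exact
  { toFun := fun g => if g x = x then 1 else -1
    map_one' := by simp
    map_mul' := by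
      intro f g
      have : CharZero K := algebraRat.charZero K
      have hne : -x ≠ x := fun hh => hx (by simpa using self_eq_neg.1 hh.symm)
      rcases h f with hf | hf <;> rcases h g with hg | hg <;>
        simp [hf, hg, hne] }

lemma quadraticSignHom_eq_one_iff {K : Type*} [Field K] [Algebra ℚ K] (x : K) (hx : x ≠ 0)
    (h : ∀ g : K ≃ₐ[ℚ] K, g x = x ∨ g x = -x) (g : K ≃ₐ[ℚ] K) :
    quadraticSignHom x hx h g = 1 ↔ g x = x := by
  classical
  simp only [quadraticSignHom, MonoidHom.coe_mk, OneHom.coe_mk]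
  split_ifs with hg <;> simp [hg]

lemma apply_eq_quadraticSignHom_mul {K : Type*} [Field K] [Algebra ℚ K] (x : K) (hx : x ≠ 0)
    (h : ∀ g : K ≃ₐ[ℚ] K, g x = x ∨ g x = -x) (g : K ≃ₐ[ℚ] K) :
    g x = ((quadraticSignHom x hx h g : ℤ) : K) * x := by
  rcases Int.units_eq_one_or (quadraticSignHom x hx h g) with h1 | h1
  · rw [h1]
    simpa using (quadraticSignHom_eq_one_iff x hx h g).1 h1
  · have : g x ≠ x := fun h2 => by
      rw [(quadraticSignHom_eq_one_iff x hx h g).2 h2] at h1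
      exact absurd h1 (by decide)
    rw [h1]
    simpa using (h g).resolve_left this

lemma exists_mem_ne_one_eq_one {G : Type*} [Group G] (H : Subgroup G) (χ ψ : G →* ℤˣ)
    (h₁ : ∃ g ∈ H, χ g ≠ 1) (h₂ : ∃ g ∈ H, χ g * ψ g ≠ 1) :
    ∃ g ∈ H, χ g ≠ 1 ∧ ψ g = 1 := by
  obtain ⟨g, hgH, hg⟩ := h₁
  obtain ⟨f, hfH, hf⟩ := h₂
  by_contra! hcon
  have h1 := hcon g hgH hg
  have h2 := hcon f hfH
  have h3 := hcon (g * f) (H.mul_mem hgH hfH)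
  simp only [map_mul] at h3
  rcases Int.units_eq_one_or (χ g) with a | a <;> rcases Int.units_eq_one_or (ψ g) with b | b <;>
    rcases Int.units_eq_one_or (χ f) with c | c <;> rcases Int.units_eq_one_or (ψ f) with d | d <;>
    simp_all

lemma exists_ne_one_eq_one_eq_one {G : Type*} [Group G] (χ ψ φ : G →* ℤˣ)
    (h₁ : ∃ g, χ g ≠ 1) (h₂ : ∃ g, χ g * ψ g ≠ 1) (h₃ : ∃ g, χ g * φ g ≠ 1)
    (h₄ : ∃ g, χ g * ψ g * φ g ≠ 1) : ∃ g, χ g ≠ 1 ∧ ψ g = 1 ∧ φ g = 1 := by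
  obtain ⟨g, hg, h⟩ := exists_mem_ne_one_eq_one φ.ker χ ψ
    (by
      obtain ⟨g, -, h, h'⟩ := exists_mem_ne_one_eq_one ⊤ χ φ (by simpa using h₁) (by simpa using h₃)
      exact ⟨g, h', h⟩)
    (by
      obtain ⟨g, -, h, h'⟩ := exists_mem_ne_one_eq_one ⊤ (χ * ψ) φ (by simpa using h₂)
        (by simpa using h₄)
      exact ⟨g, h', h⟩)
  exact ⟨g, h.1, h.2, hg⟩

lemma exists_isFrame {K : IntermediateField ℚ ℝ} {m₁ m₂ m₃ : ℕ}
    (hK : K = adjoin ℚ {√(m₁ : ℝ), √(m₂ : ℝ), √(m₃ : ℝ)})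
    (h₁ : ¬ IsSquare m₁) (h₂ : ¬ IsSquare m₂) (h₃ : ¬ IsSquare m₃)
    (h₁₂ : ¬ IsSquare (m₁ * m₂)) (h₁₃ : ¬ IsSquare (m₁ * m₃)) (h₂₃ : ¬ IsSquare (m₂ * m₃))
    (h₁₂₃ : ¬ IsSquare (m₁ * m₂ * m₃)) :
    ∃ a b c : K, (a : ℝ) = √(m₁ : ℝ) ∧ (b : ℝ) = √(m₂ : ℝ) ∧ (c : ℝ) = √(m₃ : ℝ) ∧
      ∃ σ₁ σ₂ σ₃ : K ≃ₐ[ℚ] K, IsFrame σ₁ σ₂ σ₃ ∧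
        (σ₁ a = -a ∧ σ₁ b = b ∧ σ₁ c = c) ∧ (σ₂ a = a ∧ σ₂ b = -b ∧ σ₂ c = c) ∧
        (σ₃ a = a ∧ σ₃ b = b ∧ σ₃ c = -c) := by
  have hgal : IsGalois ℚ K := by
    refine isGalois_of_eq_adjoin_of_sq_mem hK ?_
    rintro x (rfl | rfl | rfl)
    · exact ⟨m₁, by simp⟩
    · exact ⟨m₂, by simp⟩
    · exact ⟨m₃, by simp⟩
  let a : K := ⟨√(m₁ : ℝ), hK ▸ subset_adjoin _ _ (by simp)⟩
  let b : K := ⟨√(m₂ : ℝ), hK ▸ subset_adjoin _ _ (by simp)⟩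
  let c : K := ⟨√(m₃ : ℝ), hK ▸ subset_adjoin _ _ (by simp)⟩
  have ha2 : a ^ 2 = (m₁ : K) := Subtype.ext (by simp [a])
  have hb2 : b ^ 2 = (m₂ : K) := Subtype.ext (by simp [b])
  have hc2 : c ^ 2 = (m₃ : K) := Subtype.ext (by simp [c])
  have hmove : ∀ (x : K) (n : ℕ), x ^ 2 = n → ¬ IsSquare n → ∃ g : K ≃ₐ[ℚ] K, g x ≠ x := by
    intro x n hx hn
    by_contra! hcon
    obtain ⟨r, hr⟩ := (InfiniteGalois.mem_range_algebraMap_iff_fixed x).2 hcon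
    have h : algebraMap ℚ K (r ^ 2) = algebraMap ℚ K n := by rw [map_pow, hr, hx]; simp
    have h' := (algebraMap ℚ K).injective h
    exact hn (Rat.isSquare_natCast_iff.1 ⟨r, by rw [← h', sq]⟩)
  have hsign : ∀ (x : K) (n : ℕ), x ^ 2 = n → ∀ g : K ≃ₐ[ℚ] K, g x = x ∨ g x = -x := by
    intro x n hx g
    rw [← sq_eq_sq_iff_eq_or_eq_neg, ← map_pow, hx, map_natCast]
  have hne : ∀ (x : K) (n : ℕ), x ^ 2 = n → ¬ IsSquare n → x ≠ 0 := by
    rintro x n hx hn rfl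
    exact hn ⟨0, by exact_mod_cast (show (n : K) = 0 by rw [← hx]; simp)⟩
  have hext : ∀ f g : K ≃ₐ[ℚ] K, f a = g a → f b = g b → f c = g c → f = g := by
    intro f g h1 h2 h3
    have : (f : K →ₐ[ℚ] K) = g := by
      refine algHom_ext_of_eq_adjoin ℚ hK ?_
      rintro x (rfl | rfl | rfl)
      exacts [h1, h2, h3]
    exact AlgEquiv.ext fun z => DFunLike.congr_fun this z
  have hflip : ∀ (x y z : K) (k l m : ℕ), x ^ 2 = k → y ^ 2 = l → z ^ 2 = m → ¬ IsSquare k →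
      ¬ IsSquare l → ¬ IsSquare m → ¬ IsSquare (k * l) → ¬ IsSquare (k * m) →
      ¬ IsSquare (k * l * m) → ∃ g : K ≃ₐ[ℚ] K, g x = -x ∧ g y = y ∧ g z = z := by
    intro x y z k l m hx hy hz hk hl hm hkl hkm hklm
    have hx' := apply_eq_quadraticSignHom_mul x (hne x _ hx hk) (hsign x _ hx)
    have hy' := apply_eq_quadraticSignHom_mul y (hne y _ hy hl) (hsign y _ hy)
    have hz' := apply_eq_quadraticSignHom_mul z (hne z _ hz hm) (hsign z _ hz)
    obtain ⟨g, h1, h2, h3⟩ := exists_ne_one_eq_one_eq_one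
      (quadraticSignHom x (hne x _ hx hk) (hsign x _ hx))
      (quadraticSignHom y (hne y _ hy hl) (hsign y _ hy))
      (quadraticSignHom z (hne z _ hz hm) (hsign z _ hz))
      (by
        obtain ⟨g, hg⟩ := hmove x k hx hk
        exact ⟨g, fun h => hg (by rw [hx', h]; simp)⟩)
      (by
        obtain ⟨g, hg⟩ := hmove (x * y) (k * l) (by rw [mul_pow, hx, hy]; simp) hkl
        refine ⟨g, fun h => hg ?_⟩
        rw [map_mul, hx', hy', mul_mul_mul_comm, ← Int.cast_mul, ← Units.val_mul, h]
        simp)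
      (by
        obtain ⟨g, hg⟩ := hmove (x * z) (k * m) (by rw [mul_pow, hx, hz]; simp) hkm
        refine ⟨g, fun h => hg ?_⟩
        rw [map_mul, hx', hz', mul_mul_mul_comm, ← Int.cast_mul, ← Units.val_mul, h]
        simp)
      (by
        obtain ⟨g, hg⟩ := hmove (x * y * z) (k * l * m)
          (by rw [mul_pow, mul_pow, hx, hy, hz]; simp) hklm
        refine ⟨g, fun h => hg ?_⟩
        have h' := congrArg (fun u : ℤˣ => ((u : ℤ) : K)) h
        simp only [Units.val_mul, Int.cast_mul, Units.val_one, Int.cast_one] at h'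
        rw [map_mul, map_mul, hx', hy', hz']
        linear_combination (x * y * z) * h')
    refine ⟨g, (hsign x _ hx g).resolve_left fun h => h1 ?_,
      (quadraticSignHom_eq_one_iff _ _ _ g).1 h2, (quadraticSignHom_eq_one_iff _ _ _ g).1 h3⟩
    exact (quadraticSignHom_eq_one_iff _ _ _ g).2 h
  obtain ⟨σ₁, h1a, h1b, h1c⟩ := hflip a b c _ _ _ ha2 hb2 hc2 h₁ h₂ h₃ h₁₂ h₁₃ h₁₂₃
  obtain ⟨σ₂, h2b, h2a, h2c⟩ := hflip b a c _ _ _ hb2 ha2 hc2 h₂ h₁ h₃ (by rwa [mul_comm])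
    h₂₃ (by rwa [mul_comm m₂])
  obtain ⟨σ₃, h3c, h3a, h3b⟩ := hflip c a b _ _ _ hc2 ha2 hb2 h₃ h₁ h₂ (by rwa [mul_comm])
    (by rwa [mul_comm]) (by rwa [mul_assoc, mul_comm])
  refine ⟨a, b, c, rfl, rfl, rfl, σ₁, σ₂, σ₃, ?_, ⟨h1a, h1b, h1c⟩, ⟨h2a, h2b, h2c⟩,
    ⟨h3a, h3b, h3c⟩⟩
  refine ⟨?_, ?_, ?_, ?_, ?_, ?_, fun z hz1 hz2 hz3 => ?_⟩
  iterate 6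
    apply hext <;> simp only [AlgEquiv.mul_apply, AlgEquiv.one_apply, map_neg, neg_neg, *]
  refine (InfiniteGalois.mem_range_algebraMap_iff_fixed z).2 fun g => ?_
  rcases hsign a _ ha2 g with ga | ga <;> rcases hsign b _ hb2 g with gb | gb <;>
    rcases hsign c _ hc2 g with gc | gc
  · rw [hext g 1 (by simp [*]) (by simp [*]) (by simp [*])]; simp
  · rw [hext g σ₃ (by simp [*]) (by simp [*]) (by simp [*])]; simp [*]
  · rw [hext g σ₂ (by simp [*]) (by simp [*]) (by simp [*])]; simp [*]
  · rw [hext g (σ₂ * σ₃) (by simp [*]) (by simp [*]) (by simp [*])]; simp [*]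
  · rw [hext g σ₁ (by simp [*]) (by simp [*]) (by simp [*])]; simp [*]
  · rw [hext g (σ₁ * σ₃) (by simp [*]) (by simp [*]) (by simp [*])]; simp [*]
  · rw [hext g (σ₁ * σ₂) (by simp [*]) (by simp [*]) (by simp [*])]; simp [*]
  · rw [hext g (σ₁ * σ₂ * σ₃) (by simp [*]) (by simp [*]) (by simp [*])]; simp [*]

end MultiquadraticField

/-- A nonzero element of a field that is integral over `ℤ` together with its inverse. -/
structure IsIntUnit {K : Type*} [Field K] (z : K) : Prop where
  ne_zero : z ≠ 0
  isIntegral : IsIntegral ℤ z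
  isIntegral_inv : IsIntegral ℤ z⁻¹

namespace IsIntUnit

variable {K : Type*} [Field K] {y z : K}

lemma mul (hy : IsIntUnit y) (hz : IsIntUnit z) : IsIntUnit (y * z) where
  ne_zero := mul_ne_zero hy.ne_zero hz.ne_zero
  isIntegral := hy.isIntegral.mul hz.isIntegral
  isIntegral_inv := by
    rw [mul_inv]
    exact hy.isIntegral_inv.mul hz.isIntegral_inv

lemma map [Algebra ℚ K] (hz : IsIntUnit z) (τ : K ≃ₐ[ℚ] K) : IsIntUnit (τ z) where
  ne_zero := by simpa using hz.ne_zero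
  isIntegral := hz.isIntegral.map (τ : K →+* K).toIntAlgHom
  isIntegral_inv := by
    rw [← map_inv₀]
    exact hz.isIntegral_inv.map (τ : K →+* K).toIntAlgHom

lemma of_sq (hz : IsIntUnit (z ^ 2)) : IsIntUnit z where
  ne_zero := by rintro rfl; exact hz.ne_zero (by simp)
  isIntegral := hz.isIntegral.of_pow two_pos
  isIntegral_inv := IsIntegral.of_pow two_pos (by rw [inv_pow]; exact hz.isIntegral_inv)

lemma coe_units (u : (𝓞 K)ˣ) : IsIntUnit ((u : 𝓞 K) : K) where
  ne_zero := by simp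
  isIntegral := (u : 𝓞 K).isIntegral_coe
  isIntegral_inv := by
    have h : (((u⁻¹ : (𝓞 K)ˣ) : 𝓞 K) : K) = ((u : 𝓞 K) : K)⁻¹ := by
      refine eq_inv_of_mul_eq_one_left ?_
      rw [← map_mul, Units.inv_mul, map_one]
    rw [← h]
    exact RingOfIntegers.isIntegral_coe _

/-- The unit of the ring of integers defined by `z`. -/
def toUnits (hz : IsIntUnit z) : (𝓞 K)ˣ where
  val := ⟨z, hz.isIntegral⟩
  inv := ⟨z⁻¹, hz.isIntegral_inv⟩
  val_inv := RingOfIntegers.ext (mul_inv_cancel₀ hz.ne_zero)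
  inv_val := RingOfIntegers.ext (inv_mul_cancel₀ hz.ne_zero)

lemma coe_toUnits (hz : IsIntUnit z) : ((hz.toUnits : 𝓞 K) : K) = z := rfl

lemma eq_one_or_neg_one [Algebra ℚ K] {r : ℚ} (hz : IsIntUnit (algebraMap ℚ K r)) :
    r = 1 ∨ r = -1 := by
  have hinj : Function.Injective (algebraMap ℚ K) := (algebraMap ℚ K).injective
  obtain ⟨m, hm⟩ := IsIntegrallyClosed.isIntegral_iff.1
    ((isIntegral_algHom_iff (algebraMap ℚ K).toIntAlgHom hinj).1 hz.isIntegral)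
  have h2 := hz.isIntegral_inv
  rw [← map_inv₀] at h2
  obtain ⟨n, hn⟩ := IsIntegrallyClosed.isIntegral_iff.1
    ((isIntegral_algHom_iff (algebraMap ℚ K).toIntAlgHom hinj).1 h2)
  have hr : r ≠ 0 := by rintro rfl; exact hz.ne_zero (by simp)
  have hmn : m * n = 1 := by
    have : ((m * n : ℤ) : ℚ) = 1 := by
      push_cast
      simp only [eq_intCast] at hm hn
      rw [hm, hn, mul_inv_cancel₀ hr]
    exact_mod_cast this
  rcases Int.eq_one_or_neg_one_of_mul_eq_one hmn with rfl | rfl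
  · left; simpa using hm.symm
  · right; simpa using hm.symm

end IsIntUnit

lemma Squarefree.exists_int_of_mul_sq_eq {d : ℕ} (hd : Squarefree d) {y : ℚ} {n : ℤ}
    (h : (d : ℚ) * y ^ 2 = n) : ∃ m : ℤ, y = m := by
  have hden : (y.den : ℚ) ≠ 0 := by exact_mod_cast y.den_nz
  have h1 : (d : ℤ) * y.num ^ 2 = n * (y.den : ℤ) ^ 2 := by
    have h2 := h
    rw [← Rat.num_div_den y, div_pow] at h2
    field_simp at h2
    rw [mul_comm n]
    exact_mod_cast h2
  have hcop : IsCoprime ((y.den : ℤ) ^ 2) (y.num ^ 2) :=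
    (Int.isCoprime_iff_gcd_eq_one.2 (by
      rw [Int.gcd_comm]; simpa [Int.gcd, Nat.Coprime] using y.reduced)).pow
  have h3 : (y.den : ℤ) ^ 2 ∣ d := hcop.dvd_of_dvd_mul_right ⟨n, by rw [h1]; ring⟩
  have h4 : y.den * y.den ∣ d := by rw [← sq]; exact_mod_cast h3
  have h5 : y.den = 1 := by simpa using hd _ h4
  exact ⟨y.num, (Rat.den_eq_one_iff y).1 h5 |>.symm⟩

namespace IsFrame

section Field

variable {K : Type*} [Field K] [Algebra ℚ K] {τ₁ τ₂ τ₃ : K ≃ₐ[ℚ] K}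

lemma swap₁₂ (h : IsFrame τ₁ τ₂ τ₃) : IsFrame τ₂ τ₁ τ₃ :=
  ⟨h.invol₂, h.invol₁, h.invol₃, h.comm₁₂.symm, h.comm₂₃, h.comm₁₃, fun z h1 h2 h3 =>
    h.fixed z h2 h1 h3⟩

lemma swap₂₃ (h : IsFrame τ₁ τ₂ τ₃) : IsFrame τ₁ τ₃ τ₂ :=
  ⟨h.invol₁, h.invol₃, h.invol₂, h.comm₁₃, h.comm₁₂, h.comm₂₃.symm, fun z h1 h2 h3 =>
    h.fixed z h1 h3 h2⟩

lemma mul_left (h : IsFrame τ₁ τ₂ τ₃) : IsFrame (τ₁ * τ₂) τ₂ τ₃ where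
  invol₁ := by rw [mul_assoc, ← mul_assoc τ₂, ← h.comm₁₂, mul_assoc τ₁, h.invol₂, mul_one, h.invol₁]
  invol₂ := h.invol₂
  invol₃ := h.invol₃
  comm₁₂ := by rw [← mul_assoc, ← h.comm₁₂]
  comm₁₃ := by rw [mul_assoc, h.comm₂₃, ← mul_assoc, h.comm₁₃, mul_assoc]
  comm₂₃ := h.comm₂₃
  fixed z h1 h2 h3 := h.fixed z (by rwa [AlgEquiv.mul_apply, h2] at h1) h2 h3

lemma apply₁₁ (h : IsFrame τ₁ τ₂ τ₃) (z : K) : τ₁ (τ₁ z) = z := DFunLike.congr_fun h.invol₁ z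

lemma apply₁₂ (h : IsFrame τ₁ τ₂ τ₃) (z : K) : τ₁ (τ₂ z) = τ₂ (τ₁ z) :=
  DFunLike.congr_fun h.comm₁₂ z

/-- The relative norm of `z` to the fixed field of `τ₁` and `τ₂`. -/
def relNorm (τ₁ τ₂ : K ≃ₐ[ℚ] K) (z : K) : K := z * τ₁ z * (τ₂ z * τ₁ (τ₂ z))

lemma relNorm_isIntUnit {z : K} (hz : IsIntUnit z) (τ₁ τ₂ : K ≃ₐ[ℚ] K) :
    IsIntUnit (relNorm τ₁ τ₂ z) :=
  (hz.mul (hz.map _)).mul ((hz.map _).mul ((hz.map _).map _))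

lemma apply_relNorm_left (h : IsFrame τ₁ τ₂ τ₃) (z : K) :
    τ₁ (relNorm τ₁ τ₂ z) = relNorm τ₁ τ₂ z := by
  simp only [relNorm, map_mul, h.apply₁₁]
  ring

lemma apply_relNorm_right (h : IsFrame τ₁ τ₂ τ₃) (z : K) :
    τ₂ (relNorm τ₁ τ₂ z) = relNorm τ₁ τ₂ z := by
  simp only [relNorm, map_mul, h.apply₁₂, h.swap₁₂.apply₁₁]
  ring

end Field

section Real

variable {K : IntermediateField ℚ ℝ} {τ₁ τ₂ τ₃ : K ≃ₐ[ℚ] K}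

lemma isSignedQuadUnit_relNorm (h : IsFrame τ₁ τ₂ τ₃) {d : ℕ} (hd : Squarefree d) {r : K}
    (hr : (r : ℝ) = √(d : ℝ)) (h1 : τ₁ r = r) (h2 : τ₂ r = r) (h3 : τ₃ r = -r) {z : K}
    (hz : IsIntUnit z) : IsSignedQuadUnit d (relNorm τ₁ τ₂ z : K) := by
  have hη := relNorm_isIntUnit hz τ₁ τ₂
  have e1 := h.apply_relNorm_left z
  have e2 := h.apply_relNorm_right z
  generalize relNorm τ₁ τ₂ z = η at hη e1 e2
  have hd0 : (d : ℝ) ≠ 0 := by exact_mod_cast hd.ne_zero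
  have hr2 : r ^ 2 = (d : K) := Subtype.ext (by simp [hr])
  have hr0 : r ≠ 0 := by
    rintro rfl
    exact hd0 (by simpa using (congrArg (Subtype.val) hr2).symm)
  have f1 : τ₁ (τ₃ η) = τ₃ η := by rw [h.swap₂₃.apply₁₂, e1]
  have f2 : τ₂ (τ₃ η) = τ₃ η := by rw [h.swap₁₂.swap₂₃.apply₁₂, e2]
  have f3 : τ₃ (τ₃ η) = η := h.swap₂₃.swap₁₂.apply₁₁ η
  obtain ⟨x, hx⟩ := h.fixed (η + τ₃ η) (by simp [e1, f1]) (by simp [e2, f2])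
    (by simp [f3, add_comm])
  obtain ⟨y, hy⟩ := h.fixed ((η - τ₃ η) / r) (by simp [e1, f1, h1]) (by simp [e2, f2, h2])
    (by rw [map_div₀, map_sub, f3, h3, div_neg, ← neg_div, neg_sub])
  obtain ⟨n, hn⟩ := h.fixed (η * τ₃ η) (by simp [e1, f1]) (by simp [e2, f2])
    (by simp [f3, mul_comm])
  have hn1 : n = 1 ∨ n = -1 := IsIntUnit.eq_one_or_neg_one (K := K) (hn ▸ hη.mul (hη.map _))
  have hxint : IsIntegral ℤ x := by
    refine (isIntegral_algHom_iff (algebraMap ℚ K).toIntAlgHom (algebraMap ℚ K).injective).1 ?_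
    change IsIntegral ℤ (algebraMap ℚ K x)
    rw [hx]
    exact hη.isIntegral.add (hη.map τ₃).isIntegral
  obtain ⟨X, hX⟩ := IsIntegrallyClosed.isIntegral_iff.1 hxint
  have hX' : x = X := by simpa using hX.symm
  rw [eq_div_iff hr0] at hy
  have hrel : (d : ℚ) * y ^ 2 = x ^ 2 - 4 * n := by
    apply (algebraMap ℚ K).injective
    simp only [map_mul, map_sub, map_pow, map_natCast, map_ofNat, hx, hn, ← hr2]
    linear_combination (algebraMap ℚ K y * r + (η - τ₃ η)) * hy
  obtain ⟨Y, hY⟩ := hd.exists_int_of_mul_sq_eq (y := y) (n := X ^ 2 - 4 * n.num) (by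
    rw [hrel, hX']
    rcases hn1 with rfl | rfl <;> simp)
  refine ⟨X, Y, ?_, ?_⟩
  · rcases hn1 with rfl | rfl
    · left
      have : ((X : ℚ) ^ 2 - d * Y ^ 2) = 4 := by rw [← hX', ← hY, hrel]; ring
      exact_mod_cast this
    · right
      have : ((X : ℚ) ^ 2 - d * Y ^ 2) = -4 := by rw [← hX', ← hY, hrel]; ring
      exact_mod_cast this
  · have : 2 * η = algebraMap ℚ K x + algebraMap ℚ K y * r := by rw [hx, hy]; ring
    rw [two_mul] at this ⊢
    have h' := congrArg (Subtype.val) this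
    simpa [hX', hY, hr] using h'

lemma kummer (h : IsFrame τ₁ τ₂ τ₃) {d₁ d₂ d₃ : ℕ} {r₁ r₂ r₃ : K}
    (hr₁ : r₁ ^ 2 = d₁) (hr₂ : r₂ ^ 2 = d₂) (hr₃ : r₃ ^ 2 = d₃)
    (h₁ : τ₁ r₁ = -r₁ ∧ τ₁ r₂ = r₂ ∧ τ₁ r₃ = r₃) (h₂ : τ₂ r₁ = r₁ ∧ τ₂ r₂ = -r₂ ∧ τ₂ r₃ = r₃)
    (h₃ : τ₃ r₁ = r₁ ∧ τ₃ r₂ = r₂ ∧ τ₃ r₃ = -r₃) {w : K} {t : ℚ} (hw : w ^ 2 = algebraMap ℚ K t) :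
    ∃ e₁ e₂ e₃ : ℕ, (e₁ ≤ 1 ∧ e₂ ≤ 1 ∧ e₃ ≤ 1) ∧ ∃ ρ : ℚ,
      w * (r₁ ^ e₁ * r₂ ^ e₂ * r₃ ^ e₃) = algebraMap ℚ K ρ ∧
      ρ ^ 2 = t * (d₁ ^ e₁ * d₂ ^ e₂ * d₃ ^ e₃) := by
  have hsign : ∀ τ : K ≃ₐ[ℚ] K, ∃ e : ℕ, e ≤ 1 ∧ τ w = (-1) ^ e * w := by
    intro τ
    have : τ w = w ∨ τ w = -w := by
      rw [← sq_eq_sq_iff_eq_or_eq_neg, ← map_pow, hw, AlgEquiv.commutes]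
    rcases this with h | h
    · exact ⟨0, by simp, by simp [h]⟩
    · exact ⟨1, by simp, by simp [h]⟩
  obtain ⟨e₁, l₁, g₁⟩ := hsign τ₁
  obtain ⟨e₂, l₂, g₂⟩ := hsign τ₂
  obtain ⟨e₃, l₃, g₃⟩ := hsign τ₃
  have hone : ∀ e : ℕ, ((-1 : K) ^ e) * (-1) ^ e = 1 := fun e => by rw [← mul_pow]; simp
  obtain ⟨ρ, hρ⟩ := h.fixed (w * (r₁ ^ e₁ * r₂ ^ e₂ * r₃ ^ e₃))
    (by
      simp only [map_mul, map_pow, g₁, h₁]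
      rw [neg_pow r₁]
      linear_combination (w * (r₁ ^ e₁ * r₂ ^ e₂ * r₃ ^ e₃)) * hone e₁)
    (by
      simp only [map_mul, map_pow, g₂, h₂]
      rw [neg_pow r₂]
      linear_combination (w * (r₁ ^ e₁ * r₂ ^ e₂ * r₃ ^ e₃)) * hone e₂)
    (by
      simp only [map_mul, map_pow, g₃, h₃]
      rw [neg_pow r₃]
      linear_combination (w * (r₁ ^ e₁ * r₂ ^ e₂ * r₃ ^ e₃)) * hone e₃)
  refine ⟨e₁, e₂, e₃, ⟨l₁, l₂, l₃⟩, ρ, hρ.symm, ?_⟩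
  apply (algebraMap ℚ K).injective
  simp only [map_mul, map_pow, map_natCast, hρ, ← hw, ← hr₁, ← hr₂, ← hr₃]
  ring

end Real

end IsFrame

lemma padicValRat_prime_zpow_of_ne {r p : ℕ} (hr : r.Prime) (hp : p.Prime) (h : r ≠ p) (n : ℤ) :
    padicValRat r ((p : ℚ) ^ n) = 0 := by
  have := Fact.mk hr
  have := Fact.mk hp
  rw [padicValRat.zpow, padicValRat.of_nat, padicValNat_primes h]
  simp

lemma padicValRat_prime_zpow_self {p : ℕ} (hp : p.Prime) (n : ℤ) :
    padicValRat p ((p : ℚ) ^ n) = n := by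
  have := Fact.mk hp
  rw [padicValRat.zpow, padicValRat.self hp.one_lt]
  simp

lemma even_of_sq_eq_zpow_mul {ρ t : ℚ} {p : ℕ} (hp : p.Prime) {n : ℤ} (ht : t ≠ 0)
    (hv : padicValRat p t = 0) (h : ρ ^ 2 = (p : ℚ) ^ n * t) : Even n := by
  have := Fact.mk hp
  have hp0 : (p : ℚ) ≠ 0 := by exact_mod_cast hp.ne_zero
  have h0 : ρ ≠ 0 := by
    rintro rfl
    exact mul_ne_zero (zpow_ne_zero n hp0) ht (by rw [← h]; simp)
  have h1 := congrArg (padicValRat p) h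
  rw [padicValRat.mul (zpow_ne_zero n hp0) ht, padicValRat_prime_zpow_self hp, hv,
    padicValRat.pow] at h1
  exact ⟨padicValRat p ρ, by push_cast at h1; linarith⟩

lemma even_of_sq_eq_zpow {p₁ p₂ p₃ p₄ : ℕ} (h₁ : p₁.Prime) (h₂ : p₂.Prime) (h₃ : p₃.Prime)
    (h₄ : p₄.Prime) (h₁₂ : p₁ ≠ p₂) (h₁₃ : p₁ ≠ p₃) (h₁₄ : p₁ ≠ p₄) {ρ : ℚ} {i j k l : ℤ}
    (h : ρ ^ 2 = (p₁ : ℚ) ^ i * ((p₂ : ℚ) ^ j * (p₃ : ℚ) ^ k * (p₄ : ℚ) ^ l)) : Even i := by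
  have := Fact.mk h₁
  have n₂ : (p₂ : ℚ) ^ j ≠ 0 := zpow_ne_zero _ (by exact_mod_cast h₂.ne_zero)
  have n₃ : (p₃ : ℚ) ^ k ≠ 0 := zpow_ne_zero _ (by exact_mod_cast h₃.ne_zero)
  have n₄ : (p₄ : ℚ) ^ l ≠ 0 := zpow_ne_zero _ (by exact_mod_cast h₄.ne_zero)
  refine even_of_sq_eq_zpow_mul h₁ (mul_ne_zero (mul_ne_zero n₂ n₃) n₄) ?_ h
  rw [padicValRat.mul (mul_ne_zero n₂ n₃) n₄, padicValRat.mul n₂ n₃,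
    padicValRat_prime_zpow_of_ne h₁ h₂ h₁₂, padicValRat_prime_zpow_of_ne h₁ h₃ h₁₃,
    padicValRat_prime_zpow_of_ne h₁ h₄ h₁₄]
  simp

section

variable {K : IntermediateField ℚ ℝ}

lemma even_of_sq_eq_zpow_mul_of_map_eq {E w : K} (τ : K ≃ₐ[ℚ] K) (hE : 0 < (E : ℝ))
    (hτ : τ E = -E⁻¹) {x : ℤ} {t : ℚ} (ht : 0 < t) (hw : w ^ 2 = E ^ x * algebraMap ℚ K t) :
    Even x := by
  by_contra hx
  have hx' : Odd x := Int.not_even_iff_odd.1 hx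
  have h := congrArg τ hw
  rw [map_mul, map_pow, map_zpow₀, hτ, AlgEquiv.commutes, hx'.neg_zpow] at h
  have h' := congrArg (algebraMap K ℝ) h
  simp only [map_mul, map_pow, map_neg, map_zpow₀, map_inv₀, ← IsScalarTower.algebraMap_apply] at h'
  have h1 : (0 : ℝ) < ((algebraMap K ℝ E)⁻¹) ^ x := zpow_pos (inv_pos.2 hE) _
  have h2 : (0 : ℝ) < algebraMap ℚ ℝ t := by simpa using ht
  nlinarith [sq_nonneg (algebraMap K ℝ (τ w)), mul_pos h1 h2]

lemma sq_eq_of_sq_sq_eq {v P : K} (hP : 0 < (P : ℝ)) (h : (v ^ 2) ^ 2 = P ^ 2) : v ^ 2 = P := by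
  rcases sq_eq_sq_iff_eq_or_eq_neg.1 h with h | h
  · exact h
  · have h' := congrArg (algebraMap K ℝ) h
    simp only [map_pow, map_neg] at h'
    have : 0 < algebraMap K ℝ P := hP
    nlinarith [sq_nonneg (algebraMap K ℝ v)]

lemma IsFrame.exists_relNorm_sq_eq {τ₁ τ₂ τ₃ : K ≃ₐ[ℚ] K} (h : IsFrame τ₁ τ₂ τ₃) {d : ℕ}
    (hd : Squarefree d) (hd2 : 2 ≤ d) {r E : K}
    (hr : (r : ℝ) = √(d : ℝ)) (h1 : τ₁ r = r) (h2 : τ₂ r = r) (h3 : τ₃ r = -r)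
    (hE : IsFundamentalUnit d (E : ℝ)) {z : K}
    (hz : IsIntUnit z) : ∃ x : ℤ, relNorm τ₁ τ₂ z ^ 2 = (E ^ x) ^ 2 := by
  obtain ⟨x, hx⟩ := hE.exists_zpow hd2 (h.isSignedQuadUnit_relNorm hd hr h1 h2 h3 hz)
  refine ⟨x, sq_eq_sq_iff_eq_or_eq_neg.2 (hx.imp (fun h => Subtype.ext ?_)
    fun h => Subtype.ext ?_)⟩
  · rw [h]
    exact (map_zpow₀ (algebraMap K ℝ) E x).symm
  · rw [h]
    exact congrArg Neg.neg (map_zpow₀ (algebraMap K ℝ) E x).symm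

lemma IsFrame.sq_norm_eq_one {τ₁ τ₂ τ₃ : K ≃ₐ[ℚ] K} (h : IsFrame τ₁ τ₂ τ₃) {z : K}
    (hz : IsIntUnit z) : (relNorm τ₁ τ₂ z * τ₃ (relNorm τ₁ τ₂ z)) ^ 2 = 1 := by
  have hη := relNorm_isIntUnit hz τ₁ τ₂
  obtain ⟨n, hn⟩ := h.fixed (relNorm τ₁ τ₂ z * τ₃ (relNorm τ₁ τ₂ z))
    (by rw [map_mul, h.swap₂₃.apply₁₂, h.apply_relNorm_left])
    (by rw [map_mul, h.swap₁₂.swap₂₃.apply₁₂, h.apply_relNorm_right])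
    (by rw [map_mul, h.swap₂₃.swap₁₂.apply₁₁, mul_comm])
  rw [← hn, ← map_pow]
  rcases IsIntUnit.eq_one_or_neg_one (K := K) (hn ▸ hη.mul (hη.map τ₃)) with rfl | rfl <;> simp

end

/-- The field `K = ℚ(√2, √(pq), √(ps))` with generators of its Galois group, and with the seven
fundamental units of its quadratic subfields written as rational multiples of squares. -/
structure QuadUnitData (K : IntermediateField ℚ ℝ) (p q s : ℕ) where
  (a b c : K)
  (σ₁ σ₂ σ₃ : K ≃ₐ[ℚ] K)
  (E2 Epq E2pq Eps E2ps Eqs E2qs : K)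
  (zpq z2pq zps z2ps zqs z2qs : K)
  frame : IsFrame σ₁ σ₂ σ₃
  a_coe : (a : ℝ) = √((2 : ℕ) : ℝ)
  b_coe : (b : ℝ) = √((p * q : ℕ) : ℝ)
  c_coe : (c : ℝ) = √((p * s : ℕ) : ℝ)
  map₁ : σ₁ a = -a ∧ σ₁ b = b ∧ σ₁ c = c
  map₂ : σ₂ a = a ∧ σ₂ b = -b ∧ σ₂ c = c
  map₃ : σ₃ a = a ∧ σ₃ b = b ∧ σ₃ c = -c
  prime_p : p.Prime
  prime_q : q.Prime
  prime_s : s.Prime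
  p_ne_q : p ≠ q
  p_ne_s : p ≠ s
  q_ne_s : q ≠ s
  p_ne_two : p ≠ 2
  q_ne_two : q ≠ 2
  s_ne_two : s ≠ 2
  hE2 : IsFundamentalUnit 2 (E2 : ℝ)
  hEpq : IsFundamentalUnit (p * q) (Epq : ℝ)
  hE2pq : IsFundamentalUnit (2 * p * q) (E2pq : ℝ)
  hEps : IsFundamentalUnit (p * s) (Eps : ℝ)
  hE2ps : IsFundamentalUnit (2 * p * s) (E2ps : ℝ)
  hEqs : IsFundamentalUnit (q * s) (Eqs : ℝ)
  hE2qs : IsFundamentalUnit (2 * q * s) (E2qs : ℝ)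
  map_E2 : σ₁ E2 = -E2⁻¹
  Epq_eq : Epq = 2 * p * zpq ^ 2
  E2pq_eq : E2pq = p * z2pq ^ 2
  Eps_eq : Eps = 2 * p * zps ^ 2
  E2ps_eq : E2ps = p * z2ps ^ 2
  Eqs_eq : Eqs = q * zqs ^ 2
  E2qs_eq : E2qs = q * z2qs ^ 2
  map_zpq : ∀ τ : K ≃ₐ[ℚ] K, τ b = b → τ zpq = zpq
  map_zps : ∀ τ : K ≃ₐ[ℚ] K, τ c = c → τ zps = zps
  map_z2ps : ∀ τ : K ≃ₐ[ℚ] K, τ (a * c) = a * c → τ z2ps = z2ps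
  map_zqs : ∀ τ : K ≃ₐ[ℚ] K, τ (b * c) = b * c → τ zqs = zqs
  map_z2qs : ∀ τ : K ≃ₐ[ℚ] K, τ (a * (b * c)) = a * (b * c) → τ z2qs = z2qs

namespace QuadUnitData

variable {K : IntermediateField ℚ ℝ} {p q s : ℕ} (D : QuadUnitData K p q s)

lemma even_of_sq_eq {w : K} {i j k : ℤ}
    (hw : w ^ 2 = algebraMap ℚ K ((2 : ℚ) ^ i * (p : ℚ) ^ j * (q : ℚ) ^ k)) :
    Even (j + k) ∧ ∀ τ : K ≃ₐ[ℚ] K, τ D.a = -D.a → τ D.b = D.b → τ w = w → Even i := by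
  have ha2 : D.a ^ 2 = ((2 : ℕ) : K) := Subtype.ext (by
    rw [SubmonoidClass.coe_pow, D.a_coe, Real.sq_sqrt (Nat.cast_nonneg _)]; rfl)
  have hb2 : D.b ^ 2 = ((p * q : ℕ) : K) := Subtype.ext (by
    rw [SubmonoidClass.coe_pow, D.b_coe, Real.sq_sqrt (Nat.cast_nonneg _)]; simp)
  have hc2 : D.c ^ 2 = ((p * s : ℕ) : K) := Subtype.ext (by
    rw [SubmonoidClass.coe_pow, D.c_coe, Real.sq_sqrt (Nat.cast_nonneg _)]; simp)
  obtain ⟨e₁, e₂, e₃, ⟨l₁, l₂, l₃⟩, ρ, hρ, hρ2⟩ :=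
    D.frame.kummer ha2 hb2 hc2 D.map₁ D.map₂ D.map₃ hw
  have n2 : (2 : ℚ) ≠ 0 := two_ne_zero
  have np : (p : ℚ) ≠ 0 := by exact_mod_cast D.prime_p.ne_zero
  have nq : (q : ℚ) ≠ 0 := by exact_mod_cast D.prime_q.ne_zero
  have ns : (s : ℚ) ≠ 0 := by exact_mod_cast D.prime_s.ne_zero
  have hmain : ρ ^ 2 = ((2 : ℕ) : ℚ) ^ (i + e₁) * (p : ℚ) ^ (j + e₂ + e₃) * (q : ℚ) ^ (k + e₂) *
      (s : ℚ) ^ (e₃ : ℤ) := by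
    rw [hρ2, Nat.cast_ofNat, zpow_add₀ n2, zpow_add₀ np, zpow_add₀ np, zpow_add₀ nq]
    simp only [zpow_natCast, Nat.cast_mul, mul_pow]
    ring
  have h2 : Even (i + e₁) := even_of_sq_eq_zpow Nat.prime_two D.prime_p D.prime_q D.prime_s
    D.p_ne_two.symm D.q_ne_two.symm D.s_ne_two.symm (by rw [hmain]; ring)
  have hp : Even (j + e₂ + e₃) := even_of_sq_eq_zpow D.prime_p Nat.prime_two D.prime_q D.prime_s
    D.p_ne_two D.p_ne_q D.p_ne_s (by rw [hmain]; ring)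
  have hq : Even (k + e₂) := even_of_sq_eq_zpow D.prime_q Nat.prime_two D.prime_p D.prime_s
    D.q_ne_two D.p_ne_q.symm D.q_ne_s (by rw [hmain]; ring)
  have hs : Even (e₃ : ℤ) := even_of_sq_eq_zpow D.prime_s Nat.prime_two D.prime_p D.prime_q
    D.s_ne_two D.p_ne_s.symm D.q_ne_s.symm (by rw [hmain]; ring)
  obtain rfl : e₃ = 0 := by
    obtain ⟨m, hm⟩ := hs
    lia
  refine ⟨by grind, fun τ hτa hτb hτw => ?_⟩
  rcases Nat.le_one_iff_eq_zero_or_eq_one.1 l₁ with rfl | rfl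
  · simpa using h2
  exfalso
  have h' := congrArg τ hρ
  simp only [map_mul, map_pow, hτa, hτb, hτw, pow_one, pow_zero, mul_one, AlgEquiv.commutes]
    at h' hρ
  have h0 : algebraMap ℚ K ρ = 0 := by
    have : algebraMap ℚ K ρ + algebraMap ℚ K ρ = 0 := by linear_combination -hρ - h'
    exact self_eq_neg.1 (eq_neg_of_add_eq_zero_left this)
  have hρ0 : ρ = 0 := by simpa using h0
  rw [hρ0] at hmain
  have : (0 : ℚ) < ((2 : ℕ) : ℚ) ^ (i + (1 : ℕ)) * (p : ℚ) ^ (j + e₂ + (0 : ℕ)) *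
      (q : ℚ) ^ (k + e₂) * (s : ℚ) ^ ((0 : ℕ) : ℤ) := by
    have := D.prime_p.pos
    have := D.prime_q.pos
    have := D.prime_s.pos
    positivity
  rw [← hmain] at this
  simp at this

end QuadUnitData

lemma sqrt_mul_mul_sqrt_mul (p q s : ℕ) :
    √((p * q : ℕ) : ℝ) * √((p * s : ℕ) : ℝ) = p * √((q * s : ℕ) : ℝ) := by
  rw [← Real.sqrt_mul (Nat.cast_nonneg _), ← Real.sqrt_sq (Nat.cast_nonneg p),
    ← Real.sqrt_mul (sq_nonneg _)]
  congr 1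
  push_cast
  ring

lemma sqrt_two_mul_mul (q s : ℕ) :
    √((2 * q * s : ℕ) : ℝ) = √((2 : ℕ) : ℝ) * √((q * s : ℕ) : ℝ) := by
  rw [← Real.sqrt_mul (Nat.cast_nonneg _), mul_assoc, Nat.cast_mul]

lemma coe_mul_div_eq_sqrt {K : IntermediateField ℚ ℝ} {b c : K} {p q s : ℕ} (hp : p ≠ 0)
    (hb : (b : ℝ) = √((p * q : ℕ) : ℝ)) (hc : (c : ℝ) = √((p * s : ℕ) : ℝ)) :
    ((b * c / p : K) : ℝ) = √((q * s : ℕ) : ℝ) := by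
  have np : (p : ℝ) ≠ 0 := by exact_mod_cast hp
  change algebraMap K ℝ (b * c / p) = _
  rw [map_div₀, map_mul, map_natCast, div_eq_iff np, mul_comm _ (p : ℝ),
    ← sqrt_mul_mul_sqrt_mul, ← hb, ← hc]
  rfl

namespace QuadUnitData

variable {K : IntermediateField ℚ ℝ} {p q s : ℕ} (D : QuadUnitData K p q s)

/-- The product of the fundamental units with exponents `x₁, …, x₆`, omitting `ε₂`. -/
def unitProd (x : Fin 6 → ℤ) : K :=
  D.Epq ^ x 0 * D.E2pq ^ x 1 * D.Eps ^ x 2 * D.E2ps ^ x 3 * D.Eqs ^ x 4 * D.E2qs ^ x 5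

/-- The product of the square roots of the normalised fundamental units. -/
def rootProd (x : Fin 6 → ℤ) : K :=
  D.zpq ^ x 0 * D.z2pq ^ x 1 * D.zps ^ x 2 * D.z2ps ^ x 3 * D.zqs ^ x 4 * D.z2qs ^ x 5

lemma E2_pos : 0 < (D.E2 : ℝ) := one_pos.trans (D.hE2.1.one_lt le_rfl)

lemma Epq_pos : 0 < (D.Epq : ℝ) :=
  one_pos.trans (D.hEpq.1.one_lt (by nlinarith [D.prime_p.two_le, D.prime_q.two_le]))

lemma E2pq_pos : 0 < (D.E2pq : ℝ) :=
  one_pos.trans (D.hE2pq.1.one_lt (by nlinarith [D.prime_p.two_le, D.prime_q.two_le]))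

lemma Eps_pos : 0 < (D.Eps : ℝ) :=
  one_pos.trans (D.hEps.1.one_lt (by nlinarith [D.prime_p.two_le, D.prime_s.two_le]))

lemma E2ps_pos : 0 < (D.E2ps : ℝ) :=
  one_pos.trans (D.hE2ps.1.one_lt (by nlinarith [D.prime_p.two_le, D.prime_s.two_le]))

lemma Eqs_pos : 0 < (D.Eqs : ℝ) :=
  one_pos.trans (D.hEqs.1.one_lt (by nlinarith [D.prime_q.two_le, D.prime_s.two_le]))

lemma E2qs_pos : 0 < (D.E2qs : ℝ) :=
  one_pos.trans (D.hE2qs.1.one_lt (by nlinarith [D.prime_q.two_le, D.prime_s.two_le]))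

lemma E2_mul_unitProd_pos (n : ℤ) (x : Fin 6 → ℤ) :
    0 < ((D.E2 ^ n * D.unitProd x : K) : ℝ) := by
  change 0 < algebraMap K ℝ (D.E2 ^ n * D.unitProd x)
  simp only [unitProd, map_mul, map_zpow₀]
  have h0 : 0 < algebraMap K ℝ D.E2 := D.E2_pos
  have h1 : 0 < algebraMap K ℝ D.Epq := D.Epq_pos
  have h2 : 0 < algebraMap K ℝ D.E2pq := D.E2pq_pos
  have h3 : 0 < algebraMap K ℝ D.Eps := D.Eps_pos
  have h4 : 0 < algebraMap K ℝ D.E2ps := D.E2ps_pos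
  have h5 : 0 < algebraMap K ℝ D.Eqs := D.Eqs_pos
  have h6 : 0 < algebraMap K ℝ D.E2qs := D.E2qs_pos
  positivity

lemma E2_mul_unitProd_sq (n : ℤ) (x : Fin 6 → ℤ) :
    (D.E2 ^ n * D.unitProd x) ^ 2 = D.E2 ^ (n + n) * D.unitProd (x + x) := by
  have h : ∀ (z : K) (m : ℤ), z ^ (m + m) = (z ^ m) ^ 2 := fun z m => by
    rw [← mul_two, zpow_mul]
    rfl
  simp only [unitProd, Pi.add_apply, h]
  ring

lemma rootProd_ne_zero (x : Fin 6 → ℤ) : D.rootProd x ≠ 0 := by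
  have key : ∀ (E z t : K), 0 < (E : ℝ) → E = t * z ^ 2 → z ≠ 0 := by
    rintro E z t hE h rfl
    rw [h] at hE
    simp at hE
  have h1 := key _ _ _ D.Epq_pos D.Epq_eq
  have h2 := key _ _ _ D.E2pq_pos D.E2pq_eq
  have h3 := key _ _ _ D.Eps_pos D.Eps_eq
  have h4 := key _ _ _ D.E2ps_pos D.E2ps_eq
  have h5 := key _ _ _ D.Eqs_pos D.Eqs_eq
  have h6 := key _ _ _ D.E2qs_pos D.E2qs_eq
  simp [rootProd, zpow_ne_zero, h1, h2, h3, h4, h5, h6]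

lemma unitProd_eq (x : Fin 6 → ℤ) : D.unitProd x =
    algebraMap ℚ K ((2 : ℚ) ^ (x 0 + x 2) * (p : ℚ) ^ (x 0 + x 1 + x 2 + x 3) *
      (q : ℚ) ^ (x 4 + x 5)) * D.rootProd x ^ 2 := by
  have n2 : (2 : K) ≠ 0 := two_ne_zero
  have np : (p : K) ≠ 0 := by exact_mod_cast D.prime_p.ne_zero
  have nq : (q : K) ≠ 0 := by exact_mod_cast D.prime_q.ne_zero
  simp only [map_mul, map_zpow₀, map_ofNat, map_natCast, zpow_add₀ n2, zpow_add₀ np,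
    zpow_add₀ nq, unitProd, rootProd]
  rw [D.Epq_eq, D.E2pq_eq, D.Eps_eq, D.E2ps_eq, D.Eqs_eq, D.E2qs_eq]
  have hsq : ∀ (z : K) (n : ℤ), (z ^ 2) ^ n = (z ^ n) ^ 2 := fun z n => by
    rw [← zpow_natCast, ← zpow_mul, mul_comm, zpow_mul, zpow_natCast]
  simp only [mul_zpow, hsq]
  ring

lemma even_of_sq_eq_unitProd {v : K} {n : ℤ} {x : Fin 6 → ℤ}
    (hv : v ^ 2 = D.E2 ^ n * D.unitProd x) :
    Even n ∧ Even (x 0 + x 1 + x 2 + x 3 + x 4 + x 5) ∧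
      (n = 0 → ∀ τ : K ≃ₐ[ℚ] K, τ D.a = -D.a → τ D.b = D.b → τ v = v →
        τ (D.rootProd x) = D.rootProd x → Even (x 0 + x 2)) := by
  have hz := D.rootProd_ne_zero x
  have hE : D.E2 ≠ 0 := fun h => D.E2_pos.ne' (by simp [h])
  have hw : (v / D.rootProd x) ^ 2 = D.E2 ^ n * algebraMap ℚ K ((2 : ℚ) ^ (x 0 + x 2) *
      (p : ℚ) ^ (x 0 + x 1 + x 2 + x 3) * (q : ℚ) ^ (x 4 + x 5)) := by
    rw [div_pow, hv, unitProd_eq, div_eq_iff (pow_ne_zero 2 hz)]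
    ring
  have hpos : (0 : ℚ) < (2 : ℚ) ^ (x 0 + x 2) * (p : ℚ) ^ (x 0 + x 1 + x 2 + x 3) *
      (q : ℚ) ^ (x 4 + x 5) := by
    have := D.prime_p.pos
    have := D.prime_q.pos
    positivity
  have hn : Even n := even_of_sq_eq_zpow_mul_of_map_eq D.σ₁ D.E2_pos D.map_E2 hpos hw
  obtain ⟨m, rfl⟩ := hn
  have hw' : (v / D.rootProd x / D.E2 ^ m) ^ 2 = algebraMap ℚ K ((2 : ℚ) ^ (x 0 + x 2) *
      (p : ℚ) ^ (x 0 + x 1 + x 2 + x 3) * (q : ℚ) ^ (x 4 + x 5)) := by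
    rw [div_pow, hw, div_eq_iff (pow_ne_zero 2 (zpow_ne_zero m hE)), zpow_add₀ hE]
    ring
  obtain ⟨h1, h2⟩ := D.even_of_sq_eq hw'
  refine ⟨⟨m, rfl⟩, by simpa [add_assoc] using h1, fun hm τ hτa hτb hτv hτz => ?_⟩
  obtain rfl : m = 0 := by lia
  exact h2 τ hτa hτb (by simp [hτv, hτz])

lemma exists_exponents {z : K} (hz : IsIntUnit z) : ∃ (n : ℤ) (x : Fin 6 → ℤ),
    IsFrame.relNorm D.σ₂ D.σ₃ z ^ 2 = (D.E2 ^ n) ^ 2 ∧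
    IsFrame.relNorm D.σ₁ D.σ₃ z ^ 2 = (D.Epq ^ x 0) ^ 2 ∧
    IsFrame.relNorm (D.σ₁ * D.σ₂) D.σ₃ z ^ 2 = (D.E2pq ^ x 1) ^ 2 ∧
    IsFrame.relNorm D.σ₁ D.σ₂ z ^ 2 = (D.Eps ^ x 2) ^ 2 ∧
    IsFrame.relNorm (D.σ₁ * D.σ₃) D.σ₂ z ^ 2 = (D.E2ps ^ x 3) ^ 2 ∧
    IsFrame.relNorm (D.σ₂ * D.σ₃) D.σ₁ z ^ 2 = (D.Eqs ^ x 4) ^ 2 ∧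
    IsFrame.relNorm (D.σ₂ * D.σ₃) (D.σ₁ * D.σ₂) z ^ 2 = (D.E2qs ^ x 5) ^ 2 := by
  have h := D.frame
  obtain ⟨a1, b1, c1⟩ := D.map₁
  obtain ⟨a2, b2, c2⟩ := D.map₂
  obtain ⟨a3, b3, c3⟩ := D.map₃
  have lp := D.prime_p.two_le
  have lq := D.prime_q.two_le
  have ls := D.prime_s.two_le
  obtain ⟨n, hn⟩ := h.swap₁₂.swap₂₃.exists_relNorm_sq_eq Nat.squarefree_two le_rfl
    D.a_coe a2 a3 a1 D.hE2 hz
  obtain ⟨x0, hx0⟩ := h.swap₂₃.exists_relNorm_sq_eq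
    (D.prime_p.squarefree_mul_of_ne D.prime_q D.p_ne_q) (by nlinarith)
    D.b_coe b1 b3 b2 D.hEpq hz
  obtain ⟨x2, hx2⟩ := h.exists_relNorm_sq_eq
    (D.prime_p.squarefree_mul_of_ne D.prime_s D.p_ne_s) (by nlinarith)
    D.c_coe c1 c2 c3 D.hEps hz
  obtain ⟨x1, hx1⟩ := h.mul_left.swap₂₃.exists_relNorm_sq_eq (r := D.a * D.b)
    (D.prime_p.squarefree_two_mul_mul D.prime_q D.p_ne_q D.p_ne_two D.q_ne_two) (by nlinarith)
    (by rw [MulMemClass.coe_mul, D.a_coe, D.b_coe, sqrt_two_mul_mul])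
    (by simp [a1, b1, a2, b2]) (by simp [a3, b3]) (by simp [a2, b2]) D.hE2pq hz
  obtain ⟨x3, hx3⟩ := h.swap₂₃.mul_left.swap₂₃.exists_relNorm_sq_eq (r := D.a * D.c)
    (D.prime_p.squarefree_two_mul_mul D.prime_s D.p_ne_s D.p_ne_two D.s_ne_two) (by nlinarith)
    (by rw [MulMemClass.coe_mul, D.a_coe, D.c_coe, sqrt_two_mul_mul])
    (by simp [a1, c1, a3, c3]) (by simp [a2, c2]) (by simp [a3, c3]) D.hE2ps hz
  obtain ⟨x4, hx4⟩ := h.swap₁₂.swap₂₃.mul_left.swap₂₃.exists_relNorm_sq_eq (r := D.b * D.c / p)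
    (D.prime_q.squarefree_mul_of_ne D.prime_s D.q_ne_s) (by nlinarith)
    (coe_mul_div_eq_sqrt D.prime_p.ne_zero D.b_coe D.c_coe)
    (by simp [b2, c2, b3, c3]) (by simp [b1, c1]) (by simp [b3, c3, neg_div]) D.hEqs hz
  obtain ⟨x5, hx5⟩ := h.mul_left.swap₁₂.swap₂₃.mul_left.swap₂₃.exists_relNorm_sq_eq
    (r := D.a * (D.b * D.c / p))
    (D.prime_q.squarefree_two_mul_mul D.prime_s D.q_ne_s D.q_ne_two D.s_ne_two) (by nlinarith)
    (by rw [MulMemClass.coe_mul, D.a_coe, sqrt_two_mul_mul,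
      coe_mul_div_eq_sqrt D.prime_p.ne_zero D.b_coe D.c_coe])
    (by simp [a2, b2, c2, a3, b3, c3]) (by simp [a1, b1, c1, a2, b2, c2, neg_div])
    (by simp [a3, b3, c3, neg_div]) D.hE2qs hz
  exact ⟨n, ![x0, x1, x2, x3, x4, x5], hn, hx0, hx1, hx2, hx3, hx4, hx5⟩

lemma exists_sq_eq {z : K} (hz : IsIntUnit z) : ∃ (n : ℤ) (x : Fin 6 → ℤ),
    z ^ 2 = D.E2 ^ (n + n) * D.unitProd x ∧ Even (x 0 + x 1 + x 2 + x 3 + x 4 + x 5) := by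
  obtain ⟨n, x, hn, h0, h1, h2, h3, h4, h5⟩ := D.exists_exponents hz
  have hN := D.frame.sq_norm_eq_one hz
  have i1 := D.frame.apply₁₁
  have i2 := D.frame.swap₁₂.apply₁₁
  have i3 := D.frame.swap₂₃.swap₁₂.apply₁₁
  have c12 := D.frame.apply₁₂
  have c13 := D.frame.swap₂₃.apply₁₂
  have c23 := D.frame.swap₁₂.swap₂₃.apply₁₂
  obtain ⟨a1, b1, e1⟩ := D.map₁
  obtain ⟨a3, b3, e3⟩ := D.map₃
  simp only [IsFrame.relNorm, AlgEquiv.mul_apply, map_mul, i2, c12, c13, c23]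
    at hn h0 h1 h2 h3 h4 h5 hN
  have hpq_ps_qs : (z * D.σ₁ z) ^ 2 = D.E2 ^ (0 : ℤ) * D.unitProd ![x 0, 0, x 2, 0, x 4, 0] := by
    refine sq_eq_of_sq_sq_eq (D.E2_mul_unitProd_pos _ _) ?_
    simp only [unitProd, Matrix.cons_val, mul_pow, zpow_zero, mul_one, one_mul, ← h0, ← h2,
      ← h4]
    linear_combination (-(z * D.σ₁ z) ^ 4) * hN
  have hpq_2ps_2qs : (z * D.σ₃ (D.σ₁ z)) ^ 2 =
      D.E2 ^ (0 : ℤ) * D.unitProd ![x 0, 0, 0, x 3, 0, x 5] := by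
    refine sq_eq_of_sq_sq_eq (D.E2_mul_unitProd_pos _ _) ?_
    simp only [unitProd, Matrix.cons_val, mul_pow, zpow_zero, mul_one, one_mul, ← h0, ← h3,
      ← h5]
    linear_combination (-(z * D.σ₃ (D.σ₁ z)) ^ 4) * hN
  have hps_2ps : (z * D.σ₂ z) ^ 2 = D.E2 ^ n * D.unitProd ![0, 0, x 2, x 3, 0, 0] := by
    refine sq_eq_of_sq_sq_eq (D.E2_mul_unitProd_pos _ _) ?_
    simp only [unitProd, Matrix.cons_val, mul_pow, zpow_zero, mul_one, one_mul, ← hn, ← h2,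
      ← h3]
    linear_combination (-(z * D.σ₂ z) ^ 4) * hN
  have hpq_2pq : (z * D.σ₃ z) ^ 2 = D.E2 ^ n * D.unitProd ![x 0, x 1, 0, 0, 0, 0] := by
    refine sq_eq_of_sq_sq_eq (D.E2_mul_unitProd_pos _ _) ?_
    simp only [unitProd, Matrix.cons_val, mul_pow, zpow_zero, mul_one, ← hn, ← h0,
      ← h1]
    linear_combination (-(z * D.σ₃ z) ^ 4) * hN
  have hqs_2qs : (z * D.σ₃ (D.σ₂ z)) ^ 2 = D.E2 ^ n * D.unitProd ![0, 0, 0, 0, x 4, x 5] := by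
    refine sq_eq_of_sq_sq_eq (D.E2_mul_unitProd_pos _ _) ?_
    simp only [unitProd, Matrix.cons_val, mul_pow, zpow_zero, mul_one, one_mul, ← hn, ← h4,
      ← h5]
    linear_combination (-(z * D.σ₃ (D.σ₂ z)) ^ 4) * hN
  have hall : (z ^ 2) ^ 2 = D.E2 ^ n * D.unitProd x := by
    refine sq_eq_of_sq_sq_eq (D.E2_mul_unitProd_pos _ _) ?_
    simp only [unitProd, mul_pow, ← hn, ← h0, ← h1, ← h2, ← h3, ← h4, ← h5]
    have hN' := congrArg (· ^ 3) hN
    simp only [one_pow] at hN'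
    linear_combination (-z ^ 8) * hN'
  obtain ⟨-, p1, p1'⟩ := D.even_of_sq_eq_unitProd hpq_ps_qs
  obtain ⟨-, p2, p2'⟩ := D.even_of_sq_eq_unitProd hpq_2ps_2qs
  obtain ⟨pn, p3, -⟩ := D.even_of_sq_eq_unitProd hps_2ps
  obtain ⟨-, p4, -⟩ := D.even_of_sq_eq_unitProd hpq_2pq
  obtain ⟨-, p5, -⟩ := D.even_of_sq_eq_unitProd hqs_2qs
  have p1'' := p1' rfl D.σ₁ a1 b1 (by rw [map_mul, i1, mul_comm]) (by
    simp [rootProd, D.map_zpq _ b1, D.map_zps _ e1, D.map_zqs D.σ₁ (by simp [b1, e1])])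
  have p2'' := p2' rfl (D.σ₃ * D.σ₁) (by simp [a1, a3]) (by simp [b1, b3])
    (by simp only [AlgEquiv.mul_apply, map_mul, c13, i1, i3, mul_comm]) (by
    have q1 := D.map_zpq (D.σ₃ * D.σ₁) (by simp [b1, b3])
    have q2 := D.map_z2ps (D.σ₃ * D.σ₁) (by simp [a1, a3, e1, e3])
    have q3 := D.map_z2qs (D.σ₃ * D.σ₁) (by simp [a1, a3, b1, b3, e1, e3])
    simp only [rootProd, map_mul, map_zpow₀, q1, q2, q3, Matrix.cons_val, zpow_zero, map_one])
  simp only [Matrix.cons_val] at p1 p2 p3 p4 p5 p1'' p2''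
  obtain ⟨m, rfl⟩ := pn
  have hx : ∀ i, ∃ y, x i = y + y := by
    intro i
    change Even (x i)
    fin_cases i <;> simp only <;> grind
  choose y hy using hx
  obtain rfl : x = y + y := funext hy
  rw [← E2_mul_unitProd_sq] at hall
  have hsq := sq_eq_of_sq_sq_eq (D.E2_mul_unitProd_pos _ _) hall
  obtain ⟨hm, hy', -⟩ := D.even_of_sq_eq_unitProd hsq
  obtain ⟨k, rfl⟩ := hm
  exact ⟨k, y, hsq, hy'⟩

end QuadUnitData

lemma not_isSquare_of_odd_exponent {p₁ p₂ p₃ p₄ n : ℕ} (h₁ : p₁.Prime) (h₂ : p₂.Prime)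
    (h₃ : p₃.Prime) (h₄ : p₄.Prime) (h₁₂ : p₁ ≠ p₂) (h₁₃ : p₁ ≠ p₃) (h₁₄ : p₁ ≠ p₄) (j k l : ℕ)
    (hn : n = p₁ * (p₂ ^ j * p₃ ^ k * p₄ ^ l)) : ¬ IsSquare n := by
  rintro ⟨m, hm⟩
  have h : Even (1 : ℤ) := even_of_sq_eq_zpow h₁ h₂ h₃ h₄ h₁₂ h₁₃ h₁₄ (ρ := m) (j := j) (k := k)
    (l := l) (by
      simp only [zpow_one, zpow_natCast]
      rw [sq]
      exact_mod_cast hm.symm.trans hn)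
  exact absurd h (by decide)

lemma IsFundamentalUnit.eq_one_add_sqrt_two {e : ℝ} (he : IsFundamentalUnit 2 e) :
    e = 1 + √((2 : ℕ) : ℝ) := by
  obtain ⟨⟨x, y, hx, hy, h, hxy⟩, hmin⟩ := he
  refine le_antisymm (hmin _ ⟨2, 2, by norm_num, by norm_num, by norm_num, by push_cast; ring⟩) ?_
  have hxe : Even x := by
    rcases Int.even_or_odd x with h' | ⟨m, rfl⟩
    · exact h'
    · exfalso
      push_cast at h
      ring_nf at h
      lia
  obtain ⟨m, rfl⟩ := hxe
  have hye : Even y := by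
    rcases Int.even_or_odd y with h' | ⟨k, rfl⟩
    · exact h'
    · exfalso
      push_cast at h
      ring_nf at h
      lia
  obtain ⟨k, rfl⟩ := hye
  have hm : (1 : ℝ) ≤ m := by exact_mod_cast (show 1 ≤ m by lia)
  have hk : (1 : ℝ) ≤ k := by exact_mod_cast (show 1 ≤ k by lia)
  push_cast at hxy ⊢
  nlinarith [Real.sqrt_nonneg 2]

lemma IsSignedQuadUnit.isIntegral {d : ℕ} {e : ℝ} (h : IsSignedQuadUnit d e) :
    IsIntegral ℤ e := by
  obtain ⟨x, y, h, he⟩ := h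
  have hd : √(d : ℝ) ^ 2 = d := Real.sq_sqrt (Nat.cast_nonneg d)
  have hmain : ∃ n : ℤ, e ^ 2 - x * e + n = 0 := by
    have key : (2 * e - x) ^ 2 = d * y ^ 2 := by
      rw [he]
      linear_combination (y : ℝ) ^ 2 * hd
    rcases h with h | h
    · have h' : (x : ℝ) ^ 2 - d * y ^ 2 = 4 := by exact_mod_cast h
      exact ⟨1, by push_cast; linarith⟩
    · have h' : (x : ℝ) ^ 2 - d * y ^ 2 = -4 := by exact_mod_cast h
      exact ⟨-1, by push_cast; linarith⟩
  obtain ⟨n, hn⟩ := hmain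
  refine ⟨Polynomial.X ^ 2 + (-Polynomial.C x * Polynomial.X + Polynomial.C n), ?_, ?_⟩
  · refine Polynomial.monic_X_pow_add ?_
    rw [← Polynomial.C_neg]
    exact (Polynomial.degree_linear_le).trans_lt (by norm_num)
  · simp only [Polynomial.eval₂_add, Polynomial.eval₂_mul, Polynomial.eval₂_neg, Polynomial.eval₂_C,
      Polynomial.eval₂_X, Polynomial.eval₂_pow, algebraMap_int_eq, Int.coe_castRingHom]
    linarith

section

variable {K : IntermediateField ℚ ℝ}

lemma IsSignedQuadUnit.isIntUnit {d : ℕ} {E : K} (h : IsSignedQuadUnit d (E : ℝ)) :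
    IsIntUnit E where
  ne_zero := by rintro rfl; exact h.ne_zero (by simp)
  isIntegral := (isIntegral_algHom_iff (algebraMap K ℝ).toIntAlgHom
    (algebraMap K ℝ).injective).1 h.isIntegral
  isIntegral_inv := by
    refine (isIntegral_algHom_iff (algebraMap K ℝ).toIntAlgHom (algebraMap K ℝ).injective).1 ?_
    change IsIntegral ℤ (algebraMap K ℝ E⁻¹)
    rw [map_inv₀]
    exact h.inv.isIntegral

lemma HasSquareClass.exists_eq_mul_sq {d t : ℕ} {e : ℝ} (h : HasSquareClass d e t) {r : K}
    (hr : (r : ℝ) = √(d : ℝ)) : ∃ E z : K, (E : ℝ) = e ∧ E = t * z ^ 2 ∧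
      ∀ τ : K ≃ₐ[ℚ] K, τ r = r → τ z = z := by
  obtain ⟨A, B, h⟩ := h
  refine ⟨t * (algebraMap ℚ K A + algebraMap ℚ K B * r) ^ 2,
    algebraMap ℚ K A + algebraMap ℚ K B * r, ?_, rfl, fun τ hτ => ?_⟩
  · rw [h, ← hr]
    simp
  · rw [map_add, map_mul, AlgEquiv.commutes, AlgEquiv.commutes, hτ]

end

lemma exists_quadUnitData {p q s : ℕ} (hp : p.Prime) (hq : q.Prime) (hs : s.Prime)
    (hpq : p ≠ q) (hps : p ≠ s) (hqs : q ≠ s) (hp2 : p ≠ 2) (hq2 : q ≠ 2) (hs2 : s ≠ 2)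
    {e2 epq e2pq eps e2ps eqs e2qs : ℝ}
    (he2 : IsFundamentalUnit 2 e2)
    (hepq : IsFundamentalUnit (p * q) epq)
    (he2pq : IsFundamentalUnit (2 * p * q) e2pq)
    (heps : IsFundamentalUnit (p * s) eps)
    (he2ps : IsFundamentalUnit (2 * p * s) e2ps)
    (heqs : IsFundamentalUnit (q * s) eqs)
    (he2qs : IsFundamentalUnit (2 * q * s) e2qs)
    (cpq : HasSquareClass (p * q) epq (2 * p))
    (c2pq : HasSquareClass (2 * p * q) e2pq p)
    (cps : HasSquareClass (p * s) eps (2 * p))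
    (c2ps : HasSquareClass (2 * p * s) e2ps p)
    (cqs : HasSquareClass (q * s) eqs q)
    (c2qs : HasSquareClass (2 * q * s) e2qs q) :
    ∃ D : QuadUnitData (Lplus p q s) p q s, (D.E2 : ℝ) = e2 ∧ (D.Epq : ℝ) = epq ∧
      (D.E2pq : ℝ) = e2pq ∧ (D.Eps : ℝ) = eps ∧ (D.E2ps : ℝ) = e2ps ∧ (D.Eqs : ℝ) = eqs ∧
      (D.E2qs : ℝ) = e2qs := by
  have hK : Lplus p q s = adjoin ℚ {√((2 : ℕ) : ℝ), √((p * q : ℕ) : ℝ), √((p * s : ℕ) : ℝ)} := by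
    simp [Lplus]
  obtain ⟨a, b, c, ha, hb, hc, σ₁, σ₂, σ₃, hframe, h₁, h₂, h₃⟩ := exists_isFrame hK
    (not_isSquare_of_odd_exponent Nat.prime_two hp hq hs hp2.symm hq2.symm hs2.symm 0 0 0 (by ring))
    (not_isSquare_of_odd_exponent hp Nat.prime_two hq hs hp2 hpq hps 0 1 0 (by ring))
    (not_isSquare_of_odd_exponent hp Nat.prime_two hq hs hp2 hpq hps 0 0 1 (by ring))
    (not_isSquare_of_odd_exponent hp Nat.prime_two hq hs hp2 hpq hps 1 1 0 (by ring))
    (not_isSquare_of_odd_exponent hp Nat.prime_two hq hs hp2 hpq hps 1 0 1 (by ring))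
    (not_isSquare_of_odd_exponent hq Nat.prime_two hp hs hq2 hpq.symm hqs 0 2 1 (by ring))
    (not_isSquare_of_odd_exponent hq Nat.prime_two hp hs hq2 hpq.symm hqs 1 2 1 (by ring))
  generalize Lplus p q s = K at *
  have hbc : ((b * c / p : K) : ℝ) = √((q * s : ℕ) : ℝ) := coe_mul_div_eq_sqrt hp.ne_zero hb hc
  have h2 : (1 + √((2 : ℕ) : ℝ)) * (1 - √((2 : ℕ) : ℝ)) = -1 := by
    have := Real.sq_sqrt (Nat.cast_nonneg (α := ℝ) 2)
    push_cast at this ⊢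
    linarith
  obtain ⟨Epq, zpq, vpq, epq_eq, fpq⟩ := cpq.exists_eq_mul_sq hb
  obtain ⟨E2pq, z2pq, v2pq, e2pq_eq, -⟩ := c2pq.exists_eq_mul_sq (r := a * b)
    (by rw [MulMemClass.coe_mul, ha, hb, sqrt_two_mul_mul])
  obtain ⟨Eps, zps, vps, eps_eq, fps⟩ := cps.exists_eq_mul_sq hc
  obtain ⟨E2ps, z2ps, v2ps, e2ps_eq, f2ps⟩ := c2ps.exists_eq_mul_sq (r := a * c)
    (by rw [MulMemClass.coe_mul, ha, hc, sqrt_two_mul_mul])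
  obtain ⟨Eqs, zqs, vqs, eqs_eq, fqs⟩ := cqs.exists_eq_mul_sq hbc
  obtain ⟨E2qs, z2qs, v2qs, e2qs_eq, f2qs⟩ := c2qs.exists_eq_mul_sq (r := (a * (b * c / p) : K))
    (by rw [MulMemClass.coe_mul, ha, hbc, sqrt_two_mul_mul])
  have vE2 : ((1 + a : K) : ℝ) = e2 := by
    rw [he2.eq_one_add_sqrt_two, ← ha]
    simp
  subst vE2 vpq v2pq vps v2ps vqs v2qs
  refine ⟨⟨a, b, c, σ₁, σ₂, σ₃, 1 + a, Epq, E2pq, Eps, E2ps, Eqs, E2qs, zpq, z2pq, zps, z2ps, zqs,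
    z2qs, hframe, ha, hb, hc, h₁, h₂, h₃, hp, hq, hs, hpq, hps, hqs, hp2, hq2, hs2, he2, hepq,
    he2pq, heps, he2ps, heqs, he2qs, ?_, by simpa using epq_eq, e2pq_eq, by simpa using eps_eq,
    e2ps_eq, eqs_eq, e2qs_eq, fpq, fps, f2ps, fun τ hτ => fqs τ ?_, fun τ hτ => f2qs τ ?_⟩,
    rfl, rfl, rfl, rfl, rfl, rfl, rfl⟩
  · have h' : (1 + a) * (1 - a) = -1 := Subtype.ext (by simpa [ha] using h2)
    have h0 : 1 + a ≠ 0 := fun h0 => by simp [h0] at h'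
    rw [map_add, map_one, h₁.1, ← sub_eq_add_neg, eq_neg_iff_add_eq_zero]
    field_simp
    linear_combination h'
  · rw [map_div₀, hτ, map_natCast]
  · rw [← mul_div_assoc, map_div₀, hτ, map_natCast]

lemma sq_eq_sq_of_sq_roots {F : Type*} [Field F] {u e f₀ f₁ f₂ f₃ f₄ f₅ g₁ g₂ g₃ g₄ g₅ : F}
    {n c x₀ x₁ x₂ x₃ x₄ x₅ : ℤ} (n₀ : f₀ ≠ 0) (n₂ : f₂ ≠ 0) (n₄ : f₄ ≠ 0)
    (hu : u ^ 2 = e ^ (2 * n) *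
      (f₀ ^ x₀ * f₁ ^ x₁ * f₂ ^ x₂ * f₃ ^ x₃ * f₄ ^ x₄ * f₅ ^ x₅))
    (h₁ : g₁ ^ 2 = f₀ * f₁) (h₂ : g₂ ^ 2 = f₂ * f₃) (h₃ : g₃ ^ 2 = f₄ * f₅)
    (h₄ : g₄ ^ 2 = f₀ * f₂) (h₅ : g₅ ^ 2 = f₀ * f₄)
    (hc : x₀ = 2 * c + x₁ + (x₂ - x₃) + (x₄ - x₅)) :
    u ^ 2 = (e ^ n * f₀ ^ c * g₁ ^ x₁ * g₂ ^ x₃ * g₃ ^ x₅ * g₄ ^ (x₂ - x₃) *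
      g₅ ^ (x₄ - x₅)) ^ 2 := by
  have sq_zpow (z : F) (m : ℤ) : (z ^ m) ^ 2 = (z ^ 2) ^ m := by
    rw [← zpow_natCast, ← zpow_natCast, zpow_comm]
  have hx₂ : f₂ ^ x₂ = f₂ ^ x₃ * f₂ ^ (x₂ - x₃) := by rw [← zpow_add₀ n₂]; congr 1; ring
  have hx₄ : f₄ ^ x₄ = f₄ ^ x₅ * f₄ ^ (x₄ - x₅) := by rw [← zpow_add₀ n₄]; congr 1; ring
  rw [hu, hc, hx₂, hx₄, zpow_add₀ n₀, zpow_add₀ n₀, zpow_add₀ n₀]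
  simp only [mul_pow, sq_zpow g₁, sq_zpow g₂, sq_zpow g₃, sq_zpow g₄, sq_zpow g₅, h₁, h₂, h₃, h₄,
    h₅, mul_zpow, mul_comm (2 : ℤ), zpow_mul]
  norm_cast
  ring

lemma QuadUnitData.exists_generators {K : IntermediateField ℚ ℝ} {p q s : ℕ}
    (D : QuadUnitData K p q s) :
    ∃ u₂ upq ξ₁ ξ₂ ξ₃ ξ₄ ξ₅ : (𝓞 K)ˣ,
      unitVal u₂ = D.E2 ∧ unitVal upq = D.Epq ∧
      unitVal ξ₁ ^ 2 = D.Epq * D.E2pq ∧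
      unitVal ξ₂ ^ 2 = D.Eps * D.E2ps ∧
      unitVal ξ₃ ^ 2 = D.Eqs * D.E2qs ∧
      unitVal ξ₄ ^ 2 = D.Epq * D.Eps ∧
      unitVal ξ₅ ^ 2 = D.Epq * D.Eqs ∧
      Subgroup.closure ({-1, u₂, upq, ξ₁, ξ₂, ξ₃, ξ₄, ξ₅} : Set (𝓞 K)ˣ) = ⊤ := by
  have ha2 : D.a ^ 2 = 2 := Subtype.ext (by
    rw [SubmonoidClass.coe_pow, D.a_coe, Real.sq_sqrt (Nat.cast_nonneg _)]; rfl)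
  have hb2 : D.b ^ 2 = p * q := Subtype.ext (by
    rw [SubmonoidClass.coe_pow, D.b_coe, Real.sq_sqrt (Nat.cast_nonneg _)]; simp)
  have i2 := D.hE2.1.isSignedQuadUnit.isIntUnit
  have ipq := D.hEpq.1.isSignedQuadUnit.isIntUnit
  have i2pq := D.hE2pq.1.isSignedQuadUnit.isIntUnit
  have ips := D.hEps.1.isSignedQuadUnit.isIntUnit
  have i2ps := D.hE2ps.1.isSignedQuadUnit.isIntUnit
  have iqs := D.hEqs.1.isSignedQuadUnit.isIntUnit
  have i2qs := D.hE2qs.1.isSignedQuadUnit.isIntUnit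
  have exists_root {y z w : K} (hy : IsIntUnit y) (hz : IsIntUnit z) (hw : w ^ 2 = y * z) :
      ∃ ξ : (𝓞 K)ˣ, ((ξ : 𝓞 K) : K) ^ 2 = y * z :=
    ⟨(IsIntUnit.of_sq (hw ▸ hy.mul hz)).toUnits, hw⟩
  obtain ⟨ξ₁, h₁⟩ := exists_root ipq i2pq (w := p * D.a * D.zpq * D.z2pq) (by
    rw [D.Epq_eq, D.E2pq_eq]
    linear_combination (p * D.zpq * D.z2pq) ^ 2 * ha2)
  obtain ⟨ξ₂, h₂⟩ := exists_root ips i2ps (w := p * D.a * D.zps * D.z2ps) (by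
    rw [D.Eps_eq, D.E2ps_eq]
    linear_combination (p * D.zps * D.z2ps) ^ 2 * ha2)
  obtain ⟨ξ₃, h₃⟩ := exists_root iqs i2qs (w := q * D.zqs * D.z2qs) (by
    rw [D.Eqs_eq, D.E2qs_eq]
    ring)
  obtain ⟨ξ₄, h₄⟩ := exists_root ipq ips (w := 2 * p * D.zpq * D.zps) (by
    rw [D.Epq_eq, D.Eps_eq]
    ring)
  obtain ⟨ξ₅, h₅⟩ := exists_root ipq iqs (w := D.a * D.b * D.zpq * D.zqs) (by
    rw [D.Epq_eq, D.Eqs_eq]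
    linear_combination (D.zpq * D.zqs) ^ 2 * (D.b ^ 2 * ha2 + 2 * hb2))
  refine ⟨i2.toUnits, ipq.toUnits, ξ₁, ξ₂, ξ₃, ξ₄, ξ₅, rfl, rfl, congrArg Subtype.val h₁,
    congrArg Subtype.val h₂, congrArg Subtype.val h₃, congrArg Subtype.val h₄,
    congrArg Subtype.val h₅, (Subgroup.eq_top_iff' _).2 fun u => ?_⟩
  set S : Set (𝓞 K)ˣ := {-1, i2.toUnits, ipq.toUnits, ξ₁, ξ₂, ξ₃, ξ₄, ξ₅} with hS
  have mem {v : (𝓞 K)ˣ} (hv : v ∈ S) (m : ℤ) : v ^ m ∈ Subgroup.closure S :=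
    zpow_mem (Subgroup.subset_closure hv) m
  obtain ⟨n, x, hu, m, hm⟩ := D.exists_sq_eq (IsIntUnit.coe_units u)
  have hsq := sq_eq_sq_of_sq_roots (c := m - x 1 - x 2 - x 4) ipq.ne_zero ips.ne_zero iqs.ne_zero
    (by rw [hu, two_mul]; rfl) h₁ h₂ h₃ h₄ h₅ (by lia)
  set g : (𝓞 K)ˣ := i2.toUnits ^ n * ipq.toUnits ^ (m - x 1 - x 2 - x 4) * ξ₁ ^ x 1 * ξ₂ ^ x 3 *
    ξ₃ ^ x 5 * ξ₄ ^ (x 2 - x 3) * ξ₅ ^ (x 4 - x 5) with hg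
  have hgS : g ∈ Subgroup.closure S := by
    refine mul_mem (mul_mem (mul_mem (mul_mem (mul_mem (mul_mem (mem ?_ _) (mem ?_ _)) (mem ?_ _))
      (mem ?_ _)) (mem ?_ _)) (mem ?_ _)) (mem ?_ _) <;> simp [hS]
  have hgK : ((u : 𝓞 K) : K) ^ 2 = ((g : 𝓞 K) : K) ^ 2 := by
    rw [hsq, hg]
    simp [Units.coe_zpow, IsIntUnit.coe_toUnits]
  rcases sq_eq_sq_iff_eq_or_eq_neg.1 hgK with h | h
  · rwa [Units.ext (RingOfIntegers.ext h)]
  · have : u = -1 * g := Units.ext (RingOfIntegers.ext (by simpa using h))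
    rw [this]
    exact mul_mem (Subgroup.subset_closure (by simp [hS])) hgS

/-- Let `p, q, s` be distinct primes with `p ≡ 5 (mod 8)`, `s ≡ 3 (mod 8)`,
`q ≡ 7 (mod 8)` and `(p/q) = (p/s) = (s/q) = -1`.  Then there exist units
`ξ₁, …, ξ₅` of the ring of integers of `L⁺ = ℚ(√2, √(pq), √(ps))` with
`ξ₁² = ε_{pq}·ε_{2pq}`, `ξ₂² = ε_{ps}·ε_{2ps}`, `ξ₃² = ε_{qs}·ε_{2qs}`,
`ξ₄² = ε_{pq}·ε_{ps}`, `ξ₅² = ε_{pq}·ε_{qs}` (as real numbers), such that the unit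
group of the ring of integers of `L⁺` is generated by
`-1, ε₂, ε_{pq}, ξ₁, ξ₂, ξ₃, ξ₄, ξ₅`. -/
theorem statement_14 (p q s : ℕ) (hp : p.Prime) (hq : q.Prime) (hs : s.Prime)
    (hpq : p ≠ q) (hps : p ≠ s) (hqs : q ≠ s)
    (hp8 : p % 8 = 5) (hs8 : s % 8 = 3) (hq8 : q % 8 = 7)
    (hleg1 : @legendreSym q ⟨hq⟩ (p : ℤ) = -1)
    (hleg2 : @legendreSym s ⟨hs⟩ (p : ℤ) = -1)
    (hleg3 : @legendreSym q ⟨hq⟩ (s : ℤ) = -1)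
    (e2 epq e2pq eps e2ps eqs e2qs : ℝ)
    (he2 : IsFundamentalUnit 2 e2)
    (hepq : IsFundamentalUnit (p * q) epq)
    (he2pq : IsFundamentalUnit (2 * p * q) e2pq)
    (heps : IsFundamentalUnit (p * s) eps)
    (he2ps : IsFundamentalUnit (2 * p * s) e2ps)
    (heqs : IsFundamentalUnit (q * s) eqs)
    (he2qs : IsFundamentalUnit (2 * q * s) e2qs) :
    ∃ u₂ upq ξ₁ ξ₂ ξ₃ ξ₄ ξ₅ : (𝓞 ↥(Lplus p q s))ˣ,
      unitVal u₂ = e2 ∧ unitVal upq = epq ∧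
      (unitVal ξ₁) ^ 2 = epq * e2pq ∧
      (unitVal ξ₂) ^ 2 = eps * e2ps ∧
      (unitVal ξ₃) ^ 2 = eqs * e2qs ∧
      (unitVal ξ₄) ^ 2 = epq * eps ∧
      (unitVal ξ₅) ^ 2 = epq * eqs ∧
      Subgroup.closure ({-1, u₂, upq, ξ₁, ξ₂, ξ₃, ξ₄, ξ₅} :
        Set (𝓞 ↥(Lplus p q s))ˣ) = ⊤ := by
  have : Fact p.Prime := ⟨hp⟩
  have : Fact q.Prime := ⟨hq⟩
  have : Fact s.Prime := ⟨hs⟩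
  have hp2 : p ≠ 2 := by lia
  have hq2 : q ≠ 2 := by lia
  have hs2 : s ≠ 2 := by lia
  have hp4 : p % 4 = 1 := by lia
  have hq4 : q % 4 = 3 := by lia
  have hs4 : s % 4 = 3 := by lia
  have p_neg : legendreSym p (-1) = 1 := by
    rw [legendreSym.at_neg_one hp2, ZMod.χ₄_nat_one_mod_four hp4]
  have q_neg : legendreSym q (-1) = -1 := by
    rw [legendreSym.at_neg_one hq2, ZMod.χ₄_nat_three_mod_four hq4]
  have p_two : legendreSym p 2 = -1 := by
    rw [legendreSym.at_two hp2, ZMod.χ₈_nat_eq_if_mod_eight, hp8]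
    lia
  have q_two : legendreSym q 2 = 1 := by
    rw [legendreSym.at_two hq2, ZMod.χ₈_nat_eq_if_mod_eight, hq8]
    lia
  have s_two : legendreSym s 2 = -1 := by
    rw [legendreSym.at_two hs2, ZMod.χ₈_nat_eq_if_mod_eight, hs8]
    lia
  have p_q : legendreSym p q = -1 := by
    rw [← legendreSym.quadratic_reciprocity_one_mod_four hp4 hq2, hleg1]
  have p_s : legendreSym p s = -1 := by
    rw [← legendreSym.quadratic_reciprocity_one_mod_four hp4 hs2, hleg2]
  have s_q : legendreSym s q = 1 := by
    rw [legendreSym.quadratic_reciprocity_three_mod_four hq4 hs4, hleg3, neg_neg]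
  obtain ⟨D, rfl, rfl, rfl, rfl, rfl, rfl, rfl⟩ := exists_quadUnitData hp hq hs hpq hps hqs hp2 hq2
    hs2 he2 hepq he2pq heps he2ps heqs he2qs
    (hepq.hasSquareClass_two_mul hpq hp2 hq4 p_neg p_two p_q)
    (he2pq.hasSquareClass_of_two_mul hpq hp2 hq4 p_neg p_two p_q)
    (heps.hasSquareClass_two_mul hps hp2 hs4 p_neg p_two p_s)
    (he2ps.hasSquareClass_of_two_mul hps hp2 hs4 p_neg p_two p_s)
    (heqs.hasSquareClass_left hqs hq4 hs4 q_neg q_two hleg3 s_two s_q)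
    (he2qs.hasSquareClass_left_of_two_mul hqs hq4 hs4 q_neg q_two hleg3 s_two s_q)
  exact D.exists_generators
end
end
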